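/- Let α > 0 and let h be a real-valued function in L^∞_loc((0,∞)); if α ≥ 1/2, assume also h ∈ C^{N(α)}((0,∞)). Suppose that for some κ₀, κ_∞ ∈ ℝ and all m = 0, …, N(α): (d/dt)^m (h(t) − κ₀ t^{-1} (log(1/t))^{−α}) = o(t^{−1−m} ⟨log t⟩^{−α}) as t → 0, and (d/dt)^m (h(t) − κ_∞ t^{-1} (log t)^{−α}) = o(t^{−1−m} ⟨log t⟩^{−α}) as t → ∞. Then the eigenvalues of the Hankel operator H with kernel h satisfy λ_n^±(H) = a^± n^{−α} + o(n^{−α}) as n → ∞, where a^± = τ(α) ((κ₀)_±^{1/α} + (κ_∞)_±^{1/α})^α. -/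

import Mathlib

noncomputable section
open MeasureTheory Filter Asymptotics Set

/-- Lebesgue measure restricted to `(0, ∞)`. -/
abbrev muP : Measure ℝ := volume.restrict (Set.Ioi (0:ℝ))

/-- The Hilbert space `L²((0,∞))`. -/
abbrev HSp := Lp ℂ 2 muP

/-- The Hilbert space `L²(ℝ)`. -/
abbrev HLine := Lp ℂ 2 (volume : Measure ℝ)

/-- The Hilbert space `ℓ²(ℤ₊)`. -/
abbrev ellTwo := lp (fun _ : ℕ => ℂ) 2

/-- `H` is the Hankel operator with kernel `h` : `(Hu)(t) = ∫₀^∞ h(t+s) u(s) ds`. -/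
def IsHankel (h : ℝ → ℂ) (H : HSp →L[ℂ] HSp) : Prop :=
  ∀ u : HSp, ∀ᵐ t ∂muP, (H u : ℝ → ℂ) t = ∫ s in Set.Ioi (0:ℝ), h (t + s) * (u : ℝ → ℂ) s

/-- `G` is the discrete Hankel operator with matrix elements `g` :
`(Gu)(j) = ∑ₖ g(j+k) u(k)`. -/
def IsHankelD (g : ℕ → ℂ) (G : ellTwo →L[ℂ] ellTwo) : Prop :=
  ∀ u : ellTwo, ∀ j : ℕ, (G u : ℕ → ℂ) j = ∑' k : ℕ, g (j + k) * (u : ℕ → ℂ) k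

/-- `λₙ⁺(K)`, the `n`-th positive eigenvalue (non-increasing, with multiplicity) of a compact
self-adjoint operator `K`, expressed through the Courant–Fischer max-min principle
(the value is `0` if `K` has fewer than `n` positive eigenvalues). -/
def posEig {E : Type*} [NormedAddCommGroup E] [InnerProductSpace ℂ E]
    (K : E →L[ℂ] E) (n : ℕ) : ℝ :=
  ⨆ V : {V : Submodule ℂ E // Module.finrank ℂ V = n},
    ⨅ x : {x : E // x ∈ V.1 ∧ ‖x‖ = 1}, (@inner ℂ E _ (K x.1) x.1).re

/-- `λₙ⁻(K) = λₙ⁺(-K)`. -/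
def negEig {E : Type*} [NormedAddCommGroup E] [InnerProductSpace ℂ E]
    (K : E →L[ℂ] E) (n : ℕ) : ℝ := posEig (-K) n

/-- `sₙ(K)`, the `n`-th singular value of a compact operator `K`, via the max–min principle. -/
def singVal {E : Type*} [NormedAddCommGroup E] [InnerProductSpace ℂ E]
    (K : E →L[ℂ] E) (n : ℕ) : ℝ :=
  ⨆ V : {V : Submodule ℂ E // Module.finrank ℂ V = n},
    ⨅ x : {x : E // x ∈ V.1 ∧ ‖x‖ = 1}, ‖K x.1‖

/-- `N(α) = [α] + 1` if `α ≥ 1/2`, and `N(α) = 0` if `α < 1/2`. -/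
def Nal (α : ℝ) : ℕ := if α < 1/2 then 0 else Nat.floor α + 1

/-- The constant `τ(α) = 2^{-α} π^{1-2α} B(1/(2α), 1/2)^α`. -/
def tauC (α : ℝ) : ℝ :=
  (2:ℝ) ^ (-α) * Real.pi ^ (1 - 2*α) *
    (Real.Gamma (1/(2*α)) * Real.Gamma (1/2) / Real.Gamma (1/(2*α) + 1/2)) ^ α

/-- Iterated differences of a sequence: `g⁽⁰⁾ = g`, `g⁽ᵐ⁾(j) = g⁽ᵐ⁻¹⁾(j+1) - g⁽ᵐ⁻¹⁾(j)`. -/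
def iterDiff {E : Type*} [Sub E] (g : ℕ → E) : ℕ → ℕ → E
  | 0 => g
  | m + 1 => fun j => iterDiff g m (j + 1) - iterDiff g m j

/-- The standard function `v(x) = √π / √(cosh πx)`. -/
def vStd (x : ℝ) : ℝ := Real.sqrt Real.pi / Real.sqrt (Real.cosh (Real.pi * x))

/-- The Fourier transform `(Φw)(ξ) = (2π)^{-1/2} ∫ e^{-ixξ} w(x) dx`. -/
def fou (w : ℝ → ℂ) (ξ : ℝ) : ℂ :=
  (((2 * Real.pi) ^ (-(1:ℝ)/2) : ℝ) : ℂ) * ∫ x : ℝ, Complex.exp (-(Complex.I * x * ξ)) * w x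

/-- `h ∈ L^∞_loc((0,∞))`. -/
def LinftyLoc {E : Type*} [NormedAddCommGroup E] (h : ℝ → E) : Prop :=
  AEStronglyMeasurable h muP ∧
    ∀ K : Set ℝ, IsCompact K → K ⊆ Set.Ioi 0 → ∃ C, ∀ᵐ t ∂muP, t ∈ K → ‖h t‖ ≤ C

/-- The quadratic-form characterization of the pseudodifferential operator
`A = v(X) s(D) v(X)` on `L²(ℝ)`:  `⟪g, A f⟫ = ∫ conj((Φ(v·g))(ξ)) s(ξ) (Φ(v·f))(ξ) dξ`
for all `f, g` represented by smooth compactly supported functions. -/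
def IsVSDV (v : ℝ → ℝ) (s : ℝ → ℂ) (A : HLine →L[ℂ] HLine) : Prop :=
  ∀ (f g : HLine) (F G : ℝ → ℂ),
    ContDiff ℝ (⊤ : ℕ∞) F → HasCompactSupport F → ContDiff ℝ (⊤ : ℕ∞) G → HasCompactSupport G →
    (f : ℝ → ℂ) =ᵐ[volume] F → (g : ℝ → ℂ) =ᵐ[volume] G →
    (@inner ℂ HLine _ g (A f)) =
      ∫ ξ : ℝ, (starRingEnd ℂ) (fou (fun x => (v x : ℂ) * G x) ξ) * s ξ *
        fou (fun x => (v x : ℂ) * F x) ξ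

section Variational

variable {E : Type*} [NormedAddCommGroup E] [InnerProductSpace ℂ E]

/-- A subspace of dimension at least `n + S.card` contains an `n`-dimensional subspace
orthogonal to `S`. -/
theorem exists_submodule_orthogonal (V₀ : Submodule ℂ E) [FiniteDimensional ℂ V₀] (S : Finset E)
    (n : ℕ) (hn : n + S.card ≤ Module.finrank ℂ V₀) :
    ∃ V : Submodule ℂ E, V ≤ V₀ ∧ Module.finrank ℂ V = n ∧
      ∀ x ∈ V, ∀ v ∈ S, @inner ℂ E _ v x = 0 := by
  let f : V₀ →ₗ[ℂ] (S → ℂ) := LinearMap.pi fun v =>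
    ((innerSL ℂ (v : E)).toLinearMap).comp V₀.subtype
  have h1 := LinearMap.finrank_range_add_finrank_ker f
  have h2 : Module.finrank ℂ f.range ≤ S.card := by
    refine (Submodule.finrank_le _).trans ?_
    simp
  have h3 : n ≤ Module.finrank ℂ f.ker := by omega
  obtain ⟨w, hw⟩ := exists_linearIndependent_of_le_finrank h3
  let w' : Fin n → E := fun i => ((w i : V₀) : E)
  have hw' : LinearIndependent ℂ w' := by
    have := (hw.map' f.ker.subtype (Submodule.ker_subtype _)).map' V₀.subtype
      (Submodule.ker_subtype _)
    exact this
  refine ⟨Submodule.span ℂ (Set.range w'), ?_, ?_, ?_⟩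
  · rw [Submodule.span_le]
    rintro _ ⟨i, rfl⟩
    exact (w i : V₀).2
  · rw [finrank_span_eq_card hw']; simp
  · intro x hx v hv
    have hle : Submodule.span ℂ (Set.range w') ≤ (innerSL ℂ v).toLinearMap.ker := by
      rw [Submodule.span_le]
      rintro _ ⟨i, rfl⟩
      have := (w i).2
      rw [LinearMap.mem_ker] at this
      have := congrFun this ⟨v, hv⟩
      simpa [f] using this
    have := hle hx
    simpa using this

theorem abs_re_inner_le (K : E →L[ℂ] E) {x : E} (hx : ‖x‖ = 1) :
    |(@inner ℂ E _ (K x) x).re| ≤ ‖K‖ := by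
  refine (Complex.abs_re_le_norm _).trans ((norm_inner_le_norm _ _).trans ?_)
  rw [hx, mul_one]
  simpa [hx] using K.le_opNorm x

theorem bddBelow_form (K : E →L[ℂ] E) (V : Submodule ℂ E) :
    BddBelow (Set.range fun x : {x : E // x ∈ V ∧ ‖x‖ = 1} =>
      (@inner ℂ E _ (K x.1) x.1).re) := by
  refine ⟨-‖K‖, ?_⟩
  rintro _ ⟨x, rfl⟩
  exact (abs_le.1 (abs_re_inner_le K x.2.2)).1

theorem posEig_le (K : E →L[ℂ] E) (n : ℕ) {Θ : ℝ} (hΘ : 0 ≤ Θ) (S : Finset E) (hS : S.card < n)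
    (h : ∀ u : E, (∀ v ∈ S, @inner ℂ E _ v u = 0) → (@inner ℂ E _ (K u) u).re ≤ Θ * ‖u‖ ^ 2) :
    posEig K n ≤ Θ := by
  unfold posEig
  refine Real.iSup_le (fun V => ?_) hΘ
  have hfd : FiniteDimensional ℂ V.1 := by
    apply Module.finite_of_finrank_pos
    rw [V.2]; omega
  obtain ⟨W, hW, hW1, hW2⟩ := exists_submodule_orthogonal V.1 S 1 (by rw [V.2]; omega)
  have hne : Nontrivial W := Module.nontrivial_of_finrank_pos (R := ℂ) (by rw [hW1]; norm_num)
  obtain ⟨x, hx⟩ := exists_ne (0 : W)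
  have hx0 : ‖(x : E)‖ ≠ 0 := by simpa using hx
  let y : E := ((‖(x : E)‖⁻¹ : ℝ) : ℂ) • (x : E)
  have hyW : y ∈ W := W.smul_mem _ x.2
  have hy1 : ‖y‖ = 1 := by
    simp only [y, norm_smul, Complex.norm_real, norm_inv, norm_norm]
    exact inv_mul_cancel₀ hx0
  refine (ciInf_le (bddBelow_form K V.1) ⟨y, hW hyW, hy1⟩).trans ?_
  have := h y (hW2 y hyW)
  rw [hy1] at this
  simpa using this

theorem le_posEig (K : E →L[ℂ] E) (n : ℕ) (hn : 1 ≤ n) {Θ : ℝ} (V : Submodule ℂ E)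
    (hV : Module.finrank ℂ V = n)
    (h : ∀ u ∈ V, Θ * ‖u‖ ^ 2 ≤ (@inner ℂ E _ (K u) u).re) :
    Θ ≤ posEig K n := by
  unfold posEig
  have hne : ∀ V : {V : Submodule ℂ E // Module.finrank ℂ V = n},
      Nonempty {x : E // x ∈ V.1 ∧ ‖x‖ = 1} := by
    intro V
    have : Nontrivial V.1 := Module.nontrivial_of_finrank_pos (R := ℂ) (by rw [V.2]; omega)
    obtain ⟨x, hx⟩ := exists_ne (0 : V.1)
    have hx0 : ‖(x : E)‖ ≠ 0 := by simpa using hx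
    refine ⟨((‖(x : E)‖⁻¹ : ℝ) : ℂ) • (x : E), V.1.smul_mem _ x.2, ?_⟩
    simp only [norm_smul, Complex.norm_real, norm_inv, norm_norm]
    exact inv_mul_cancel₀ hx0
  have hbdd : BddAbove (Set.range fun V : {V : Submodule ℂ E // Module.finrank ℂ V = n} =>
      ⨅ x : {x : E // x ∈ V.1 ∧ ‖x‖ = 1}, (@inner ℂ E _ (K x.1) x.1).re) := by
    refine ⟨‖K‖, ?_⟩
    rintro _ ⟨W, rfl⟩
    obtain ⟨x⟩ := hne W
    exact (ciInf_le (bddBelow_form K W.1) x).trans (abs_le.1 (abs_re_inner_le K x.2.2)).2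
  refine le_trans ?_ (le_ciSup hbdd ⟨V, hV⟩)
  have := hne ⟨V, hV⟩
  refine le_ciInf fun x => ?_
  have := h x.1 x.2.1
  rw [x.2.2] at this
  simpa using this

/-- If `Q` is within `β` of the diagonal form `∑ mᵢ |⟨eᵢ, u⟩|²` off a finite set of vectors, then
the positive eigenvalues are bounded above accordingly. -/
theorem posEig_le_of_diag (K : E →L[ℂ] E) {ι : Type*} (e : ι → E) (he : Orthonormal ℂ e)
    (m : ι → ℝ) (β Θ : ℝ) (hβ : 0 ≤ β) (hΘ : 0 ≤ Θ) (S : Finset E)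
    (hS : ∀ u : E, (∀ v ∈ S, @inner ℂ E _ v u = 0) → (@inner ℂ E _ (K u) u).re
      ≤ ∑' i, m i * ‖@inner ℂ E _ (e i) u‖ ^ 2 + β * ‖u‖ ^ 2)
    (F : Finset ι) (hF : ∀ i ∉ F, m i ≤ Θ)
    (n : ℕ) (hn : S.card + F.card < n) : posEig K n ≤ Θ + β := by
  classical
  refine posEig_le K n (by positivity) (S ∪ F.image e) ?_ ?_
  · have h1 := Finset.card_union_le S (F.image e)
    have h2 := Finset.card_image_le (s := F) (f := e)
    omega
  · intro u hu
    refine (hS u fun v hv => hu v (Finset.mem_union_left _ hv)).trans ?_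
    rw [add_mul]
    gcongr
    have hsum : Summable fun i => ‖@inner ℂ E _ (e i) u‖ ^ 2 := he.inner_products_summable u
    by_cases hs : Summable fun i => m i * ‖@inner ℂ E _ (e i) u‖ ^ 2
    · calc _ ≤ ∑' i, Θ * ‖@inner ℂ E _ (e i) u‖ ^ 2 := by
            refine hs.tsum_le_tsum (fun i => ?_) (hsum.mul_left Θ)
            by_cases hi : i ∈ F
            · rw [hu (e i) (Finset.mem_union_right _ (Finset.mem_image_of_mem _ hi))]; simp
            · gcongr
              exact hF i hi
        _ ≤ _ := by
            rw [tsum_mul_left]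
            gcongr
            exact he.tsum_inner_products_le u
    · rw [tsum_eq_zero_of_not_summable hs]; positivity

theorem le_posEig_of_diag (K : E →L[ℂ] E) {ι : Type*} (e : ι → E) (he : Orthonormal ℂ e)
    (m : ι → ℝ) (β Θ : ℝ) (S : Finset E)
    (hS : ∀ u : E, (∀ v ∈ S, @inner ℂ E _ v u = 0) →
      ∑' i, m i * ‖@inner ℂ E _ (e i) u‖ ^ 2 - β * ‖u‖ ^ 2 ≤ (@inner ℂ E _ (K u) u).re)
    (F : Finset ι) (hF : ∀ i ∈ F, Θ ≤ m i)
    (n : ℕ) (hn1 : 1 ≤ n) (hn : n + S.card ≤ F.card) : Θ - β ≤ posEig K n := by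
  classical
  let e' : F → E := fun i => e i
  have he' : Orthonormal ℂ e' := he.comp _ Subtype.val_injective
  let V₀ : Submodule ℂ E := Submodule.span ℂ (Set.range e')
  have hfin : Module.finrank ℂ V₀ = F.card := by
    rw [finrank_span_eq_card he'.linearIndependent]; simp
  have : FiniteDimensional ℂ V₀ := FiniteDimensional.span_of_finite ℂ (Set.finite_range _)
  obtain ⟨V, hV, hVn, hVS⟩ := exists_submodule_orthogonal V₀ S n (by omega)
  refine le_posEig K n hn1 V hVn fun u hu => ?_
  refine le_trans ?_ (hS u (hVS u hu))
  rw [sub_mul]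
  gcongr
  have hz : ∀ i ∉ F, @inner ℂ E _ (e i) u = 0 := by
    intro i hi
    have hle : V₀ ≤ (innerSL ℂ (e i)).toLinearMap.ker := by
      rw [Submodule.span_le]
      rintro _ ⟨j, rfl⟩
      have : i ≠ j := fun h => hi (h ▸ j.2)
      simpa [e'] using he.2 this
    simpa using hle (hV hu)
  rw [tsum_eq_sum (s := F) (fun i hi => by rw [hz i hi]; simp)]
  have hnorm : ‖u‖ ^ 2 = ∑ i ∈ F, ‖@inner ℂ E _ (e i) u‖ ^ 2 := by
    obtain ⟨c, hc⟩ := (Submodule.mem_span_range_iff_exists_fun ℂ).1 (hV hu)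
    have hin : ∀ i : F, @inner ℂ E _ (e' i) u = c i := by
      intro i; rw [← hc]; exact he'.inner_right_fintype c i
    have h1 : @inner ℂ E _ u u = ∑ i, (starRingEnd ℂ) (c i) * c i := by
      conv_lhs => rw [← hc]
      rw [he'.inner_sum]
    have h2 : ((‖u‖ ^ 2 : ℝ) : ℂ) = ((∑ i : F, ‖c i‖ ^ 2 : ℝ) : ℂ) := by
      have := inner_self_eq_norm_sq_to_K (𝕜 := ℂ) u
      rw [h1] at this
      push_cast
      simp only [Complex.coe_algebraMap] at this
      rw [← this]
      refine Finset.sum_congr rfl fun i _ => ?_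
      rw [Complex.conj_mul']
    rw [Complex.ofReal_inj.1 h2, ← Finset.sum_coe_sort F]
    refine Finset.sum_congr rfl fun i _ => ?_
    rw [← hin i]
  rw [hnorm, Finset.mul_sum]
  refine Finset.sum_le_sum fun i hi => ?_
  gcongr
  exact hF i hi

end Variational

section PowerAsymptotics

theorem tendsto_div_rpow_nat {α c : ℝ} (hα : 0 < α) (hc : 0 < c) :
    Tendsto (fun n : ℕ => (c / (n : ℝ)) ^ α) atTop (nhdsWithin 0 (Ioi 0)) := by
  refine tendsto_nhdsWithin_iff.2 ⟨?_, ?_⟩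
  · have h1 : Tendsto (fun n : ℕ => c / (n : ℝ)) atTop (nhds 0) :=
      tendsto_const_div_atTop_nhds_zero_nat c
    have := h1.rpow_const (p := α) (Or.inr hα.le)
    rwa [Real.zero_rpow hα.ne'] at this
  · filter_upwards [eventually_gt_atTop 0] with n hn
    have : (0 : ℝ) < n := by exact_mod_cast hn
    exact Real.rpow_pos_of_pos (by positivity) _

/-- Two-sided counting bounds at all small levels `θ` give power asymptotics. -/
theorem isLittleO_of_counting {α V : ℝ} (hα : 0 < α) (hV : 0 ≤ V) (lam : ℕ → ℝ)
    (hnn : ∀ n, 1 ≤ n → 0 ≤ lam n)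
    (hup : ∀ ε : ℝ, 0 < ε → ε < 1 → ∀ᶠ θ in nhdsWithin (0 : ℝ) (Ioi 0), ∀ n : ℕ, 1 ≤ n →
      (V + ε) * θ ^ (-(1 / α)) < n → lam n ≤ (1 + ε) * θ)
    (hlo : ∀ ε : ℝ, 0 < ε → ε < 1 → ∀ᶠ θ in nhdsWithin (0 : ℝ) (Ioi 0), ∀ n : ℕ, 1 ≤ n →
      (n : ℝ) ≤ (V - ε) * θ ^ (-(1 / α)) → (1 - ε) * θ ≤ lam n) :
    (fun n : ℕ => lam n - V ^ α * (n : ℝ) ^ (-α)) =o[atTop] fun n : ℕ => (n : ℝ) ^ (-α) := by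
  have hpow : ∀ c : ℝ, 0 < c → ∀ n : ℕ, 1 ≤ n →
      ((c / (n : ℝ)) ^ α) ^ (-(1 / α)) = n / c := by
    intro c hc n hn
    have hn0 : (0 : ℝ) < n := by exact_mod_cast hn
    rw [← Real.rpow_mul (by positivity)]
    have : α * -(1 / α) = -1 := by field_simp
    rw [this, Real.rpow_neg_one, inv_div]
  have hpow2 : ∀ c : ℝ, 0 ≤ c → ∀ n : ℕ, (c / (n : ℝ)) ^ α = c ^ α * (n : ℝ) ^ (-α) := by
    intro c hc n
    rw [Real.div_rpow hc (by positivity), Real.rpow_neg (by positivity), div_eq_mul_inv]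
  have key : Tendsto (fun n : ℕ => lam n * (n : ℝ) ^ α) atTop (nhds (V ^ α)) := by
    rw [tendsto_order]
    constructor
    · intro a ha
      have h1 : Tendsto (fun ε : ℝ => (1 - ε) * (max (V - ε) 0) ^ α) (nhdsWithin 0 (Ioi 0))
          (nhds (V ^ α)) := by
        have : ContinuousAt (fun ε : ℝ => (1 - ε) * (max (V - ε) 0) ^ α) 0 := by
          refine ContinuousAt.mul (by fun_prop) (ContinuousAt.rpow_const (by fun_prop)
            (Or.inr hα.le))
        have h2 := this.tendsto
        simp only [sub_zero, one_mul, max_eq_left hV] at h2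
        exact h2.mono_left nhdsWithin_le_nhds
      obtain ⟨ε, h2, hε0, hε1⟩ := ((h1.eventually_const_lt ha).and
        (Ioo_mem_nhdsGT (zero_lt_one' ℝ))).exists
      rcases le_or_gt (V - ε) 0 with hneg | hpos
      · rw [max_eq_right hneg, Real.zero_rpow hα.ne', mul_zero] at h2
        filter_upwards [eventually_ge_atTop 1] with n hn
        exact h2.trans_le (mul_nonneg (hnn n hn) (by positivity))
      · rw [max_eq_left hpos.le] at h2
        filter_upwards [(tendsto_div_rpow_nat hα hpos).eventually (hlo ε hε0 hε1),
          eventually_ge_atTop 1] with n hn hn1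
        have hn0 : (0 : ℝ) < n := by exact_mod_cast hn1
        have h3 := hn n hn1 (by
          rw [hpow _ hpos n hn1, mul_div_cancel₀ _ hpos.ne'])
        rw [hpow2 _ hpos.le] at h3
        refine h2.trans_le ?_
        calc (1 - ε) * (V - ε) ^ α
            = (1 - ε) * ((V - ε) ^ α * (n : ℝ) ^ (-α)) * (n : ℝ) ^ α := by
              rw [Real.rpow_neg hn0.le]; field_simp
          _ ≤ _ := by gcongr
    · intro a ha
      have h1 : Tendsto (fun ε : ℝ => (1 + ε) * (V + 2 * ε) ^ α) (nhdsWithin 0 (Ioi 0))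
          (nhds (V ^ α)) := by
        have : ContinuousAt (fun ε : ℝ => (1 + ε) * (V + 2 * ε) ^ α) 0 := by
          refine ContinuousAt.mul (by fun_prop) (ContinuousAt.rpow_const (by fun_prop)
            (Or.inr hα.le))
        have h2 := this.tendsto
        simp only [add_zero, one_mul, mul_zero] at h2
        exact h2.mono_left nhdsWithin_le_nhds
      obtain ⟨ε, h2, hε0, hε1⟩ := ((h1.eventually_lt_const ha).and
        (Ioo_mem_nhdsGT (zero_lt_one' ℝ))).exists
      have hpos : 0 < V + 2 * ε := by positivity
      filter_upwards [(tendsto_div_rpow_nat hα hpos).eventually (hup ε hε0 hε1),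
        eventually_ge_atTop 1] with n hn hn1
      have hn0 : (0 : ℝ) < n := by exact_mod_cast hn1
      have h3 := hn n hn1 (by
        rw [hpow _ hpos n hn1, mul_div_assoc', div_lt_iff₀ hpos]
        nlinarith)
      rw [hpow2 _ hpos.le] at h3
      refine lt_of_le_of_lt ?_ h2
      calc lam n * (n : ℝ) ^ α
          ≤ (1 + ε) * ((V + 2 * ε) ^ α * (n : ℝ) ^ (-α)) * (n : ℝ) ^ α := by gcongr
        _ = _ := by
              rw [Real.rpow_neg hn0.le]; field_simp
  have hne : ∀ᶠ n : ℕ in atTop, (n : ℝ) ^ (-α) = 0 →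
      lam n - V ^ α * (n : ℝ) ^ (-α) = 0 := by
    filter_upwards [eventually_ge_atTop 1] with n hn h0
    have hn0 : (0 : ℝ) < n := by exact_mod_cast hn
    exact absurd h0 (Real.rpow_pos_of_pos hn0 _).ne'
  rw [isLittleO_iff_tendsto' hne]
  have h5 : Tendsto (fun n : ℕ => lam n * (n : ℝ) ^ α - V ^ α) atTop (nhds 0) := by
    simpa using key.sub_const (V ^ α)
  refine h5.congr' ?_
  filter_upwards [eventually_ge_atTop 1] with n hn
  have hn0 : (0 : ℝ) < n := by exact_mod_cast hn
  rw [Real.rpow_neg hn0.le]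
  field_simp

end PowerAsymptotics

section SpecialIntegrals

theorem sigmoid_eq_exp (x : ℝ) :
    Real.sigmoid x = Real.exp (x / 2 - Real.log (2 * Real.cosh (x / 2))) := by
  have h := Real.cosh_pos (x / 2)
  rw [Real.exp_sub, Real.exp_log (by positivity), Real.sigmoid_def, inv_eq_one_div,
    div_eq_div_iff (by positivity) (by positivity), Real.cosh_eq]
  have : Real.exp (x / 2) * Real.exp (-x) = Real.exp (-(x / 2)) := by
    rw [← Real.exp_add]; ring_nf
  linear_combination (-1) * this

theorem one_sub_sigmoid_eq_exp (x : ℝ) :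
    1 - Real.sigmoid x = Real.exp (-(x / 2) - Real.log (2 * Real.cosh (x / 2))) := by
  rw [← Real.sigmoid_neg, sigmoid_eq_exp, neg_div, Real.cosh_neg]

theorem betaIntegral_eq_integral_cosh (u v : ℂ) :
    Complex.betaIntegral u v =
      ∫ x : ℝ, Complex.exp ((u - v) * (x / 2) - (u + v) * Real.log (2 * Real.cosh (x / 2))) := by
  rw [Complex.betaIntegral, intervalIntegral.integral_of_le zero_le_one,
    integral_Ioc_eq_integral_Ioo, ← Real.range_sigmoid, ← Set.image_univ,
    integral_image_eq_integral_abs_deriv_smul MeasurableSet.univ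
      (fun x _ => (Real.hasDerivAt_sigmoid x).hasDerivWithinAt) Real.sigmoid_injective.injOn,
    setIntegral_univ]
  refine integral_congr_ae (Eventually.of_forall fun x => ?_)
  have h1 : 0 < Real.sigmoid x := Real.sigmoid_pos x
  have h2 : 0 < 1 - Real.sigmoid x := by linarith [Real.sigmoid_lt_one x]
  simp only [Complex.real_smul]
  rw [abs_of_pos (by positivity), ← Complex.ofReal_one, ← Complex.ofReal_sub,
    one_sub_sigmoid_eq_exp, sigmoid_eq_exp]
  push_cast
  have cp : ∀ (y : ℝ) (w : ℂ), Complex.exp (y : ℂ) ^ w = Complex.exp (y * w) := by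
    intro y w
    rw [Complex.cpow_def_of_ne_zero (Complex.exp_ne_zero _), ← Complex.ofReal_exp,
      ← Complex.ofReal_log (Real.exp_pos y).le, Real.log_exp]
  have a1 := cp (x / 2 - Real.log (2 * Real.cosh (x / 2))) (u - 1)
  have a2 := cp (-(x / 2) - Real.log (2 * Real.cosh (x / 2))) (v - 1)
  push_cast at a1 a2
  rw [a1, a2, ← Complex.exp_add, ← Complex.exp_add, ← Complex.exp_add]
  congr 1
  ring

/-- The function `1 / (2 cosh (z / 2))`. -/
def phiH (z : ℝ) : ℝ := (2 * Real.cosh (z / 2))⁻¹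

/-- The Fourier transform `π / cosh (π ξ)` of `phiH`. -/
def symS (ξ : ℝ) : ℝ := Real.pi / Real.cosh (Real.pi * ξ)

theorem phiH_pos (z : ℝ) : 0 < phiH z := by
  have := Real.cosh_pos (z / 2)
  unfold phiH; positivity

theorem symS_pos (z : ℝ) : 0 < symS z := by
  have := Real.cosh_pos (Real.pi * z)
  have := Real.pi_pos
  unfold symS; positivity

theorem continuous_phiH : Continuous phiH := by
  unfold phiH
  refine Continuous.inv₀ (by fun_prop) fun x => ?_
  have := Real.cosh_pos (x / 2)
  positivity

theorem symS_neg (ξ : ℝ) : symS (-ξ) = symS ξ := by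
  unfold symS; rw [mul_neg, Real.cosh_neg]

theorem symS_abs (ξ : ℝ) : symS |ξ| = symS ξ := by
  rcases abs_cases ξ with h | h <;> rw [h.1]
  exact symS_neg ξ

theorem phiH_le (z : ℝ) : phiH z ≤ Real.exp (-|z| / 2) := by
  unfold phiH
  rw [neg_div, Real.exp_neg]
  refine inv_anti₀ (Real.exp_pos _) ?_
  rw [← Real.cosh_abs, abs_div, abs_two, Real.cosh_eq]
  have := Real.exp_pos (-(|z| / 2))
  linarith

theorem symS_le (ξ : ℝ) : symS ξ ≤ 2 * Real.pi * Real.exp (-Real.pi * |ξ|) := by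
  unfold symS
  rw [div_le_iff₀ (Real.cosh_pos _), ← Real.cosh_abs, abs_mul, abs_of_pos Real.pi_pos,
    Real.cosh_eq]
  have h1 : Real.exp (-Real.pi * |ξ|) * Real.exp (Real.pi * |ξ|) = 1 := by
    rw [← Real.exp_add]; simp
  have h2 : 0 < Real.exp (-Real.pi * |ξ|) * Real.exp (-(Real.pi * |ξ|)) := by positivity
  nlinarith [Real.pi_pos]

theorem symS_antitoneOn : AntitoneOn symS (Ici 0) := by
  intro x hx y hy hxy
  unfold symS
  have h0 := Real.pi_pos
  have hx' : 0 ≤ x := hx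
  have hy' : 0 ≤ y := hy
  refine div_le_div_of_nonneg_left h0.le (Real.cosh_pos _) ?_
  rw [Real.cosh_le_cosh, abs_of_nonneg (by positivity), abs_of_nonneg (by positivity)]
  gcongr

theorem integral_exp_mul_phiH (ξ : ℝ) :
    ∫ y : ℝ, Complex.exp (-(Complex.I * ξ * y)) * phiH y = symS ξ := by
  have h := betaIntegral_eq_integral_cosh (1 / 2 - Complex.I * ξ) (1 / 2 + Complex.I * ξ)
  have h1 : ∀ y : ℝ, Complex.exp ((1 / 2 - Complex.I * ξ - (1 / 2 + Complex.I * ξ)) * (y / 2) -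
      (1 / 2 - Complex.I * ξ + (1 / 2 + Complex.I * ξ)) * Real.log (2 * Real.cosh (y / 2))) =
      Complex.exp (-(Complex.I * ξ * y)) * phiH y := by
    intro y
    have hc := Real.cosh_pos (y / 2)
    rw [show (1 / 2 - Complex.I * ξ - (1 / 2 + Complex.I * ξ)) * ((y : ℂ) / 2) -
      (1 / 2 - Complex.I * ξ + (1 / 2 + Complex.I * ξ)) * Real.log (2 * Real.cosh (y / 2)) =
      -(Complex.I * ξ * y) + ((-Real.log (2 * Real.cosh (y / 2)) : ℝ) : ℂ) by push_cast; ring]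
    rw [Complex.exp_add, ← Complex.ofReal_exp, Real.exp_neg, Real.exp_log (by positivity)]
    rfl
  simp_rw [h1] at h
  rw [← h]
  have hg := Complex.Gamma_mul_Gamma_eq_betaIntegral
    (s := 1 / 2 - Complex.I * ξ) (t := 1 / 2 + Complex.I * ξ) (by simp) (by simp)
  rw [show (1 / 2 - Complex.I * (ξ : ℂ) + (1 / 2 + Complex.I * ξ)) = 1 by ring,
    Complex.Gamma_one, one_mul] at hg
  rw [← hg]
  have h2 := Complex.Gamma_mul_Gamma_one_sub (1 / 2 - Complex.I * ξ)
  rw [show (1 - (1 / 2 - Complex.I * (ξ : ℂ))) = 1 / 2 + Complex.I * ξ by ring] at h2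
  rw [h2]
  have h3 : Complex.sin (Real.pi * (1 / 2 - Complex.I * ξ)) = Real.cosh (Real.pi * ξ) := by
    rw [show (Real.pi : ℂ) * (1 / 2 - Complex.I * ξ) =
      Real.pi / 2 - ((Real.pi * ξ : ℝ) : ℂ) * Complex.I by push_cast; ring]
    rw [Complex.sin_pi_div_two_sub, Complex.cos_mul_I, Complex.ofReal_cosh]
  rw [h3]; unfold symS; push_cast; rfl

theorem integral_symS_rpow {p : ℝ} (hp : 0 < p) :
    ∫ ξ : ℝ, symS ξ ^ p =
      Real.pi ^ (p - 1) * (Real.Gamma (p / 2) * Real.Gamma (1 / 2) / Real.Gamma (p / 2 + 1 / 2)) := by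
  have hpi := Real.pi_pos
  have h := betaIntegral_eq_integral_cosh ((p / 2 : ℝ) : ℂ) ((p / 2 : ℝ) : ℂ)
  have h1 : ∀ y : ℝ, Complex.exp ((((p / 2 : ℝ) : ℂ) - ((p / 2 : ℝ) : ℂ)) * (y / 2) -
      (((p / 2 : ℝ) : ℂ) + ((p / 2 : ℝ) : ℂ)) * Real.log (2 * Real.cosh (y / 2))) =
      (((2 * Real.cosh (y / 2)) ^ (-p) : ℝ) : ℂ) := by
    intro y
    have hc := Real.cosh_pos (y / 2)
    rw [Real.rpow_def_of_pos (by positivity), Complex.ofReal_exp]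
    congr 1
    push_cast; ring
  simp_rw [h1] at h
  rw [integral_complex_ofReal] at h
  have hg := Complex.Gamma_mul_Gamma_eq_betaIntegral
    (s := ((p / 2 : ℝ) : ℂ)) (t := ((p / 2 : ℝ) : ℂ)) (by simp; positivity) (by simp; positivity)
  rw [h, ← Complex.ofReal_add, Complex.Gamma_ofReal, Complex.Gamma_ofReal] at hg
  norm_cast at hg
  rw [add_halves] at hg
  have hs : ∀ ξ : ℝ, symS ξ ^ p = (2 * Real.pi) ^ p *
      (fun y : ℝ => (2 * Real.cosh (y / 2)) ^ (-p)) (2 * Real.pi * ξ) := by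
    intro ξ
    have hc := Real.cosh_pos (Real.pi * ξ)
    simp only
    rw [show 2 * Real.pi * ξ / 2 = Real.pi * ξ by ring, Real.rpow_neg (by positivity),
      ← div_eq_mul_inv, ← Real.div_rpow (by positivity) (by positivity)]
    unfold symS
    congr 1
    field_simp
  simp_rw [hs]
  rw [integral_const_mul, Measure.integral_comp_mul_left
    (fun y : ℝ => (2 * Real.cosh (y / 2)) ^ (-p)), smul_eq_mul]
  have hdup := Real.Gamma_mul_Gamma_add_half (p / 2)
  rw [show 2 * (p / 2) = p by ring] at hdup
  have g1 : Real.Gamma p ≠ 0 := (Real.Gamma_pos_of_pos hp).ne'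
  have g2 : Real.Gamma (p / 2 + 1 / 2) ≠ 0 := (Real.Gamma_pos_of_pos (by positivity)).ne'
  have e1 : (∫ y : ℝ, (2 * Real.cosh (y / 2)) ^ (-p)) =
      Real.Gamma (p / 2) * Real.Gamma (p / 2) / Real.Gamma p := by
    rw [eq_div_iff g1, hg]; ring
  rw [e1, Real.Gamma_one_half_eq, abs_of_pos (by positivity)]
  have e2 : Real.Gamma (p / 2) = Real.Gamma p * (2:ℝ) ^ (1 - p) * √Real.pi /
      Real.Gamma (p / 2 + 1 / 2) := by
    rw [eq_div_iff g2, hdup]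
  have e3 : (2 * Real.pi) ^ p = (2 * Real.pi) * (Real.pi ^ (p - 1) * (2:ℝ) ^ (p - 1)) := by
    rw [← Real.mul_rpow hpi.le (by norm_num), mul_comm Real.pi 2,
      Real.rpow_sub_one (by positivity)]
    field_simp
  have e4 : (2:ℝ) ^ (p - 1) * (2:ℝ) ^ (1 - p) = 1 := by
    rw [← Real.rpow_add (by norm_num)]; simp
  rw [e3, show Real.Gamma (p / 2) * Real.Gamma (p / 2) / Real.Gamma p =
    Real.Gamma (p / 2) * (2:ℝ) ^ (1 - p) * √Real.pi / Real.Gamma (p / 2 + 1 / 2) by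
      nth_rewrite 2 [e2]; field_simp]
  calc _ = Real.pi ^ (p - 1) * ((2:ℝ) ^ (p - 1) * (2:ℝ) ^ (1 - p)) *
      (Real.Gamma (p / 2) * √Real.pi / Real.Gamma (p / 2 + 1 / 2)) := by field_simp
    _ = _ := by rw [e4, mul_one]

set_option maxHeartbeats 800000 in
/-- Comparison of a Riemann sum of an even function, decreasing on the half-line, with its
integral. -/
theorem summable_and_abs_riemann_sum_sub_le {g : ℝ → ℝ} (heven : ∀ x, g |x| = g x)
    (hanti : AntitoneOn g (Ici 0)) (hint : IntegrableOn g (Ioi 0)) (hnn : ∀ x, 0 ≤ g x)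
    {δ : ℝ} (hδ : 0 < δ) :
    (Summable fun k : ℤ => g (δ * k)) ∧
      |δ * ∑' k : ℤ, g (δ * k) - ∫ x, g x| ≤ δ * g 0 := by
  have hanti' : AntitoneOn (fun x => g (δ * x)) (Ici 0) := by
    intro x hx y hy hxy
    have hx' : 0 ≤ x := hx
    have hy' : 0 ≤ y := hy
    exact hanti (mul_nonneg hδ.le hx') (mul_nonneg hδ.le hy')
      (mul_le_mul_of_nonneg_left hxy hδ.le)
  have hint' : IntegrableOn (fun x => g (δ * x)) (Ioi 0) := by
    rw [integrableOn_Ioi_comp_mul_left_iff g 0 hδ, mul_zero]; exact hint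
  set I := ∫ x in Ioi (0:ℝ), g (δ * x) with hI
  have hI2 : ∫ x, g x = 2 * (δ * I) := by
    rw [hI, integral_comp_mul_left_Ioi g 0 hδ, mul_zero, smul_eq_mul, mul_inv_cancel_left₀ hδ.ne',
      ← integral_comp_abs]
    simp_rw [heven]
  have hlim : Tendsto (fun n : ℕ => ∫ x in (0:ℝ)..n, g (δ * x)) atTop (nhds I) :=
    intervalIntegral_tendsto_integral_Ioi 0 hint' tendsto_natCast_atTop_atTop
  have up : ∀ n : ℕ, ∑ i ∈ Finset.range n, g (δ * ((i + 1 : ℕ) : ℝ)) ≤ ∫ x in (0:ℝ)..n, g (δ * x) := by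
    intro n
    have := (hanti'.mono (fun y hy => hy.1 : Icc (0:ℝ) (0 + (n:ℝ)) ⊆ Ici 0)).sum_le_integral
    simpa using this
  have lo : ∀ n : ℕ, ∫ x in (0:ℝ)..n, g (δ * x) ≤ ∑ i ∈ Finset.range n, g (δ * ((i : ℕ) : ℝ)) := by
    intro n
    have := (hanti'.mono (fun y hy => hy.1 : Icc (0:ℝ) (0 + (n:ℝ)) ⊆ Ici 0)).integral_le_sum
    simpa using this
  have leI : ∀ n : ℕ, ∫ x in (0:ℝ)..n, g (δ * x) ≤ I := by
    intro n
    rw [intervalIntegral.integral_of_le (Nat.cast_nonneg n)]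
    exact setIntegral_mono_set hint' (Eventually.of_forall fun x => hnn _)
      Ioc_subset_Ioi_self.eventuallyLE
  have sumS : Summable fun i : ℕ => g (δ * ((i + 1 : ℕ) : ℝ)) :=
    summable_of_sum_range_le (fun _ => hnn _) fun n => (up n).trans (leI n)
  have sum0 : Summable fun i : ℕ => g (δ * (i : ℝ)) := by
    rw [← summable_nat_add_iff 1]; exact sumS
  have evn : ∀ i : ℕ, g (δ * ((-(i:ℤ) : ℤ) : ℝ)) = g (δ * (i : ℝ)) := by
    intro i
    rw [← heven]
    congr 1
    push_cast
    rw [mul_neg, abs_neg, abs_of_nonneg (by positivity)]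
  have s1 : Summable fun i : ℕ => g (δ * (((i:ℕ):ℤ) : ℝ)) := by simpa using sum0
  have s2 : Summable fun i : ℕ => g (δ * ((-(i:ℤ) : ℤ) : ℝ)) := by
    simp_rw [evn]; exact sum0
  refine ⟨Summable.of_nat_of_neg (f := fun k : ℤ => g (δ * k)) s1 s2, ?_⟩
  rw [Summable.tsum_of_nat_of_neg (f := fun k : ℤ => g (δ * k)) s1 s2]
  simp_rw [evn]
  simp only [Int.cast_natCast, Int.cast_zero, mul_zero]
  have c1 : ∑' i : ℕ, g (δ * (i:ℝ)) - g 0 ≤ I := by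
    rw [sum0.tsum_eq_zero_add]
    simp only [Nat.cast_zero, mul_zero, add_sub_cancel_left]
    exact le_of_tendsto_of_tendsto' sumS.hasSum.tendsto_sum_nat hlim up
  have c2 : I ≤ ∑' i : ℕ, g (δ * (i:ℝ)) :=
    le_of_tendsto_of_tendsto' hlim sum0.hasSum.tendsto_sum_nat lo
  rw [hI2, abs_le]
  constructor <;> nlinarith

theorem integrableOn_symS_rpow {p : ℝ} (hp : 0 < p) :
    IntegrableOn (fun x => symS x ^ p) (Ioi 0) := by
  have h1 : IntegrableOn (fun x : ℝ => (2 * Real.pi) ^ p * Real.exp (-(Real.pi * p) * x)) (Ioi 0) :=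
    (integrableOn_exp_mul_Ioi (by have := Real.pi_pos; nlinarith [mul_pos this hp]) 0).const_mul _
  refine h1.mono' ?_ ?_
  · refine Continuous.aestronglyMeasurable ?_
    refine Continuous.rpow_const ?_ fun x => Or.inl (symS_pos x).ne'
    unfold symS
    exact continuous_const.div (by fun_prop) fun x => (Real.cosh_pos _).ne'
  · refine (ae_restrict_iff' measurableSet_Ioi).2 (Eventually.of_forall fun x hx => ?_)
    have hx' : 0 < x := hx
    rw [Real.norm_of_nonneg (Real.rpow_nonneg (symS_pos x).le _)]
    refine (Real.rpow_le_rpow (symS_pos x).le (symS_le x) hp.le).trans_eq ?_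
    rw [Real.mul_rpow (by positivity) (Real.exp_pos _).le, ← Real.exp_mul, abs_of_pos hx']
    ring_nf

theorem symS_riemann {p : ℝ} (hp : 0 < p) {δ : ℝ} (hδ : 0 < δ) :
    (Summable fun k : ℤ => symS (δ * k) ^ p) ∧
      |δ * ∑' k : ℤ, symS (δ * k) ^ p - ∫ x, symS x ^ p| ≤ δ * symS 0 ^ p := by
  refine summable_and_abs_riemann_sum_sub_le (g := fun x => symS x ^ p)
    (fun x => by simp only [symS_abs]) ?_ (integrableOn_symS_rpow hp)
    (fun x => Real.rpow_nonneg (symS_pos x).le _) hδ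
  intro x hx y hy hxy
  exact Real.rpow_le_rpow (symS_pos y).le (symS_antitoneOn hx hy hxy) hp.le

theorem poisson_phiH {L : ℝ} (hL : 0 < L) (z : ℝ) :
    ∑' m : ℤ, (phiH (z + m * L) : ℂ) =
      ∑' k : ℤ, ((L⁻¹ * symS (2 * Real.pi / L * k) : ℝ) : ℂ) *
        Complex.exp (Complex.I * (2 * Real.pi / L * k * z)) := by
  set f : ℝ → ℂ := fun x => ((phiH (L * x) : ℝ) : ℂ) with hf
  have hcont : Continuous f :=
    Complex.continuous_ofReal.comp (continuous_phiH.comp (by fun_prop))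
  have hfour : ∀ n : ℤ, FourierTransform.fourier f (n : ℝ) =
      ((L⁻¹ * symS (2 * Real.pi / L * n) : ℝ) : ℂ) := by
    intro n
    rw [Real.fourier_real_eq_integral_exp_smul]
    have h1 : ∀ v : ℝ, Complex.exp (((-2 * Real.pi * v * n : ℝ) : ℂ) * Complex.I) • f v =
        (fun y : ℝ => Complex.exp (-(Complex.I * ((2 * Real.pi / L * n : ℝ) : ℂ) * y)) * phiH y)
          (L * v) := by
      intro v
      simp only [hf, smul_eq_mul]
      congr 2
      have : (L : ℂ) ≠ 0 := by exact_mod_cast hL.ne'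
      push_cast
      field_simp
    simp_rw [h1]
    rw [Measure.integral_comp_mul_left (fun y : ℝ =>
      Complex.exp (-(Complex.I * ((2 * Real.pi / L * n : ℝ) : ℂ) * y)) * phiH y),
      integral_exp_mul_phiH, abs_of_pos (by positivity),
      Complex.real_smul]
    push_cast; rfl
  have hdecay : f =O[cocompact ℝ] fun x => |x| ^ (-(2:ℝ)) := by
    refine IsBigO.of_bound (8 / L ^ 2) ?_
    have : ∀ᶠ x : ℝ in cocompact ℝ, x ≠ 0 := by
      have : ({0}ᶜ : Set ℝ) ∈ cocompact ℝ := isCompact_singleton.compl_mem_cocompact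
      exact this
    filter_upwards [this] with x hx
    have hx' : 0 < |x| := abs_pos.2 hx
    simp only [hf, Complex.norm_real]
    rw [Real.norm_of_nonneg (phiH_pos _).le, Real.norm_of_nonneg (by positivity),
      Real.rpow_neg hx'.le, Real.rpow_two]
    refine (phiH_le _).trans ?_
    rw [neg_div, Real.exp_neg, abs_mul, abs_of_pos hL, ← div_eq_mul_inv, div_div,
      inv_le_comm₀ (Real.exp_pos _) (by positivity), inv_div]
    have := Real.quadratic_le_exp_of_nonneg (x := L * |x| / 2) (by positivity)
    refine le_trans ?_ this
    have h0 : 0 ≤ L * |x| / 2 := by positivity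
    nlinarith
  have hsum : Summable fun n : ℤ => FourierTransform.fourier f (n : ℝ) := by
    simp_rw [hfour]
    have := (symS_riemann one_pos (δ := 2 * Real.pi / L) (by have := Real.pi_pos; positivity)).1
    simp_rw [Real.rpow_one] at this
    exact Complex.ofRealCLM.summable (this.mul_left L⁻¹)
  have key := Real.tsum_eq_tsum_fourier_of_rpow_decay_of_summable hcont one_lt_two hdecay hsum
    (z / L)
  simp_rw [hfour] at key
  have hLc : (L : ℂ) ≠ 0 := by exact_mod_cast hL.ne'
  convert key using 3 with m k
  · simp only [hf]
    congr 2
    field_simp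
  · rw [fourier_coe_apply]
    congr 1
    push_cast
    field_simp

end SpecialIntegrals

section Forms

/-- The sesquilinear form of the integral kernel `k`, evaluated on the diagonal. -/
def form (k : ℝ → ℝ → ℝ) (u : ℝ → ℂ) : ℂ :=
  ∫ z, (k z.1 z.2 : ℂ) * (u z.2 * (starRingEnd ℂ) (u z.1)) ∂(muP.prod muP)

/-- The squared norm of `u`. -/
def sqN (u : ℝ → ℂ) : ℝ := ∫ t, ‖u t‖ ^ 2 ∂muP

/-- A positive kernel which defines a bounded operator. -/
def gK (a t s : ℝ) : ℝ :=
  t ^ (-(1:ℝ) / 2) * s ^ (-(1:ℝ) / 2) * Real.exp (-|Real.log t - Real.log s + a| / 4)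

theorem sqN_eq (u : HSp) : sqN u = ‖u‖ ^ 2 := by
  have h := MeasureTheory.L2.inner_def (𝕜 := ℂ) u u
  have h2 : (‖u‖ ^ 2 : ℝ) = (inner ℂ u u).re := (inner_self_eq_norm_sq (𝕜 := ℂ) u).symm
  rw [h2, h]
  have : ∀ t, (inner ℂ ((u : ℝ → ℂ) t) ((u : ℝ → ℂ) t)) = ((‖(u : ℝ → ℂ) t‖ ^ 2 : ℝ) : ℂ) := by
    intro t
    rw [inner_self_eq_norm_sq_to_K]; simp
  simp_rw [this]
  rw [integral_complex_ofReal, Complex.ofReal_re]; rfl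

theorem gK_nonneg {t s : ℝ} (a : ℝ) (ht : 0 < t) (hs : 0 < s) : 0 ≤ gK a t s := by
  unfold gK; positivity

theorem ae_muP_pos : ∀ᵐ t ∂muP, 0 < t :=
  (ae_restrict_iff' measurableSet_Ioi).2 (Eventually.of_forall fun _ h => h)

theorem ae_prod_pos : ∀ᵐ z ∂(muP.prod muP), 0 < z.1 ∧ 0 < z.2 := by
  have : muP.prod muP = (volume.prod volume).restrict (Ioi (0:ℝ) ×ˢ Ioi 0) :=
    Measure.prod_restrict _ _
  rw [this]
  exact (ae_restrict_iff' (measurableSet_Ioi.prod measurableSet_Ioi)).2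
    (Eventually.of_forall fun z h => h)

theorem integral_exp_neg_abs_div_four (c : ℝ) :
    Integrable (fun x : ℝ => Real.exp (-|c - x| / 4)) ∧
      ∫ x : ℝ, Real.exp (-|c - x| / 4) = 8 := by
  have e1 : ∀ x : ℝ, Real.exp (-|x| / 4) = (fun y => Real.exp ((-1 / 4) * y)) |x| := by
    intro x; simp only; congr 1; ring
  have h0 : IntegrableOn (fun x : ℝ => Real.exp ((-1 / 4) * x)) (Ioi 0) :=
    integrableOn_exp_mul_Ioi (by norm_num) 0
  have h2 : ∫ x : ℝ, Real.exp (-|x| / 4) = 8 := by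
    simp_rw [e1]
    rw [integral_comp_abs (f := fun y => Real.exp ((-1 / 4) * y)),
      integral_exp_mul_Ioi (by norm_num) 0]
    norm_num
  have h1 : Integrable (fun x : ℝ => Real.exp (-|x| / 4)) := by
    by_contra hc
    rw [integral_undef hc] at h2
    norm_num at h2
  refine ⟨?_, ?_⟩
  · exact h1.comp_sub_left c
  · rw [integral_sub_left_eq_self (fun x : ℝ => Real.exp (-|x| / 4)) volume c, h2]

theorem integral_exp_log_div (c : ℝ) :
    Integrable (fun s : ℝ => Real.exp (-|c - Real.log s| / 4) * s⁻¹) muP ∧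
      ∫ s, Real.exp (-|c - Real.log s| / 4) * s⁻¹ ∂muP = 8 := by
  have him : Ioi (0:ℝ) = Real.exp '' univ := by rw [image_univ, Real.range_exp]
  have hcongr : ∀ x : ℝ, |Real.exp x| • (Real.exp (-|c - Real.log (Real.exp x)| / 4) *
      (Real.exp x)⁻¹) = Real.exp (-|c - x| / 4) := by
    intro x
    rw [abs_of_pos (Real.exp_pos x), Real.log_exp, smul_eq_mul]
    have := (Real.exp_pos x).ne'
    field_simp
  have hi := integral_exp_neg_abs_div_four c
  constructor
  · have := (integrableOn_image_iff_integrableOn_abs_deriv_smul MeasurableSet.univ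
      (fun x _ => (Real.hasDerivAt_exp x).hasDerivWithinAt) Real.exp_injective.injOn
      (fun s : ℝ => Real.exp (-|c - Real.log s| / 4) * s⁻¹)).2
    rw [← him] at this
    refine this ?_
    simp_rw [hcongr]
    exact hi.1.integrableOn
  · have := integral_image_eq_integral_abs_deriv_smul MeasurableSet.univ
      (fun x _ => (Real.hasDerivAt_exp x).hasDerivWithinAt) Real.exp_injective.injOn
      (fun s : ℝ => Real.exp (-|c - Real.log s| / 4) * s⁻¹)
    rw [← him] at this
    rw [this]
    simp_rw [hcongr]
    rw [setIntegral_univ, hi.2]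

theorem measurable_gK (a : ℝ) : Measurable (fun z : ℝ × ℝ => gK a z.1 z.2) := by
  unfold gK
  fun_prop

theorem integrable_weight {u : ℝ → ℂ} (hu : MemLp u 2 muP) (a : ℝ) :
    Integrable (fun z : ℝ × ℝ => ‖u z.1‖ ^ 2 *
      (Real.exp (-|Real.log z.1 + a - Real.log z.2| / 4) * z.2⁻¹)) (muP.prod muP) ∧
    ∫ z : ℝ × ℝ, ‖u z.1‖ ^ 2 *
      (Real.exp (-|Real.log z.1 + a - Real.log z.2| / 4) * z.2⁻¹) ∂(muP.prod muP) = 8 * sqN u := by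
  have hu2 : Integrable (fun t => ‖u t‖ ^ 2) muP := hu.integrable_norm_pow (by norm_num)
  have hm : AEStronglyMeasurable (fun z : ℝ × ℝ => ‖u z.1‖ ^ 2 *
      (Real.exp (-|Real.log z.1 + a - Real.log z.2| / 4) * z.2⁻¹)) (muP.prod muP) := by
    refine AEStronglyMeasurable.mul (hu2.aestronglyMeasurable.comp_fst) ?_
    exact (by fun_prop : Measurable fun z : ℝ × ℝ =>
      Real.exp (-|Real.log z.1 + a - Real.log z.2| / 4) * z.2⁻¹).aestronglyMeasurable
  have hint : Integrable (fun z : ℝ × ℝ => ‖u z.1‖ ^ 2 *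
      (Real.exp (-|Real.log z.1 + a - Real.log z.2| / 4) * z.2⁻¹)) (muP.prod muP) := by
    rw [integrable_prod_iff hm]
    refine ⟨Eventually.of_forall fun t =>
      (integral_exp_log_div (Real.log t + a)).1.const_mul (‖u t‖ ^ 2), ?_⟩
    refine (hu2.mul_const 8).congr (Eventually.of_forall fun t => ?_)
    simp only
    rw [← (integral_exp_log_div (Real.log t + a)).2, ← integral_const_mul]
    refine integral_congr_ae ?_
    filter_upwards [ae_muP_pos] with s hs
    rw [Real.norm_of_nonneg (by positivity)]
  refine ⟨hint, ?_⟩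
  rw [integral_prod _ hint]
  simp only
  simp_rw [integral_const_mul, (integral_exp_log_div _).2]
  rw [integral_mul_const, mul_comm]; rfl

theorem schur {u : ℝ → ℂ} (hu : MemLp u 2 muP) (a : ℝ) :
    Integrable (fun z : ℝ × ℝ => gK a z.1 z.2 * (‖u z.2‖ * ‖u z.1‖)) (muP.prod muP) ∧
    ∫ z : ℝ × ℝ, gK a z.1 z.2 * (‖u z.2‖ * ‖u z.1‖) ∂(muP.prod muP) ≤ 8 * sqN u := by
  have h1 := integrable_weight hu a
  have h2 := integrable_weight hu (-a)
  have h2s : Integrable (fun z : ℝ × ℝ => ‖u z.2‖ ^ 2 *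
      (Real.exp (-|Real.log z.2 + -a - Real.log z.1| / 4) * z.1⁻¹)) (muP.prod muP) := h2.1.swap
  have h2i : ∫ z : ℝ × ℝ, ‖u z.2‖ ^ 2 *
      (Real.exp (-|Real.log z.2 + -a - Real.log z.1| / 4) * z.1⁻¹) ∂(muP.prod muP) = 8 * sqN u := by
    rw [← h2.2, ← integral_prod_swap]; rfl
  have hdom := (h1.1.add h2s).const_mul (1 / 2)
  have hle : ∀ᵐ z ∂(muP.prod muP), gK a z.1 z.2 * (‖u z.2‖ * ‖u z.1‖) ≤
      1 / 2 * (‖u z.1‖ ^ 2 *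
      (Real.exp (-|Real.log z.1 + a - Real.log z.2| / 4) * z.2⁻¹) + ‖u z.2‖ ^ 2 *
      (Real.exp (-|Real.log z.2 + -a - Real.log z.1| / 4) * z.1⁻¹)) := by
    filter_upwards [ae_prod_pos] with z hz
    obtain ⟨h3, h4⟩ := hz
    have e1 : |Real.log z.1 + a - Real.log z.2| = |Real.log z.1 - Real.log z.2 + a| := by
      congr 1; ring
    have e2 : |Real.log z.2 + -a - Real.log z.1| = |Real.log z.1 - Real.log z.2 + a| := by
      rw [← abs_neg]; congr 1; ring
    rw [e1, e2]
    unfold gK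
    set E := Real.exp (-|Real.log z.1 - Real.log z.2 + a| / 4)
    have hE : 0 < E := Real.exp_pos _
    have p1 : z.1⁻¹ = (z.1 ^ (-(1:ℝ) / 2)) ^ 2 := by
      rw [← Real.rpow_natCast, ← Real.rpow_mul h3.le, ← Real.rpow_neg_one]; norm_num
    have p2 : z.2⁻¹ = (z.2 ^ (-(1:ℝ) / 2)) ^ 2 := by
      rw [← Real.rpow_natCast, ← Real.rpow_mul h4.le, ← Real.rpow_neg_one]; norm_num
    rw [p1, p2]
    have := mul_nonneg hE.le (sq_nonneg (‖u z.1‖ * z.2 ^ (-(1:ℝ) / 2) - ‖u z.2‖ * z.1 ^ (-(1:ℝ) / 2)))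
    nlinarith
  have hm : AEStronglyMeasurable (fun z : ℝ × ℝ => gK a z.1 z.2 * (‖u z.2‖ * ‖u z.1‖))
      (muP.prod muP) :=
    (measurable_gK a).aestronglyMeasurable.mul
      (hu.aestronglyMeasurable.comp_snd.norm.mul hu.aestronglyMeasurable.comp_fst.norm)
  have hint : Integrable (fun z : ℝ × ℝ => gK a z.1 z.2 * (‖u z.2‖ * ‖u z.1‖)) (muP.prod muP) := by
    refine hdom.mono' hm ?_
    filter_upwards [hle, ae_prod_pos] with z h hz
    rw [Real.norm_of_nonneg (mul_nonneg (gK_nonneg a hz.1 hz.2) (by positivity))]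
    exact h
  refine ⟨hint, ?_⟩
  refine (integral_mono_ae hint hdom hle).trans_eq ?_
  rw [integral_const_mul]
  simp only [Pi.add_apply]
  rw [integral_add h1.1 h2s, h1.2, h2i]; ring

/-- Integrability of the integrand of `form`. -/
theorem integrable_form {k : ℝ → ℝ → ℝ} (hk : Measurable fun z : ℝ × ℝ => k z.1 z.2) {a M : ℝ}
    (hb : ∀ t s, 0 < t → 0 < s → |k t s| ≤ M * gK a t s) {u : ℝ → ℂ} (hu : MemLp u 2 muP) :
    Integrable (fun z : ℝ × ℝ => (k z.1 z.2 : ℂ) * (u z.2 * (starRingEnd ℂ) (u z.1)))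
      (muP.prod muP) := by
  refine ((schur hu a).1.const_mul M).mono' ?_ ?_
  · refine AEStronglyMeasurable.mul ?_ ?_
    · exact (Complex.measurable_ofReal.comp hk).aestronglyMeasurable
    · refine hu.aestronglyMeasurable.comp_snd.mul ?_
      exact Complex.continuous_conj.comp_aestronglyMeasurable hu.aestronglyMeasurable.comp_fst
  · filter_upwards [ae_prod_pos] with z hz
    rw [norm_mul, norm_mul, RCLike.norm_conj, Complex.norm_real, Real.norm_eq_abs, ← mul_assoc M]
    exact mul_le_mul_of_nonneg_right (hb _ _ hz.1 hz.2)
      (mul_nonneg (norm_nonneg _) (norm_nonneg _))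

theorem norm_form_le {k : ℝ → ℝ → ℝ} {a M : ℝ} (hM : 0 ≤ M)
    (hb : ∀ t s, 0 < t → 0 < s → |k t s| ≤ M * gK a t s) {u : ℝ → ℂ} (hu : MemLp u 2 muP) :
    ‖form k u‖ ≤ 8 * M * sqN u := by
  have h1 : ‖form k u‖ ≤ ∫ z, M * (gK a z.1 z.2 * (‖u z.2‖ * ‖u z.1‖)) ∂(muP.prod muP) := by
    refine norm_integral_le_of_norm_le ((schur hu a).1.const_mul M) ?_
    filter_upwards [ae_prod_pos] with z hz
    rw [norm_mul, norm_mul, RCLike.norm_conj, Complex.norm_real, Real.norm_eq_abs, ← mul_assoc M]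
    exact mul_le_mul_of_nonneg_right (hb _ _ hz.1 hz.2)
      (mul_nonneg (norm_nonneg _) (norm_nonneg _))
  rw [integral_const_mul] at h1
  nlinarith [mul_le_mul_of_nonneg_left (schur hu a).2 hM]

theorem form_add {k l : ℝ → ℝ → ℝ} (hk : Measurable fun z : ℝ × ℝ => k z.1 z.2)
    (hl : Measurable fun z : ℝ × ℝ => l z.1 z.2) {a b M M' : ℝ}
    (hb : ∀ t s, 0 < t → 0 < s → |k t s| ≤ M * gK a t s)
    (hb' : ∀ t s, 0 < t → 0 < s → |l t s| ≤ M' * gK b t s) {u : ℝ → ℂ} (hu : MemLp u 2 muP) :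
    form (fun t s => k t s + l t s) u = form k u + form l u := by
  unfold form
  rw [← integral_add (integrable_form hk hb hu) (integrable_form hl hb' hu)]
  congr 1; ext z; push_cast; ring

end Forms

section Moments

/-- A monomial centred at the left end of an interval, cut off to this interval. -/
def monoInd (lo hi : ℝ) (m : ℕ) : ℝ → ℂ :=
  indicator (Ico lo hi) fun s => (((s - lo) ^ m : ℝ) : ℂ)

theorem memLp_monoInd (lo hi : ℝ) (m : ℕ) : MemLp (monoInd lo hi m) 2 muP := by
  unfold monoInd
  rw [memLp_indicator_iff_restrict measurableSet_Ico]
  have : IsFiniteMeasure (muP.restrict (Ico lo hi)) := by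
    refine ⟨?_⟩
    rw [Measure.restrict_apply_univ]
    refine (Measure.restrict_apply_le _ _).trans_lt ?_
    simp
  refine MemLp.of_bound (by fun_prop) ((hi - lo) ^ m) ?_
  refine (ae_restrict_iff' measurableSet_Ico).2 (Eventually.of_forall fun s hs => ?_)
  have h0 : 0 ≤ s - lo := sub_nonneg.2 hs.1
  rw [Complex.norm_real, Real.norm_of_nonneg (by positivity)]
  gcongr
  exact hs.2.le

theorem norm_form_le_of_approx {ι : Type*} {k : ℝ → ℝ → ℝ}
    (hk : Measurable fun z : ℝ × ℝ => k z.1 z.2) {a M : ℝ}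
    (hb : ∀ t s, 0 < t → 0 < s → |k t s| ≤ M * gK a t s) {β : ℝ} (hβ : 0 ≤ β)
    (T : Finset ι) (lo hi : ι → ℝ) (N : ℕ) {u : ℝ → ℂ} (hu : MemLp u 2 muP)
    (hmom : ∀ i ∈ T, ∀ m < N, ∫ s, monoInd (lo i) (hi i) m s * u s ∂muP = 0)
    (happ : ∀ t, 0 < t → ∃ c : ι → ℕ → ℝ, ∀ s, 0 < s →
      ‖(k t s : ℂ) - ∑ i ∈ T, ∑ m ∈ Finset.range N, (c i m : ℂ) * monoInd (lo i) (hi i) m s‖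
        ≤ β * gK a t s) :
    ‖form k u‖ ≤ 8 * β * sqN u := by
  have hsch := schur hu a
  have hif := integrable_form hk hb hu
  have hscht : Integrable (fun z : ℝ × ℝ => β * (gK a z.1 z.2 * (‖u z.2‖ * ‖u z.1‖)))
    (muP.prod muP) := hsch.1.const_mul β
  have key : ‖form k u‖ ≤ ∫ t, ∫ s, β * (gK a t s * (‖u s‖ * ‖u t‖)) ∂muP ∂muP := by
    unfold form
    rw [integral_prod _ hif]
    refine norm_integral_le_of_norm_le hscht.integral_prod_left ?_
    filter_upwards [ae_muP_pos, hif.prod_right_ae, hscht.prod_right_ae] with t ht h1 h2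
    obtain ⟨c, hc⟩ := happ t ht
    set P : ℝ → ℂ := fun s => ∑ i ∈ T, ∑ m ∈ Finset.range N,
      (c i m : ℂ) * monoInd (lo i) (hi i) m s
    have hint : ∀ i m, Integrable (fun s => monoInd (lo i) (hi i) m s * u s) muP :=
      fun i m => (memLp_monoInd (lo i) (hi i) m).integrable_mul hu
    have hPe : ∀ s, P s * (u s * (starRingEnd ℂ) (u t)) = ∑ i ∈ T, ∑ m ∈ Finset.range N,
        ((c i m : ℂ) * (starRingEnd ℂ) (u t)) * (monoInd (lo i) (hi i) m s * u s) := by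
      intro s
      simp only [P]
      rw [Finset.sum_mul]
      refine Finset.sum_congr rfl fun i _ => ?_
      rw [Finset.sum_mul]
      refine Finset.sum_congr rfl fun m _ => ?_
      ring
    have hPi : Integrable (fun s => P s * (u s * (starRingEnd ℂ) (u t))) muP := by
      simp_rw [hPe]
      exact integrable_finsetSum _ fun i _ => integrable_finsetSum _ fun m _ =>
        (hint i m).const_mul _
    have hP0 : ∫ s, P s * (u s * (starRingEnd ℂ) (u t)) ∂muP = 0 := by
      simp_rw [hPe]
      rw [integral_finsetSum _ fun i _ => integrable_finsetSum _ fun m _ =>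
        (hint i m).const_mul _]
      refine Finset.sum_eq_zero fun i hi' => ?_
      rw [integral_finsetSum _ fun m _ => (hint i m).const_mul _]
      refine Finset.sum_eq_zero fun m hm => ?_
      rw [integral_const_mul, hmom i hi' m (Finset.mem_range.1 hm), mul_zero]
    have e1 : ∫ s, (k t s : ℂ) * (u s * (starRingEnd ℂ) (u t)) ∂muP =
        ∫ s, ((k t s : ℂ) - P s) * (u s * (starRingEnd ℂ) (u t)) ∂muP := by
      simp_rw [sub_mul]
      rw [integral_sub h1 hPi, hP0, sub_zero]
    rw [e1]
    refine norm_integral_le_of_norm_le h2 ?_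
    filter_upwards [ae_muP_pos] with s hs
    rw [norm_mul, norm_mul, RCLike.norm_conj, ← mul_assoc β]
    exact mul_le_mul_of_nonneg_right (hc s hs) (mul_nonneg (norm_nonneg _) (norm_nonneg _))
  rw [← integral_prod _ hscht, integral_const_mul] at key
  nlinarith [mul_le_mul_of_nonneg_left hsch.2 hβ]

theorem taylor_bound {F : ℝ → ℝ} {N : ℕ} (hN : 1 ≤ N) (hF : ContDiffOn ℝ N F (Ioi 0))
    {x y C : ℝ} (hx : 0 < x) (hxy : x < y)
    (hC : ∀ s ∈ Icc x y, |iteratedDeriv N F s| ≤ C) {s : ℝ} (hs : s ∈ Icc x y) :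
    |F s - ∑ m ∈ Finset.range N, (iteratedDerivWithin m F (Icc x y) x / m.factorial) * (s - x) ^ m|
      ≤ C * (y - x) ^ N := by
  obtain ⟨n, rfl⟩ : ∃ n, N = n + 1 := ⟨N - 1, by omega⟩
  have hsub : Icc x y ⊆ Ioi 0 := fun z hz => hx.trans_le hz.1
  have hC0 : 0 ≤ C := (abs_nonneg _).trans (hC x ⟨le_rfl, hxy.le⟩)
  have h := taylor_mean_remainder_bound (f := F) (C := C) (n := n) hxy.le
    (by exact_mod_cast hF.mono hsub) hs (fun z hz => by
      rw [iteratedDerivWithin_eq_iteratedDeriv (uniqueDiffOn_Icc hxy)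
        (hF.contDiffAt (Ioi_mem_nhds (hsub hz))) hz]
      exact hC z hz)
  rw [taylor_within_apply, Real.norm_eq_abs] at h
  have e : ∑ m ∈ Finset.range (n + 1),
      (iteratedDerivWithin m F (Icc x y) x / m.factorial) * (s - x) ^ m =
      ∑ k ∈ Finset.range (n + 1), ((k.factorial : ℝ)⁻¹ * (s - x) ^ k) •
        iteratedDerivWithin k F (Icc x y) x := by
    refine Finset.sum_congr rfl fun m _ => ?_
    rw [smul_eq_mul]; ring
  rw [e]
  refine h.trans ?_
  have h1 : (1:ℝ) ≤ n.factorial := by exact_mod_cast n.factorial_pos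
  have h2 : 0 ≤ s - x := sub_nonneg.2 hs.1
  calc C * (s - x) ^ (n + 1) / n.factorial ≤ C * (s - x) ^ (n + 1) :=
        div_le_self (by positivity) h1
    _ ≤ C * (y - x) ^ (n + 1) := by gcongr; exact hs.2

theorem gK_le_of_near {a t s s' : ℝ} (ht : 0 < t) (hs : 0 < s) (hs' : 0 < s')
    (h : |Real.log s - Real.log s'| ≤ 1) : gK a t s' ≤ 3 * gK a t s := by
  unfold gK
  have h1 : s' ^ (-(1:ℝ) / 2) ≤ Real.exp (1 / 2) * s ^ (-(1:ℝ) / 2) := by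
    rw [Real.rpow_def_of_pos hs, Real.rpow_def_of_pos hs', ← Real.exp_add]
    refine Real.exp_le_exp.2 ?_
    have := (abs_le.1 h).2
    linarith
  have h2 : Real.exp (-|Real.log t - Real.log s' + a| / 4) ≤
      Real.exp (1 / 4) * Real.exp (-|Real.log t - Real.log s + a| / 4) := by
    rw [← Real.exp_add]
    refine Real.exp_le_exp.2 ?_
    have := abs_sub_abs_le_abs_sub (Real.log t - Real.log s + a) (Real.log t - Real.log s' + a)
    rw [show Real.log t - Real.log s + a - (Real.log t - Real.log s' + a) =
      -(Real.log s - Real.log s') by ring, abs_neg] at this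
    linarith
  have h3 : Real.exp (1 / 2) * Real.exp (1 / 4) ≤ 3 := by
    rw [← Real.exp_add]
    have : Real.exp (1 / 2 + 1 / 4) ≤ Real.exp 1 := Real.exp_le_exp.2 (by norm_num)
    linarith [Real.exp_one_lt_d9]
  have p1 : 0 < t ^ (-(1:ℝ) / 2) := by positivity
  have p2 : 0 < s ^ (-(1:ℝ) / 2) := by positivity
  have p3 : 0 < s' ^ (-(1:ℝ) / 2) := by positivity
  calc t ^ (-(1:ℝ) / 2) * s' ^ (-(1:ℝ) / 2) * Real.exp (-|Real.log t - Real.log s' + a| / 4)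
      ≤ t ^ (-(1:ℝ) / 2) * (Real.exp (1 / 2) * s ^ (-(1:ℝ) / 2)) *
        (Real.exp (1 / 4) * Real.exp (-|Real.log t - Real.log s + a| / 4)) := by gcongr
    _ = (Real.exp (1 / 2) * Real.exp (1 / 4)) * (t ^ (-(1:ℝ) / 2) * s ^ (-(1:ℝ) / 2) *
        Real.exp (-|Real.log t - Real.log s + a| / 4)) := by ring
    _ ≤ _ := by gcongr

end Moments

section Cells

/-- Left end of the `i.2`-th of `n i.1` subintervals of `[e^q, e^(q+1))`, `q = i.1`. -/
def cellLo (n : ℤ → ℕ) (i : (_ : ℤ) × ℕ) : ℝ := Real.exp (i.1 + i.2 / n i.1)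

/-- Right end of the `i.2`-th of `n i.1` subintervals of `[e^q, e^(q+1))`, `q = i.1`. -/
def cellHi (n : ℤ → ℕ) (i : (_ : ℤ) × ℕ) : ℝ := Real.exp (i.1 + (i.2 + 1) / n i.1)

/-- Indices of the subintervals. -/
def cellIdx (n : ℤ → ℕ) (Q : Finset ℤ) : Finset ((_ : ℤ) × ℕ) :=
  Q.sigma fun q => Finset.range (n q)

/-- A kernel which, in its second variable, is smooth on the intervals `[e^q, e^(q+1))` with
size controlled by `A q * lam`. -/
def CellK (N : ℕ) (a lam : ℝ) (A : ℤ → ℝ) (k : ℝ → ℝ → ℝ) : Prop :=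
  (Measurable fun z : ℝ × ℝ => k z.1 z.2) ∧ ∀ t, 0 < t → ∀ q : ℤ, ∃ F : ℝ → ℝ,
    ContDiffOn ℝ N F (Ioi 0) ∧
    (∀ s ∈ Ico (Real.exp q) (Real.exp (q + 1)), k t s = F s) ∧
    ∀ s ∈ Icc (Real.exp q) (Real.exp (q + 1)), |F s| ≤ A q * lam * gK a t s ∧
      |iteratedDeriv N F s| * s ^ N ≤ A q * lam * gK a t s

theorem mem_cell_floor {s : ℝ} (hs : 0 < s) :
    s ∈ Ico (Real.exp ⌊Real.log s⌋) (Real.exp (⌊Real.log s⌋ + 1)) := by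
  refine ⟨?_, ?_⟩
  · rw [← Real.le_log_iff_exp_le hs]; exact Int.floor_le _
  · rw [← Real.log_lt_iff_lt_exp hs]; exact Int.lt_floor_add_one _

theorem mem_cell_iff {n : ℤ → ℕ} {i : (_ : ℤ) × ℕ} (hi : i.2 < n i.1) {s : ℝ} (hs : 0 < s) :
    s ∈ Ico (cellLo n i) (cellHi n i) ↔
      i = ⟨⌊Real.log s⌋, ⌊Int.fract (Real.log s) * n ⌊Real.log s⌋⌋₊⟩ := by
  obtain ⟨q, l⟩ := i
  simp only at hi
  have hn : (0:ℝ) < n q := by exact_mod_cast (Nat.zero_le _).trans_lt hi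
  have hl : (l:ℝ) + 1 ≤ n q := by exact_mod_cast hi
  unfold cellLo cellHi
  simp only [mem_Ico, Sigma.mk.injEq]
  rw [← Real.le_log_iff_exp_le hs, ← Real.log_lt_iff_lt_exp hs]
  constructor
  · rintro ⟨h1, h2⟩
    have hq : ⌊Real.log s⌋ = q := by
      rw [Int.floor_eq_iff]
      have : 0 ≤ (l:ℝ) / n q := by positivity
      have : ((l:ℝ) + 1) / n q ≤ 1 := by rw [div_le_one hn]; exact hl
      constructor <;> linarith
    refine ⟨hq.symm, heq_of_eq ?_⟩
    have hf : Int.fract (Real.log s) = Real.log s - q := by rw [Int.fract, hq]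
    rw [hf, hq]
    symm
    have h3 : (l:ℝ) / n q ≤ Real.log s - q := by linarith
    have h4 : Real.log s - q < ((l:ℝ) + 1) / n q := by linarith
    rw [div_le_iff₀ hn] at h3
    rw [lt_div_iff₀ hn] at h4
    rw [Nat.floor_eq_iff ((Nat.cast_nonneg l).trans h3)]
    exact ⟨h3, h4⟩
  · rintro ⟨hq, hl'⟩
    have hl2 := eq_of_heq hl'
    have hf : Int.fract (Real.log s) = Real.log s - q := by rw [Int.fract, hq]
    rw [← hq, hf] at hl2
    have h0 : 0 ≤ (Real.log s - q) * n q := by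
      rw [← hf]; exact mul_nonneg (Int.fract_nonneg _) hn.le
    have := (Nat.floor_eq_iff h0).1 hl2.symm
    rw [← div_le_iff₀ hn, ← lt_div_iff₀ hn] at this
    constructor <;> linarith [this.1, this.2]

theorem norm_form_le_of_cellK {N : ℕ} (hN : 1 ≤ N) {a lam M : ℝ} {A : ℤ → ℝ} (hlam : 0 ≤ lam)
    {k : ℝ → ℝ → ℝ} (hk : CellK N a lam A k) (hA : ∀ q, 0 ≤ A q) (hAM : ∀ q, A q ≤ M) {θ : ℝ}
    (hθ : 0 < θ) {n : ℤ → ℕ} {Q : Finset ℤ} (hQ : ∀ q, θ < A q → q ∈ Q)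
    (hn : ∀ q, θ < A q → A q ≤ θ * (n q : ℝ) ^ N) (hn0 : ∀ q, A q ≤ θ → n q = 0)
    {u : ℝ → ℂ} (hu : MemLp u 2 muP)
    (hmom : ∀ i ∈ cellIdx n Q, ∀ m < N,
      ∫ s, monoInd (cellLo n i) (cellHi n i) m s * u s ∂muP = 0) :
    ‖form k u‖ ≤ 8 * (3 * 2 ^ N * θ) * lam * sqN u := by
  obtain ⟨hmeas, hcell⟩ := hk
  have hb : ∀ t s, 0 < t → 0 < s → |k t s| ≤ M * lam * gK a t s := by
    intro t s ht hs
    obtain ⟨F, -, hF1, hF2⟩ := hcell t ht ⌊Real.log s⌋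
    have hm := mem_cell_floor hs
    rw [hF1 s hm]
    refine (hF2 s ⟨hm.1, hm.2.le⟩).1.trans ?_
    have := gK_nonneg a ht hs
    gcongr
    exact hAM _
  have main := norm_form_le_of_approx hmeas hb (β := 3 * 2 ^ N * θ * lam) (by positivity)
    (cellIdx n Q) (cellLo n) (cellHi n) N hu hmom ?_
  · refine main.trans_eq (by ring)
  intro t ht
  choose F hFd hF1 hF2 using hcell t ht
  refine ⟨fun i m => iteratedDerivWithin m (F i.1) (Icc (cellLo n i) (cellHi n i)) (cellLo n i) /
    m.factorial, fun s hs => ?_⟩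
  set q := ⌊Real.log s⌋ with hq
  have hmq := mem_cell_floor hs
  rw [← hq] at hmq
  have hgn := gK_nonneg a ht hs
  rcases le_or_gt (A q) θ with hle | hgt
  · have hz : ∑ i ∈ cellIdx n Q, ∑ m ∈ Finset.range N,
        ((iteratedDerivWithin m (F i.1) (Icc (cellLo n i) (cellHi n i)) (cellLo n i) /
    m.factorial : ℝ) : ℂ) * monoInd (cellLo n i) (cellHi n i) m s = 0 := by
      refine Finset.sum_eq_zero fun i hi => Finset.sum_eq_zero fun m _ => ?_
      unfold cellIdx at hi
      rw [Finset.mem_sigma, Finset.mem_range] at hi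
      unfold monoInd
      rw [indicator_of_notMem, mul_zero]
      intro hmem
      rw [mem_cell_iff hi.2 hs] at hmem
      have : i.1 = q := by rw [hmem]
      rw [this, hn0 q hle] at hi
      omega
    rw [hz, sub_zero, Complex.norm_real, Real.norm_eq_abs, hF1 q s hmq]
    refine (hF2 q s ⟨hmq.1, hmq.2.le⟩).1.trans ?_
    have h1 : (1:ℝ) ≤ 3 * 2 ^ N := by
      have : (1:ℝ) ≤ 2 ^ N := one_le_pow₀ (by norm_num)
      linarith
    have h2 : A q * lam * gK a t s ≤ θ * lam * gK a t s := by gcongr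
    have h3 : 0 ≤ θ * lam * gK a t s := by positivity
    nlinarith
  · have hnq : 0 < n q := by
      rcases Nat.eq_zero_or_pos (n q) with h0 | h0
      · have := hn q hgt
        rw [h0, Nat.cast_zero, zero_pow (by omega), mul_zero] at this
        linarith
      · exact h0
    have hnr : (0:ℝ) < n q := by exact_mod_cast hnq
    set l := ⌊Int.fract (Real.log s) * n q⌋₊ with hl
    have hln : l < n q := by
      rw [hl, Nat.floor_lt (mul_nonneg (Int.fract_nonneg _) hnr.le)]
      have := Int.fract_lt_one (Real.log s)
      nlinarith
    set i0 : (_ : ℤ) × ℕ := ⟨q, l⟩ with hi0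
    have hi0T : i0 ∈ cellIdx n Q := by
      unfold cellIdx
      rw [Finset.mem_sigma, Finset.mem_range]
      exact ⟨hQ q hgt, hln⟩
    have hmem : s ∈ Ico (cellLo n i0) (cellHi n i0) := by
      rw [mem_cell_iff (by exact hln) hs]
    rw [Finset.sum_eq_single_of_mem i0 hi0T]
    swap
    · intro i hi hne
      unfold cellIdx at hi
      rw [Finset.mem_sigma, Finset.mem_range] at hi
      refine Finset.sum_eq_zero fun m _ => ?_
      unfold monoInd
      rw [indicator_of_notMem, mul_zero]
      intro hmem'
      rw [mem_cell_iff hi.2 hs] at hmem'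
      exact hne hmem'
    have hsum : ∑ m ∈ Finset.range N, ((iteratedDerivWithin m (F i0.1)
        (Icc (cellLo n i0) (cellHi n i0)) (cellLo n i0) / m.factorial : ℝ) : ℂ) *
        monoInd (cellLo n i0) (cellHi n i0) m s =
        ((∑ m ∈ Finset.range N, (iteratedDerivWithin m (F i0.1)
        (Icc (cellLo n i0) (cellHi n i0)) (cellLo n i0) / m.factorial) *
          (s - cellLo n i0) ^ m : ℝ) : ℂ) := by
      rw [Complex.ofReal_sum]
      refine Finset.sum_congr rfl fun m _ => ?_
      unfold monoInd
      rw [indicator_of_mem hmem, Complex.ofReal_mul]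
    rw [hsum, ← Complex.ofReal_sub, Complex.norm_real, Real.norm_eq_abs, hF1 q s hmq]
    set x := cellLo n i0 with hx
    set y := cellHi n i0 with hy
    have hx0 : 0 < x := Real.exp_pos _
    have hlq : (l:ℝ) + 1 ≤ n q := by exact_mod_cast hln
    have hqx : Real.exp q ≤ x := Real.exp_le_exp.2 (by
      have : 0 ≤ (l:ℝ) / n q := by positivity
      simp only [hi0]; linarith)
    have hyq : y ≤ Real.exp (q + 1) := Real.exp_le_exp.2 (by
      have : ((l:ℝ) + 1) / n q ≤ 1 := by rw [div_le_one hnr]; exact hlq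
      simp only [hi0]; linarith)
    have hyx : y - x ≤ 2 * x / n q := by
      have e1 : y = x * Real.exp (1 / n q) := by
        rw [hx, hy, cellLo, cellHi, ← Real.exp_add]
        congr 1
        simp only [hi0]; ring
      have h1 : (1:ℝ) ≤ n q := by exact_mod_cast hnq
      have h2 : (1:ℝ) / n q ≤ 1 := by rw [div_le_one hnr]; exact h1
      have h3 : |Real.exp (1 / n q) - 1 - 1 / n q| ≤ (1 / n q) ^ 2 :=
        Real.abs_exp_sub_one_sub_id_le (by rw [abs_of_pos (by positivity)]; exact h2)
      have h4 : (0:ℝ) < 1 / n q := by positivity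
      have h5 : Real.exp (1 / n q) ≤ 1 + 2 * (1 / n q) := by
        have := (abs_le.1 h3).2
        nlinarith
      rw [e1]
      calc x * Real.exp (1 / n q) - x ≤ x * (1 + 2 * (1 / n q)) - x := by gcongr
        _ = _ := by ring
    have hxy : x < y := hmem.1.trans_lt hmem.2
    have hC : ∀ s' ∈ Icc x y, |iteratedDeriv N (F q) s'| ≤ A q * lam * (3 * gK a t s) / x ^ N := by
      intro s' hs'
      have hs0 : 0 < s' := hx0.trans_le hs'.1
      have hb2 := (hF2 q s' ⟨hqx.trans hs'.1, hs'.2.trans hyq⟩).2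
      rw [le_div_iff₀ (by positivity)]
      have hnear : |Real.log s - Real.log s'| ≤ 1 := by
        have a1 := (Real.le_log_iff_exp_le hs).2 hmq.1
        have a2 := (Real.log_lt_iff_lt_exp hs).2 hmq.2
        have a3 := (Real.le_log_iff_exp_le hs0).2 (hqx.trans hs'.1)
        have a4 := (Real.log_le_iff_le_exp hs0).2 (hs'.2.trans hyq)
        rw [abs_le]; constructor <;> linarith
      have hg := gK_le_of_near (a := a) ht hs hs0 hnear
      have hAl : 0 ≤ A q * lam := mul_nonneg (hA q) hlam
      calc |iteratedDeriv N (F q) s'| * x ^ N ≤ |iteratedDeriv N (F q) s'| * s' ^ N := by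
            gcongr; exact hs'.1
        _ ≤ A q * lam * gK a t s' := hb2
        _ ≤ _ := by gcongr
    have ht' := taylor_bound hN (hFd q) hx0 hxy hC ⟨hmem.1, hmem.2.le⟩
    refine ht'.trans ?_
    have hyx0 : 0 ≤ y - x := (sub_pos.2 hxy).le
    calc A q * lam * (3 * gK a t s) / x ^ N * (y - x) ^ N
        ≤ (θ * (n q : ℝ) ^ N) * lam * (3 * gK a t s) / x ^ N * (2 * x / n q) ^ N := by
          gcongr
          exact hn q hgt
      _ = 3 * 2 ^ N * θ * lam * gK a t s := by
          rw [div_pow, mul_pow]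
          have : ((n q : ℝ)) ^ N ≠ 0 := by positivity
          have : x ^ N ≠ 0 := by positivity
          field_simp

end Cells

section Kernels

/-- The index of the logarithmic block `[e^(jL), e^((j+1)L))` containing `t`. -/
def blk (L : ℕ) (t : ℝ) : ℤ := ⌊Real.log t⌋ / (L : ℤ)

/-- The coefficient attached to a block. -/
def coef (α κ0 κinf : ℝ) (L : ℕ) (j : ℤ) : ℝ :=
  (if 0 < j then κinf else κ0) * ((L : ℝ) * |(j : ℝ)|) ^ (-α)

/-- Size function for kernels: bounded on finitely many blocks, small inside the remaining ones. -/
def cellA (α C1 C2 ε : ℝ) (L d J : ℕ) (q : ℤ) : ℝ :=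
  if |q / (L : ℤ)| ≤ J then C1 else
    (if (d : ℤ) ≤ q % (L : ℤ) ∧ q % (L : ℤ) + 1 + d ≤ L then ε else C2) *
      ((L : ℝ) * |((q / (L : ℤ) : ℤ) : ℝ)|) ^ (-α)

/-- Block diagonal Carleman type kernels. -/
def modK (c : ℤ → ℝ) (L : ℕ) (a : ℝ) (t s : ℝ) : ℝ :=
  if blk L t = blk L s then c (blk L s) * Real.exp (a / 2) * (Real.exp a * t + s)⁻¹ else 0

theorem measurable_blk (L : ℕ) : Measurable (blk L) :=
  (Measurable.of_discrete (f := fun n : ℤ => n / (L : ℤ))).comp (by fun_prop)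

theorem measurable_modK (c : ℤ → ℝ) (L : ℕ) (a : ℝ) :
    Measurable fun z : ℝ × ℝ => modK c L a z.1 z.2 := by
  unfold modK
  refine Measurable.ite ?_ ?_ measurable_const
  · exact measurableSet_eq_fun ((measurable_blk L).comp measurable_fst)
      ((measurable_blk L).comp measurable_snd)
  · refine Measurable.mul (Measurable.mul ?_ measurable_const) (by fun_prop)
    exact (Measurable.of_discrete (f := c)).comp ((measurable_blk L).comp measurable_snd)

theorem blk_eq_iff {L : ℕ} (hL : 0 < L) {t : ℝ} {j : ℤ} :
    blk L t = j ↔ (j : ℝ) * L ≤ Real.log t ∧ Real.log t < ((j : ℝ) + 1) * L := by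
  have hL' : (0:ℤ) < L := by exact_mod_cast hL
  unfold blk
  have h1 : j ≤ ⌊Real.log t⌋ / (L : ℤ) ↔ (j : ℝ) * L ≤ Real.log t := by
    rw [Int.le_ediv_iff_mul_le hL', Int.le_floor]; push_cast; rfl
  have h2 : j + 1 ≤ ⌊Real.log t⌋ / (L : ℤ) ↔ ((j : ℝ) + 1) * L ≤ Real.log t := by
    rw [Int.le_ediv_iff_mul_le hL', Int.le_floor]; push_cast; rfl
  rw [← not_le, ← h1, ← h2]
  omega

theorem blk_of_mem_cell {L : ℕ} {q : ℤ} {s : ℝ}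
    (hs : s ∈ Ico (Real.exp q) (Real.exp (q + 1))) : blk L s = q / (L : ℤ) := by
  have hs0 : 0 < s := (Real.exp_pos _).trans_le hs.1
  unfold blk
  congr 1
  rw [Int.floor_eq_iff]
  exact ⟨(Real.le_log_iff_exp_le hs0).2 hs.1, (Real.log_lt_iff_lt_exp hs0).2 hs.2⟩

theorem exp_half_mul_inv_add_eq {t s : ℝ} (ht : 0 < t) (hs : 0 < s) (a : ℝ) :
    Real.exp (a / 2) * (Real.exp a * t + s)⁻¹ =
      t ^ (-(1:ℝ) / 2) * s ^ (-(1:ℝ) / 2) * phiH (Real.log t - Real.log s + a) := by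
  unfold phiH
  set x := Real.log t with hx
  set y := Real.log s with hy
  have e1 : t = Real.exp x := (Real.exp_log ht).symm
  have e2 : s = Real.exp y := (Real.exp_log hs).symm
  rw [Real.rpow_def_of_pos ht, Real.rpow_def_of_pos hs, ← hx, ← hy, Real.cosh_eq, e1, e2,
    ← Real.exp_add a x, ← Real.exp_add]
  have h1 : Real.exp (a + x) + Real.exp y = Real.exp ((a + x + y) / 2) *
      (2 * ((Real.exp ((x - y + a) / 2) + Real.exp (-((x - y + a) / 2))) / 2)) := by
    rw [show ∀ p q r : ℝ, r * (2 * ((p + q) / 2)) = r * p + r * q by intros; ring,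
      ← Real.exp_add, ← Real.exp_add]
    congr 2 <;> ring
  rw [h1, mul_inv, ← mul_assoc, ← Real.exp_neg, ← Real.exp_add]
  congr 2
  ring

theorem exp_half_mul_inv_add_le {t s : ℝ} (ht : 0 < t) (hs : 0 < s) (a : ℝ) :
    Real.exp (a / 2) * (Real.exp a * t + s)⁻¹ ≤
      gK a t s * Real.exp (-|Real.log t - Real.log s + a| / 4) := by
  rw [exp_half_mul_inv_add_eq ht hs, gK, mul_assoc, mul_assoc, mul_assoc,
    ← Real.exp_add]
  have := phiH_le (Real.log t - Real.log s + a)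
  rw [show -|Real.log t - Real.log s + a| / 4 + -|Real.log t - Real.log s + a| / 4 =
    -|Real.log t - Real.log s + a| / 2 by ring]
  gcongr

theorem inv_add_le {t s : ℝ} (ht : 0 < t) (hs : 0 < s) :
    (t + s)⁻¹ ≤ gK 0 t s * Real.exp (-|Real.log t - Real.log s| / 4) := by
  simpa using exp_half_mul_inv_add_le ht hs 0

theorem iteratedDeriv_const_mul_inv_add (C b : ℝ) (m : ℕ) {s : ℝ} :
    iteratedDeriv m (fun s => C * (b + s)⁻¹) s =
      C * ((-1) ^ m * m.factorial * ((b + s) ^ (m + 1))⁻¹) := by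
  rw [iteratedDeriv_const_mul_field]
  have h1 := congrFun (iteratedDeriv_comp_const_add m (Inv.inv : ℝ → ℝ) b) s
  rw [h1, iteratedDeriv_eq_iterate, iter_deriv_inv]
  congr 2
  rw [show (-1 - (m : ℤ)) = -((m + 1 : ℕ) : ℤ) by push_cast; ring, zpow_neg, zpow_natCast]

theorem abs_iteratedDeriv_const_mul_inv_add_le (C : ℝ) {b : ℝ} (hb : 0 ≤ b) {m N : ℕ} (hm : m ≤ N)
    {s : ℝ} (hs : 0 < s) :
    |iteratedDeriv m (fun s => C * (b + s)⁻¹) s| * s ^ m ≤ |C| * N.factorial * (b + s)⁻¹ := by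
  have hbs : 0 < b + s := by linarith
  rw [iteratedDeriv_const_mul_inv_add C b m, abs_mul, abs_mul, abs_mul, abs_pow, abs_neg,
    abs_one, one_pow, one_mul, abs_of_pos (by positivity : 0 < ((b + s) ^ (m + 1))⁻¹),
    Nat.abs_cast]
  have h1 : (m.factorial : ℝ) ≤ N.factorial := by exact_mod_cast Nat.factorial_le hm
  have h2 : ((b + s) ^ (m + 1))⁻¹ * s ^ m ≤ (b + s)⁻¹ := by
    rw [pow_succ, mul_inv, mul_assoc, mul_comm (b + s)⁻¹, ← mul_assoc]
    refine mul_le_of_le_one_left (by positivity) ?_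
    rw [← inv_pow, ← mul_pow]
    refine pow_le_one₀ (by positivity) ?_
    rw [inv_mul_le_iff₀ hbs]; linarith
  calc |C| * (m.factorial * ((b + s) ^ (m + 1))⁻¹) * s ^ m
      = |C| * m.factorial * (((b + s) ^ (m + 1))⁻¹ * s ^ m) := by ring
    _ ≤ _ := by gcongr

theorem contDiffOn_const_mul_inv_add (C : ℝ) {b : ℝ} (hb : 0 ≤ b) (n : WithTop ℕ∞) :
    ContDiffOn ℝ n (fun s => C * (b + s)⁻¹) (Ioi 0) := by
  refine contDiffOn_const.mul (ContDiffOn.inv (contDiffOn_const.add contDiffOn_id) ?_)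
  intro x hx
  have : (0:ℝ) < x := hx
  exact (by positivity : b + x ≠ 0)

theorem abs_coef_le {α κ0 κinf K : ℝ} (h0 : |κ0| ≤ K) (h1 : |κinf| ≤ K) (L : ℕ) (j : ℤ) :
    |coef α κ0 κinf L j| ≤ K * ((L : ℝ) * |(j : ℝ)|) ^ (-α) := by
  unfold coef
  rw [abs_mul, abs_of_nonneg (by positivity : 0 ≤ ((L : ℝ) * |(j : ℝ)|) ^ (-α))]
  gcongr
  split_ifs <;> assumption

theorem rpow_block_le_one {α : ℝ} (hα : 0 < α) {L : ℕ} (hL : 0 < L) (j : ℤ) :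
    ((L : ℝ) * |(j : ℝ)|) ^ (-α) ≤ 1 := by
  rcases eq_or_ne j 0 with rfl | hj
  · simp [Real.zero_rpow (neg_ne_zero.2 hα.ne')]
  · refine Real.rpow_le_one_of_one_le_of_nonpos ?_ (by linarith)
    have h1 : (1:ℝ) ≤ L := by exact_mod_cast hL
    have h2 : (1:ℝ) ≤ |(j : ℝ)| := by exact_mod_cast Int.one_le_abs hj
    nlinarith

/-- Position of a point of the closed cell inside its block. -/
theorem cell_log_bounds {L : ℕ} {q : ℤ} {s : ℝ}
    (hs : s ∈ Icc (Real.exp q) (Real.exp (q + 1))) :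
    ((q / (L : ℤ) : ℤ) : ℝ) * L + ((q % (L : ℤ) : ℤ) : ℝ) ≤ Real.log s ∧
    Real.log s ≤ ((q / (L : ℤ) : ℤ) : ℝ) * L + ((q % (L : ℤ) : ℤ) : ℝ) + 1 := by
  have hs0 : 0 < s := (Real.exp_pos _).trans_le hs.1
  have h1 := (Real.le_log_iff_exp_le hs0).2 hs.1
  have h2 := (Real.log_le_iff_le_exp hs0).2 hs.2
  have h3 : (q : ℝ) = ((q / (L : ℤ) : ℤ) : ℝ) * L + ((q % (L : ℤ) : ℤ) : ℝ) := by
    have := Int.ediv_mul_add_emod q L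
    exact_mod_cast this.symm
  constructor <;> linarith

theorem cellK_of_bounds {N : ℕ} {a lam : ℝ} {A : ℤ → ℝ} {k : ℝ → ℝ → ℝ}
    (hk : Measurable fun z : ℝ × ℝ => k z.1 z.2) (F : ℝ → ℤ → ℝ → ℝ)
    (h1 : ∀ t, 0 < t → ∀ q, ContDiffOn ℝ N (F t q) (Ioi 0))
    (h2 : ∀ t, 0 < t → ∀ q : ℤ, ∀ s ∈ Ico (Real.exp q) (Real.exp (q + 1)), k t s = F t q s)
    (h3 : ∀ t, 0 < t → ∀ q : ℤ, ∀ s ∈ Icc (Real.exp q) (Real.exp (q + 1)), ∀ m, (m = 0 ∨ m = N) →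
      |iteratedDeriv m (F t q) s| * s ^ m ≤ A q * lam * gK a t s) :
    CellK N a lam A k := by
  refine ⟨hk, fun t ht q => ⟨F t q, h1 t ht q, h2 t ht q, fun s hs => ⟨?_, ?_⟩⟩⟩
  · simpa using h3 t ht q s hs 0 (Or.inl rfl)
  · exact h3 t ht q s hs N (Or.inr rfl)

theorem cellK_modK {N : ℕ} {α κ0 κinf K C1 C2 ε : ℝ} (hα : 0 < α) (h0 : |κ0| ≤ K)
    (h1 : |κinf| ≤ K) {L : ℕ} (hL : 0 < L) (d J : ℕ)
    (hC1 : K * N.factorial ≤ C1) (hC2 : K * N.factorial ≤ C2)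
    (hε : K * N.factorial * Real.exp (-(d : ℝ) / 4) ≤ ε) {m : ℤ} (hm : m ≠ 0) :
    CellK N (m * L) (Real.exp (-((L : ℝ) * (|(m : ℝ)| - 1)) / 4)) (cellA α C1 C2 ε L d J)
      (modK (coef α κ0 κinf L) L (m * L)) := by
  set a : ℝ := m * L with ha
  set c := coef α κ0 κinf L with hc
  have hL0 : (0:ℝ) < L := by exact_mod_cast hL
  have hLz : (0:ℤ) < L := by exact_mod_cast hL
  have hK : 0 ≤ K := (abs_nonneg _).trans h0
  refine cellK_of_bounds (measurable_modK _ _ _)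
    (fun t q s => ((if blk L t = q / (L : ℤ) then c (q / (L : ℤ)) else 0) * Real.exp (a / 2)) *
      (Real.exp a * t + s)⁻¹) ?_ ?_ ?_
  · intro t ht q
    exact contDiffOn_const_mul_inv_add _ (by positivity) _
  · intro t ht q s hs
    unfold modK
    rw [blk_of_mem_cell hs]
    split_ifs <;> simp
  · intro t ht q s hs n hn
    have hs0 : 0 < s := (Real.exp_pos _).trans_le hs.1
    refine (abs_iteratedDeriv_const_mul_inv_add_le _ (by positivity : 0 ≤ Real.exp a * t)
      (m := n) (N := N) (by rcases hn with rfl | rfl <;> simp) hs0).trans ?_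
    rw [abs_mul, abs_of_pos (Real.exp_pos (a / 2))]
    have hg := gK_nonneg a ht hs0
    have hinv := exp_half_mul_inv_add_le ht hs0 a
    have hN0 : (0:ℝ) ≤ N.factorial := by positivity
    have hB0 : 0 ≤ ((L : ℝ) * |((q / (L : ℤ) : ℤ) : ℝ)|) ^ (-α) := by positivity
    have hA0 : 0 ≤ cellA α C1 C2 ε L d J q := by
      unfold cellA
      have : 0 ≤ C1 := le_trans (by positivity) hC1
      have : 0 ≤ C2 := le_trans (by positivity) hC2
      have : 0 ≤ ε := le_trans (by positivity) hε
      split_ifs <;> positivity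
    split_ifs with hb
    swap
    · rw [abs_zero, zero_mul, zero_mul, zero_mul]
      positivity
    have hbt := (blk_eq_iff hL).1 hb
    have hbs := cell_log_bounds (L := L) hs
    set j := q / (L : ℤ) with hj
    have hr0 : (0:ℝ) ≤ ((q % (L : ℤ) : ℤ) : ℝ) := by exact_mod_cast Int.emod_nonneg q hLz.ne'
    have hr1 : ((q % (L : ℤ) : ℤ) : ℝ) + 1 ≤ L := by exact_mod_cast Int.emod_lt_of_pos q hLz
    have hm1 : (1:ℝ) ≤ |(m : ℝ)| := by exact_mod_cast Int.one_le_abs hm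
    have haabs : |a| = |(m : ℝ)| * L := by rw [ha, abs_mul, Nat.abs_cast]
    -- lower bound for the distance to the diagonal
    have hdist : ∀ D : ℝ, |Real.log t - Real.log s| ≤ L - D →
        L * (|(m : ℝ)| - 1) + D ≤ |Real.log t - Real.log s + a| := by
      intro D hD
      have := abs_sub_abs_le_abs_sub a (-(Real.log t - Real.log s))
      rw [abs_neg, haabs, sub_neg_eq_add, add_comm a] at this
      nlinarith
    have habs : |Real.log t - Real.log s| ≤ L - 0 := by
      rw [abs_le]; constructor <;> nlinarith
    have hcj := abs_coef_le h0 h1 L j (α := α)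
    have step : ∀ D B : ℝ, |Real.log t - Real.log s| ≤ L - D → K * N.factorial * Real.exp (-D / 4) *
        ((L : ℝ) * |(j : ℝ)|) ^ (-α) ≤ B → |c j| * Real.exp (a / 2) * N.factorial *
        (Real.exp a * t + s)⁻¹ ≤ B * Real.exp (-((L : ℝ) * (|(m : ℝ)| - 1)) / 4) * gK a t s := by
      intro D B hD hB
      have hexp : Real.exp (-|Real.log t - Real.log s + a| / 4) ≤
          Real.exp (-D / 4) * Real.exp (-((L : ℝ) * (|(m : ℝ)| - 1)) / 4) := by
        rw [← Real.exp_add]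
        refine Real.exp_le_exp.2 ?_
        have := hdist D hD
        linarith
      calc |c j| * Real.exp (a / 2) * N.factorial * (Real.exp a * t + s)⁻¹
          = |c j| * N.factorial * (Real.exp (a / 2) * (Real.exp a * t + s)⁻¹) := by ring
        _ ≤ (K * ((L : ℝ) * |(j : ℝ)|) ^ (-α)) * N.factorial * (gK a t s *
            (Real.exp (-D / 4) * Real.exp (-((L : ℝ) * (|(m : ℝ)| - 1)) / 4))) := by
          refine mul_le_mul (by gcongr) (hinv.trans (by gcongr)) ?_ (by positivity)
          exact mul_nonneg (Real.exp_pos _).le (inv_nonneg.2 (by positivity))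
        _ = (K * N.factorial * Real.exp (-D / 4) * ((L : ℝ) * |(j : ℝ)|) ^ (-α)) *
            Real.exp (-((L : ℝ) * (|(m : ℝ)| - 1)) / 4) * gK a t s := by ring
        _ ≤ _ := by gcongr
    unfold cellA
    rw [← hj]
    split_ifs with hJ hint
    · refine step 0 C1 habs ?_
      have h1 := rpow_block_le_one hα hL j
      simp only [neg_zero, zero_div, Real.exp_zero, mul_one]
      refine (mul_le_of_le_one_right (by positivity) h1).trans hC1
    · refine step d _ ?_ ?_
      · have i1 : (d : ℝ) ≤ ((q % (L : ℤ) : ℤ) : ℝ) := by exact_mod_cast hint.1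
        have i2 : ((q % (L : ℤ) : ℤ) : ℝ) + 1 + d ≤ L := by exact_mod_cast hint.2
        rw [abs_le]; constructor <;> nlinarith
      · gcongr
    · refine step 0 _ habs ?_
      simp only [neg_zero, zero_div, Real.exp_zero, mul_one]
      gcongr

end Kernels

section Regular

/-- Smooth kernels with prescribed logarithmic behaviour at zero and at infinity. -/
structure Reg (N : ℕ) (α κ0 κinf C : ℝ) (f : ℝ → ℝ) : Prop where
  one_le : 1 ≤ N
  lt_order : α < N
  meas : Measurable f
  smooth : ContDiffOn ℝ N f (Ioi 0)
  bound : ∀ τ, 0 < τ → ∀ m, (m = 0 ∨ m = N) →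
    |iteratedDeriv m f τ| * τ ^ (m + 1) ≤ C * (1 + |Real.log τ|) ^ (-α)
  asymp_inf : ∀ η, 0 < η → ∃ X, ∀ τ, 0 < τ → X ≤ Real.log τ → ∀ m, (m = 0 ∨ m = N) →
    |iteratedDeriv m f τ * τ ^ (m + 1) - (-1) ^ m * m.factorial * (κinf * |Real.log τ| ^ (-α))| ≤
      η * |Real.log τ| ^ (-α)
  asymp_zero : ∀ η, 0 < η → ∃ X, ∀ τ, 0 < τ → Real.log τ ≤ -X → ∀ m, (m = 0 ∨ m = N) →
    |iteratedDeriv m f τ * τ ^ (m + 1) - (-1) ^ m * m.factorial * (κ0 * |Real.log τ| ^ (-α))| ≤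
      η * |Real.log τ| ^ (-α)

theorem exists_rpow_near (α : ℝ) {η : ℝ} (hη : 0 < η) :
    ∃ δ, 0 < δ ∧ ∀ r : ℝ, |r - 1| ≤ δ → |r ^ (-α) - 1| ≤ η := by
  have hc : ContinuousAt (fun r : ℝ => r ^ (-α)) 1 :=
    Real.continuousAt_rpow_const 1 (-α) (Or.inl one_ne_zero)
  obtain ⟨δ, hδ, h⟩ := Metric.continuousAt_iff.1 hc η hη
  refine ⟨δ / 2, by positivity, fun r hr => ?_⟩
  have := h (x := r) (by rw [Real.dist_eq]; linarith)
  rw [Real.dist_eq, Real.one_rpow] at this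
  exact this.le

theorem Reg.block {N : ℕ} {α κ0 κinf C : ℝ} {f : ℝ → ℝ} (hf : Reg N α κ0 κinf C f) {L : ℕ}
    (hL : 0 < L) {η : ℝ} (hη : 0 < η) :
    ∃ J : ℕ, 2 ≤ J ∧ ∀ j : ℤ, (J : ℤ) < |j| → ∀ τ, 0 < τ → (j : ℝ) * L ≤ Real.log τ →
      Real.log τ ≤ ((j : ℝ) + 1) * L + 1 → ∀ m, (m = 0 ∨ m = N) →
      |iteratedDeriv m f τ * τ ^ (m + 1) - (-1) ^ m * m.factorial * coef α κ0 κinf L j| ≤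
        η * ((L : ℝ) * |(j : ℝ)|) ^ (-α) := by
  obtain ⟨X1, hX1⟩ := hf.asymp_inf (η / 4) (by positivity)
  obtain ⟨X0, hX0⟩ := hf.asymp_zero (η / 4) (by positivity)
  set K : ℝ := max |κ0| |κinf| with hK
  have hK0 : 0 ≤ K := (abs_nonneg κ0).trans (le_max_left _ _)
  set η' : ℝ := min 1 (η / (2 * (N.factorial * K + 1))) with hη'
  have hη'0 : 0 < η' := by positivity
  obtain ⟨δ, hδ, hδ'⟩ := exists_rpow_near α hη'0
  obtain ⟨J, hJ⟩ := exists_nat_ge (2 + |X1| + |X0| + 2 / δ)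
  have hd0 : 0 ≤ 2 / δ := by positivity
  have hJ2 : (2:ℝ) ≤ J := by linarith [abs_nonneg X1, abs_nonneg X0]
  refine ⟨J, by exact_mod_cast hJ2, fun j hj τ hτ hx1 hx2 m hm => ?_⟩
  set x := Real.log τ with hx
  have hL1 : (1:ℝ) ≤ L := by exact_mod_cast hL
  have hj' : (J : ℝ) < |(j : ℝ)| := by exact_mod_cast hj
  have hj0 : 0 < |(j : ℝ)| := by linarith
  set B := ((L : ℝ) * |(j : ℝ)|) ^ (-α) with hB
  have hB0 : 0 < B := by positivity
  set r : ℝ := |x| / (L * |(j : ℝ)|) with hr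
  have hr1 : |r - 1| ≤ δ := by
    have h1 : r - 1 = (|x| - L * |(j : ℝ)|) / (L * |(j : ℝ)|) := by
      rw [hr]; field_simp
    rw [h1, abs_div, abs_of_pos (by positivity : 0 < L * |(j : ℝ)|), div_le_iff₀ (by positivity)]
    have h2 : |(|x| - L * |(j : ℝ)|)| ≤ L + 1 := by
      have := abs_abs_sub_abs_le x (j * L)
      rw [abs_mul, Nat.abs_cast, mul_comm |(j : ℝ)|] at this
      refine this.trans ?_
      rw [abs_le]; constructor <;> linarith
    have h3 : 2 ≤ δ * |(j : ℝ)| := by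
      have : 2 / δ ≤ |(j : ℝ)| := by linarith [abs_nonneg X1, abs_nonneg X0]
      rw [div_le_iff₀ hδ] at this
      linarith
    nlinarith
  have hxr : |x| ^ (-α) = r ^ (-α) * B := by
    rw [hB, ← Real.mul_rpow (by positivity) (by positivity), hr]
    congr 1
    field_simp
  have hnear := hδ' r hr1
  have hr2 : r ^ (-α) ≤ 2 := by
    have := (abs_le.1 hnear).2
    have : η' ≤ 1 := min_le_left _ _
    linarith
  have hfac : (m.factorial : ℝ) ≤ N.factorial := by
    exact_mod_cast Nat.factorial_le (by rcases hm with rfl | rfl <;> simp)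
  have key : ∀ κ : ℝ, |κ| ≤ K → coef α κ0 κinf L j = κ * B →
      |iteratedDeriv m f τ * τ ^ (m + 1) - (-1) ^ m * m.factorial * (κ * |x| ^ (-α))| ≤
        η / 4 * |x| ^ (-α) →
      |iteratedDeriv m f τ * τ ^ (m + 1) - (-1) ^ m * m.factorial * coef α κ0 κinf L j| ≤ η * B := by
    intro κ hκ hc h
    rw [hc]
    have e1 : iteratedDeriv m f τ * τ ^ (m + 1) - (-1) ^ m * m.factorial * (κ * B) =
        (iteratedDeriv m f τ * τ ^ (m + 1) - (-1) ^ m * m.factorial * (κ * |x| ^ (-α))) +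
        (-1) ^ m * (m.factorial * (κ * ((r ^ (-α) - 1) * B))) := by rw [hxr]; ring
    rw [e1]
    refine (abs_add_le _ _).trans ?_
    have e2 : |(-1) ^ m * (m.factorial * (κ * ((r ^ (-α) - 1) * B)))| ≤
        N.factorial * (K * (η' * B)) := by
      rw [abs_mul, abs_pow, abs_neg, abs_one, one_pow, one_mul, abs_mul, abs_mul, abs_mul,
        Nat.abs_cast, abs_of_pos hB0]
      gcongr
    have e3 : (N.factorial : ℝ) * (K * (η' * B)) ≤ η / 2 * B := by
      have h1 : η' ≤ η / (2 * (N.factorial * K + 1)) := min_le_right _ _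
      rw [le_div_iff₀ (by positivity)] at h1
      have : (N.factorial : ℝ) * K * η' ≤ η / 2 := by nlinarith
      calc (N.factorial : ℝ) * (K * (η' * B)) = (N.factorial : ℝ) * K * η' * B := by ring
        _ ≤ _ := by gcongr
    have e4 : η / 4 * |x| ^ (-α) ≤ η / 2 * B := by
      rw [hxr]
      have := mul_le_mul_of_nonneg_right hr2 hB0.le
      nlinarith
    linarith
  rcases lt_or_gt_of_ne (show (j : ℝ) ≠ 0 from abs_pos.1 hj0) with h | h
  · have hjn : ¬ (0 < j) := by
      have : j < 0 := by exact_mod_cast h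
      omega
    refine key κ0 (le_max_left _ _) (by unfold coef; rw [if_neg hjn]) (hX0 τ hτ ?_ m hm)
    rw [abs_of_neg h] at hj'
    have : X0 ≤ |X0| := le_abs_self _
    nlinarith [abs_nonneg X1]
  · have hjn : 0 < j := by exact_mod_cast h
    refine key κinf (le_max_right _ _) (by unfold coef; rw [if_pos hjn]) (hX1 τ hτ ?_ m hm)
    rw [abs_of_pos h] at hj'
    have : X1 ≤ |X1| := le_abs_self _
    nlinarith [abs_nonneg X0]

/-- A Peetre type inequality for logarithmic weights. -/
theorem log_weight_le {α : ℝ} (hα : 0 < α) {T y z : ℝ} (h : |T - y| ≤ |z| + 1) :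
    (1 + |T|) ^ (-α) ≤
      (8 * α) ^ α * Real.exp (1 / 4) * (1 + |y|) ^ (-α) * Real.exp (|z| / 8) := by
  have h1 : 1 + |y| ≤ (1 + |T|) * (2 + |z|) := by
    have := abs_sub_abs_le_abs_sub y T
    rw [abs_sub_comm] at this
    nlinarith [abs_nonneg T, abs_nonneg z]
  have hz : 0 ≤ |z| := abs_nonneg z
  have h2 : (1 + |y|) ^ α ≤ (1 + |T|) ^ α * (2 + |z|) ^ α := by
    rw [← Real.mul_rpow (by positivity) (by positivity)]
    exact Real.rpow_le_rpow (by positivity) h1 hα.le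
  have h3 : (2 + |z|) ^ α ≤ (8 * α) ^ α * (Real.exp (1 / 4) * Real.exp (|z| / 8)) := by
    have e : (2 + |z|) = 8 * α * ((2 + |z|) / (8 * α)) := by field_simp
    rw [e, Real.mul_rpow (by positivity) (by positivity), ← Real.exp_add]
    gcongr
    calc ((2 + |z|) / (8 * α)) ^ α ≤ (Real.exp ((2 + |z|) / (8 * α))) ^ α := by
          refine Real.rpow_le_rpow (by positivity) ?_ hα.le
          linarith [Real.add_one_le_exp ((2 + |z|) / (8 * α))]
      _ = Real.exp (1 / 4 + |z| / 8) := by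
          rw [← Real.exp_mul]; congr 1; field_simp; ring
  have hT : 0 < (1 + |T|) ^ α := by positivity
  have hy : 0 < (1 + |y|) ^ α := by positivity
  rw [Real.rpow_neg (by positivity), Real.rpow_neg (by positivity),
    show (8 * α) ^ α * Real.exp (1 / 4) * ((1 + |y|) ^ α)⁻¹ * Real.exp (|z| / 8) =
      ((8 * α) ^ α * (Real.exp (1 / 4) * Real.exp (|z| / 8))) / (1 + |y|) ^ α by
      rw [div_eq_mul_inv]; ring, inv_eq_one_div, div_le_div_iff₀ hT hy, one_mul]
  calc (1 + |y|) ^ α ≤ (1 + |T|) ^ α * (2 + |z|) ^ α := h2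
    _ ≤ _ := by rw [mul_comm]; gcongr

theorem abs_log_add_sub_le {t s : ℝ} (ht : 0 < t) (hs : 0 < s) :
    |Real.log (t + s) - Real.log s| ≤ |Real.log t - Real.log s| + 1 := by
  have h0 : Real.log s ≤ Real.log (t + s) := Real.log_le_log hs (by linarith)
  rw [abs_of_nonneg (by linarith)]
  have hm : t + s ≤ 2 * max t s := by linarith [le_max_left t s, le_max_right t s]
  have h1 : Real.log (t + s) ≤ Real.log 2 + Real.log (max t s) := by
    rw [← Real.log_mul two_ne_zero (by positivity)]
    exact Real.log_le_log (by positivity) hm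
  have h2 : Real.log 2 ≤ 1 := by linarith [Real.log_two_lt_d9]
  rcases max_cases t s with ⟨h, _⟩ | ⟨h, _⟩ <;> rw [h] at h1
  · linarith [le_abs_self (Real.log t - Real.log s)]
  · linarith [abs_nonneg (Real.log t - Real.log s)]

end Regular

section Remainder

theorem mul_pow_le_of_le {D t s : ℝ} (hD : 0 ≤ D) (ht : 0 < t) (hs : 0 < s) (m : ℕ) {E : ℝ}
    (h : D * (t + s) ^ (m + 1) ≤ E) : D * s ^ m ≤ E * (t + s)⁻¹ := by
  have h1 : s ^ m ≤ (t + s) ^ m := by gcongr; linarith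
  rw [le_mul_inv_iff₀ (by positivity)]
  calc D * s ^ m * (t + s) ≤ D * (t + s) ^ m * (t + s) := by gcongr
    _ = D * (t + s) ^ (m + 1) := by ring
    _ ≤ E := h

theorem gK_exp_le {t s : ℝ} (ht : 0 < t) (hs : 0 < s) : (t + s)⁻¹ ≤ gK 0 t s := by
  refine (inv_add_le ht hs).trans (mul_le_of_le_one_right (gK_nonneg 0 ht hs) ?_)
  rw [Real.exp_le_one_iff]
  have := abs_nonneg (Real.log t - Real.log s)
  linarith

/-- The difference between a regular kernel and its block diagonal model. -/
def remK (f : ℝ → ℝ) (c : ℤ → ℝ) (L : ℕ) (t s : ℝ) : ℝ := f (t + s) - modK c L 0 t s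

theorem Reg.exists_cellK_remK {N : ℕ} {α κ0 κinf C : ℝ} {f : ℝ → ℝ} (hα : 0 < α)
    (hf : Reg N α κ0 κinf C f) :
    ∃ C0 : ℝ, 0 < C0 ∧ (max |κ0| |κinf|) * N.factorial ≤ C0 ∧
      ∀ (ε : ℝ) (L d : ℕ), 0 < ε → 0 < L → C0 * Real.exp (-(d : ℝ) / 8) ≤ ε →
      ∃ J : ℕ, CellK N 0 1 (cellA α C0 (C0 + ε) ε L d J) (remK f (coef α κ0 κinf L) L) := by
  set K : ℝ := max |κ0| |κinf| with hK
  have hK0 : 0 ≤ K := (abs_nonneg κ0).trans (le_max_left _ _)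
  set P : ℝ := (8 * α) ^ α * Real.exp (1 / 4) with hP
  have hP0 : 0 < P := by positivity
  have hC : 0 ≤ C := by
    have := hf.bound 1 one_pos 0 (Or.inl rfl)
    simp only [iteratedDeriv_zero, one_pow, Real.log_one, abs_zero, add_zero, Real.one_rpow,
      mul_one] at this
    exact (abs_nonneg _).trans this
  set C0 : ℝ := C + K * N.factorial + C * P * 2 ^ α + 1 with hC0
  have hfK : 0 ≤ K * N.factorial := by positivity
  have hCP : 0 ≤ C * P * 2 ^ α := by positivity
  have hC0p : 0 < C0 := by positivity
  refine ⟨C0, hC0p, by linarith, fun ε L d hε hL hd => ?_⟩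
  obtain ⟨J, hJ2, hJ⟩ := hf.block hL hε
  refine ⟨J, ?_⟩
  set c := coef α κ0 κinf L with hc
  have hL0 : (0:ℝ) < L := by exact_mod_cast hL
  have hLz : (0:ℤ) < L := by exact_mod_cast hL
  have hsm : ∀ t, 0 < t → ∀ C' : ℝ, ContDiffOn ℝ N (fun s => f (t + s) - C' * (t + s)⁻¹) (Ioi 0) := by
    intro t ht C'
    refine ContDiffOn.sub ?_ (contDiffOn_const_mul_inv_add C' ht.le _)
    refine hf.smooth.comp (contDiffOn_const.add contDiffOn_id) ?_
    intro x hx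
    exact add_pos ht hx
  have hder : ∀ t s, 0 < t → 0 < s → ∀ C' : ℝ, ∀ m, m ≤ N →
      iteratedDeriv m (fun s => f (t + s) - C' * (t + s)⁻¹) s =
        iteratedDeriv m f (t + s) - C' * ((-1) ^ m * m.factorial * ((t + s) ^ (m + 1))⁻¹) := by
    intro t s ht hs C' m hm
    have hmN : (m : WithTop ℕ∞) ≤ N := by exact_mod_cast hm
    rw [iteratedDeriv_fun_sub, iteratedDeriv_const_mul_inv_add,
      congrFun (iteratedDeriv_comp_const_add m f t) s]
    · have := (hf.smooth (t + s) (add_pos ht hs)).contDiffAt (Ioi_mem_nhds (add_pos ht hs))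
      refine (ContDiffAt.comp s this ?_).of_le hmN
      exact contDiffAt_const.add contDiffAt_id
    · exact ((contDiffOn_const_mul_inv_add C' ht.le N) s hs).contDiffAt (Ioi_mem_nhds hs)
        |>.of_le hmN
  refine cellK_of_bounds (F := fun t q s => f (t + s) -
      (if blk L t = q / (L : ℤ) then c (q / (L : ℤ)) else 0) * (t + s)⁻¹) ?_ ?_ ?_ ?_
  · exact (hf.meas.comp (measurable_fst.add measurable_snd)).sub (measurable_modK c L 0)
  · intro t ht q
    exact hsm t ht _
  · intro t ht q s hs
    simp only [remK, modK, blk_of_mem_cell hs]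
    split_ifs <;> simp
  intro t ht q s hs m hm
  have hmN : m ≤ N := by rcases hm with rfl | rfl <;> simp
  have hs0 : 0 < s := (Real.exp_pos _).trans_le hs.1
  have hts : 0 < t + s := add_pos ht hs0
  rw [hder t s ht hs0 _ m hmN, mul_one]
  have hg := gK_nonneg 0 ht hs0
  have hb := hf.bound (t + s) hts m hm
  have hbs := cell_log_bounds (L := L) hs
  have hcell := abs_log_add_sub_le ht hs0
  unfold cellA
  set j := q / (L : ℤ) with hj
  set B : ℝ := ((L : ℝ) * |(j : ℝ)|) ^ (-α) with hB
  have hB0 : 0 ≤ B := by positivity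
  have hr0 : (0:ℝ) ≤ ((q % (L : ℤ) : ℤ) : ℝ) := by exact_mod_cast Int.emod_nonneg q hLz.ne'
  have hr1 : ((q % (L : ℤ) : ℤ) : ℝ) + 1 ≤ L := by exact_mod_cast Int.emod_lt_of_pos q hLz
  have hfac : (m.factorial : ℝ) ≤ N.factorial := by exact_mod_cast Nat.factorial_le hmN
  by_cases hjJ : |j| ≤ (J : ℤ)
  · rw [if_pos hjJ]
    have hcj : |if blk L t = j then c j else 0| ≤ K := by
      split_ifs
      · refine (abs_coef_le (le_max_left _ _) (le_max_right _ _) L j).trans ?_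
        exact mul_le_of_le_one_right hK0 (rpow_block_le_one hα hL j)
      · simpa using hK0
    generalize (if blk L t = j then c j else 0) = c' at hcj ⊢
    have h1 : |iteratedDeriv m f (t + s) - c' * ((-1) ^ m * m.factorial * ((t + s) ^ (m + 1))⁻¹)| *
        (t + s) ^ (m + 1) ≤ C + K * N.factorial := by
      refine (mul_le_mul_of_nonneg_right (abs_sub _ _) (by positivity)).trans ?_
      rw [add_mul]
      refine add_le_add (hb.trans ?_) ?_
      · refine mul_le_of_le_one_right hC ?_
        exact Real.rpow_le_one_of_one_le_of_nonpos
          (by linarith [abs_nonneg (Real.log (t + s))]) (by linarith)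
      · rw [abs_mul, abs_mul, abs_mul, abs_pow, abs_neg, abs_one, one_pow, one_mul, Nat.abs_cast,
          abs_of_pos (by positivity : 0 < ((t + s) ^ (m + 1))⁻¹), mul_assoc, mul_assoc,
          inv_mul_cancel₀ (by positivity), mul_one]
        gcongr
    refine (mul_pow_le_of_le (abs_nonneg _) ht hs0 m h1).trans ?_
    have := gK_exp_le ht hs0
    have h2 : 0 ≤ C + K * N.factorial := by positivity
    refine mul_le_mul (by linarith) this (by positivity) hC0p.le
  rw [if_neg hjJ]
  have hjJ' : (J : ℤ) < |j| := not_le.1 hjJ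
  have hj2 : (2:ℝ) < |(j : ℝ)| := by
    have : (2 : ℤ) < |j| := lt_of_le_of_lt (by exact_mod_cast hJ2) hjJ'
    exact_mod_cast this
  by_cases hblk : blk L t = j
  · rw [if_pos hblk]
    have hbt := (blk_eq_iff hL).1 hblk
    have hlt : t + s ≤ 2 * Real.exp (((j : ℝ) + 1) * L) := by
      have h1 : t ≤ Real.exp (((j : ℝ) + 1) * L) := (Real.log_le_iff_le_exp ht).1 hbt.2.le
      have h2 : s ≤ Real.exp (((j : ℝ) + 1) * L) :=
        (Real.log_le_iff_le_exp hs0).1 (by linarith)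
      linarith
    have h3 : Real.log (t + s) ≤ ((j : ℝ) + 1) * L + 1 := by
      have := Real.log_le_log hts hlt
      rw [Real.log_mul two_ne_zero (Real.exp_pos _).ne', Real.log_exp] at this
      linarith [Real.log_two_lt_d9]
    have h4 : (j : ℝ) * L ≤ Real.log (t + s) :=
      hbt.1.trans (Real.log_le_log ht (by linarith))
    have h5 := hJ j hjJ' (t + s) hts h4 h3 m hm
    have h6 : |iteratedDeriv m f (t + s) - c j * ((-1) ^ m * m.factorial * ((t + s) ^ (m + 1))⁻¹)| *
        (t + s) ^ (m + 1) ≤ ε * B := by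
      refine le_trans (le_of_eq ?_) h5
      rw [← abs_of_pos (by positivity : 0 < (t + s) ^ (m + 1)), ← abs_mul,
        abs_of_pos (by positivity : 0 < (t + s) ^ (m + 1)), sub_mul]
      congr 2
      rw [mul_assoc, mul_assoc, inv_mul_cancel₀ (by positivity)]
      ring
    refine (mul_pow_le_of_le (abs_nonneg _) ht hs0 m h6).trans ?_
    have := gK_exp_le ht hs0
    have h7 : ε ≤ if (d : ℤ) ≤ q % (L : ℤ) ∧ q % (L : ℤ) + 1 + d ≤ L then ε else C0 + ε := by
      split_ifs <;> linarith
    gcongr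
  · rw [if_neg hblk]
    simp only [zero_mul, sub_zero]
    set z := Real.log t - Real.log s with hz
    have hy : (L : ℝ) * |(j : ℝ)| / 2 ≤ 1 + |Real.log s| := by
      rcases lt_or_ge (j : ℝ) 0 with h | h
      · rw [abs_of_neg h] at hj2 ⊢
        have := neg_le_abs (Real.log s)
        nlinarith
      · rw [abs_of_nonneg h] at hj2 ⊢
        have := le_abs_self (Real.log s)
        nlinarith
    have hyB : (1 + |Real.log s|) ^ (-α) ≤ 2 ^ α * B := by
      refine (Real.rpow_le_rpow_of_nonpos (by positivity) hy (by linarith)).trans (le_of_eq ?_)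
      rw [hB, Real.div_rpow (by positivity) (by positivity), Real.rpow_neg zero_le_two]
      field_simp
    have hw := log_weight_le hα hcell
    have h1 := mul_pow_le_of_le (abs_nonneg _) ht hs0 m hb
    have hinv := inv_add_le ht hs0
    rw [← hz] at hinv
    have h2 : |iteratedDeriv m f (t + s)| * s ^ m ≤
        C * P * 2 ^ α * Real.exp (-|z| / 8) * B * gK 0 t s := by
      refine h1.trans ?_
      calc C * (1 + |Real.log (t + s)|) ^ (-α) * (t + s)⁻¹
          ≤ C * (P * (2 ^ α * B) * Real.exp (|z| / 8)) * (gK 0 t s * Real.exp (-|z| / 4)) := by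
            gcongr
            exact hw.trans (by gcongr)
        _ = C * P * 2 ^ α * (Real.exp (|z| / 8) * Real.exp (-|z| / 4)) * B * gK 0 t s := by ring
        _ = _ := by
            rw [← Real.exp_add]; congr 4; ring
    refine h2.trans ?_
    have hone : C * P * 2 ^ α ≤ C0 := by linarith
    split_ifs with hint
    · gcongr
      refine le_trans ?_ hd
      refine mul_le_mul hone (Real.exp_le_exp.2 ?_) (Real.exp_pos _).le hC0p.le
      have i1 : (d : ℝ) ≤ ((q % (L : ℤ) : ℤ) : ℝ) := by exact_mod_cast hint.1
      have i2 : ((q % (L : ℤ) : ℤ) : ℝ) + 1 + d ≤ L := by exact_mod_cast hint.2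
      have hzd : (d : ℝ) ≤ |z| := by
        rw [blk_eq_iff hL] at hblk
        rcases lt_or_ge (Real.log t) ((j : ℝ) * L) with h | h
        · have := neg_le_abs z
          linarith
        · have h' : ((j : ℝ) + 1) * L ≤ Real.log t := by
            by_contra hcon
            exact hblk ⟨h, not_le.1 hcon⟩
          have := le_abs_self z
          linarith
      linarith
    · gcongr
      refine le_trans (mul_le_of_le_one_right hCP ?_) (by linarith : C * P * 2 ^ α ≤ C0 + ε)
      rw [Real.exp_le_one_iff]
      have := abs_nonneg z
      linarith

end Remainder

section Basis

/-- Logarithmic exponentials supported on one block. -/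
def eF (L : ℕ) (i : ℤ × ℤ) (t : ℝ) : ℂ :=
  if blk L t = i.1 then (((L : ℝ) ^ (-(1:ℝ) / 2) * t ^ (-(1:ℝ) / 2) : ℝ) : ℂ) *
    Complex.exp (Complex.I * ((2 * Real.pi / L * i.2 * Real.log t : ℝ) : ℂ)) else 0

theorem blk_eq_iff_mem {L : ℕ} (hL : 0 < L) {t : ℝ} (ht : 0 < t) {j : ℤ} :
    blk L t = j ↔ t ∈ Ico (Real.exp (j * L)) (Real.exp ((j + 1) * L)) := by
  rw [blk_eq_iff hL, mem_Ico, Real.le_log_iff_exp_le ht, Real.log_lt_iff_lt_exp ht]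

theorem integral_blk {L : ℕ} (hL : 0 < L) (j : ℤ) (F : ℝ → ℂ) :
    ∫ t, (if blk L t = j then F t else 0) ∂muP =
      ∫ t in (Real.exp (j * L))..(Real.exp ((j + 1) * L)), F t := by
  have hle : Real.exp (j * L) ≤ Real.exp ((j + 1) * L) := by
    refine Real.exp_le_exp.2 ?_
    have : (0:ℝ) ≤ L := by positivity
    nlinarith
  rw [intervalIntegral.integral_of_le hle, ← integral_Ico_eq_integral_Ioc]
  have h1 : ∫ t, (if blk L t = j then F t else 0) ∂muP =
      ∫ t in Ioi 0, (Ico (Real.exp (j * L)) (Real.exp ((j + 1) * L))).indicator F t := by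
    refine setIntegral_congr_fun measurableSet_Ioi fun t ht => ?_
    simp only [indicator, ← blk_eq_iff_mem hL ht]
  rw [h1, setIntegral_indicator measurableSet_Ico, inter_eq_right.2]
  intro t ht
  exact (Real.exp_pos _).trans_le ht.1

theorem measurable_eF (L : ℕ) (i : ℤ × ℤ) : Measurable (eF L i) := by
  unfold eF
  refine Measurable.ite (measurable_blk L (measurableSet_singleton i.1)) ?_ measurable_const
  fun_prop

theorem norm_eF_le {L : ℕ} (hL : 0 < L) (i : ℤ × ℤ) {t : ℝ} (ht : 0 < t) :
    ‖eF L i t‖ ≤ ‖(Ico (Real.exp (i.1 * L)) (Real.exp ((i.1 + 1) * L))).indicator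
      (fun _ => (L : ℝ) ^ (-(1:ℝ) / 2) * (Real.exp (i.1 * L)) ^ (-(1:ℝ) / 2)) t‖ := by
  unfold eF
  by_cases h : blk L t = i.1
  · have hm := (blk_eq_iff_mem hL ht).1 h
    have he : ‖Complex.exp (Complex.I * ((2 * Real.pi / L * i.2 * Real.log t : ℝ) : ℂ))‖ = 1 := by
      rw [mul_comm, Complex.norm_exp_ofReal_mul_I]
    rw [if_pos h, indicator_of_mem hm, norm_mul, he, mul_one,
      Complex.norm_real, Real.norm_of_nonneg (by positivity), Real.norm_of_nonneg (by positivity)]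
    gcongr ?_ * ?_
    exact Real.rpow_le_rpow_of_nonpos (Real.exp_pos _) hm.1 (by norm_num)
  · rw [if_neg h]
    simp

theorem memLp_eF {L : ℕ} (hL : 0 < L) (i : ℤ × ℤ) : MemLp (eF L i) 2 muP := by
  refine MemLp.mono (g := (Ico (Real.exp (i.1 * L)) (Real.exp ((i.1 + 1) * L))).indicator
      (fun _ => (L : ℝ) ^ (-(1:ℝ) / 2) * (Real.exp (i.1 * L)) ^ (-(1:ℝ) / 2))) ?_
    (measurable_eF L i).aestronglyMeasurable ?_
  · refine memLp_indicator_const 2 measurableSet_Ico _ (Or.inr ?_)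
    refine ne_top_of_le_ne_top ?_ (Measure.restrict_le_self _)
    simp
  · filter_upwards [ae_muP_pos] with t ht using norm_eF_le hL i ht

/-- The basis functions as vectors. -/
def eV {L : ℕ} (hL : 0 < L) (i : ℤ × ℤ) : HSp := (memLp_eF hL i).toLp

theorem integral_log_exp {L : ℕ} (hL : 0 < L) (j n : ℤ) :
    ∫ t in (Real.exp (j * L))..(Real.exp ((j + 1) * L)), (((L : ℝ)⁻¹ * t⁻¹ : ℝ) : ℂ) *
      Complex.exp (Complex.I * ((2 * Real.pi / L * n * Real.log t : ℝ) : ℂ)) =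
      if n = 0 then 1 else 0 := by
  have hL0 : (0:ℝ) < L := by exact_mod_cast hL
  have hle : Real.exp (j * L) ≤ Real.exp ((j + 1) * L) := Real.exp_le_exp.2 (by nlinarith)
  have hpos : ∀ t ∈ uIcc (Real.exp (j * L)) (Real.exp ((j + 1) * L)), 0 < t := by
    intro t ht
    rw [uIcc_of_le hle] at ht
    exact (Real.exp_pos _).trans_le ht.1
  have hint : IntervalIntegrable (fun t : ℝ => (((L : ℝ)⁻¹ * t⁻¹ : ℝ) : ℂ) *
      Complex.exp (Complex.I * ((2 * Real.pi / L * n * Real.log t : ℝ) : ℂ))) volume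
      (Real.exp (j * L)) (Real.exp ((j + 1) * L)) := by
    refine ContinuousOn.intervalIntegrable fun t ht => ?_
    have := (hpos t ht).ne'
    refine ContinuousAt.continuousWithinAt ?_
    fun_prop (disch := assumption)
  split_ifs with hn
  · subst hn
    rw [intervalIntegral.integral_eq_sub_of_hasDerivAt
      (f := fun t : ℝ => (((L : ℝ)⁻¹ * Real.log t : ℝ) : ℂ)) ?_ hint]
    · rw [Real.log_exp, Real.log_exp, ← Complex.ofReal_sub]
      norm_cast
      field_simp
      push_cast
      ring
    · intro t ht
      have := ((Real.hasDerivAt_log (hpos t ht).ne').const_mul (L : ℝ)⁻¹).ofReal_comp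
      simpa using this
  · set ω : ℝ := 2 * Real.pi / L * n with hω
    have hn' : (n : ℝ) ≠ 0 := by exact_mod_cast hn
    have hω0 : ω ≠ 0 := by have := Real.pi_pos.ne'; positivity
    have hωc : (ω : ℂ) ≠ 0 := by exact_mod_cast hω0
    have hLc : (L : ℂ) ≠ 0 := by exact_mod_cast hL.ne'
    rw [intervalIntegral.integral_eq_sub_of_hasDerivAt (f := fun t : ℝ =>
      ((L : ℂ) * (Complex.I * ω))⁻¹ * Complex.exp (Complex.I * ((ω * Real.log t : ℝ) : ℂ))) ?_ hint]
    · rw [Real.log_exp, Real.log_exp, ← mul_sub]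
      have : Complex.exp (Complex.I * ((ω * ((j + 1) * L) : ℝ) : ℂ)) =
          Complex.exp (Complex.I * ((ω * (j * L) : ℝ) : ℂ)) := by
        rw [Complex.exp_eq_exp_iff_exists_int]
        refine ⟨n, ?_⟩
        rw [hω]
        push_cast
        field_simp
      rw [this, sub_self, mul_zero]
    · intro t ht
      have h1 := ((((Real.hasDerivAt_log (hpos t ht).ne').const_mul ω).ofReal_comp.const_mul
        Complex.I).cexp).const_mul ((L : ℂ) * (Complex.I * ω))⁻¹
      refine h1.congr_deriv ?_
      push_cast
      generalize Complex.exp _ = E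
      field_simp

theorem orthonormal_eV {L : ℕ} (hL : 0 < L) : Orthonormal ℂ (eV hL) := by
  rw [orthonormal_iff_ite]
  intro i i'
  have hL0 : (0:ℝ) < L := by exact_mod_cast hL
  have h1 : inner ℂ (eV hL i) (eV hL i') = ∫ t, (if blk L t = i.1 then
      (if i.1 = i'.1 then (((L : ℝ)⁻¹ * t⁻¹ : ℝ) : ℂ) * Complex.exp (Complex.I *
        ((2 * Real.pi / L * (i'.2 - i.2 : ℤ) * Real.log t : ℝ) : ℂ)) else 0) else 0) ∂muP := by
    rw [L2.inner_def]
    refine integral_congr_ae ?_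
    filter_upwards [ae_muP_pos, (memLp_eF hL i).coeFn_toLp, (memLp_eF hL i').coeFn_toLp]
      with t ht h1 h2
    rw [eV, eV, h1, h2]
    unfold eF
    by_cases hb : blk L t = i.1
    · rw [if_pos hb, if_pos hb, hb]
      split_ifs with h
      · have e1 : (L : ℝ)⁻¹ * t⁻¹ = (L : ℝ) ^ (-(1:ℝ) / 2) * t ^ (-(1:ℝ) / 2) *
            ((L : ℝ) ^ (-(1:ℝ) / 2) * t ^ (-(1:ℝ) / 2)) := by
          rw [mul_mul_mul_comm, ← Real.rpow_add hL0, ← Real.rpow_add ht]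
          norm_num [Real.rpow_neg_one]
        rw [e1, RCLike.inner_apply, map_mul, ← Complex.exp_conj, Complex.conj_ofReal, map_mul,
          Complex.conj_I, Complex.conj_ofReal]
        rw [show ∀ a b c : ℂ, a * b * (a * c) = a * a * (b * c) by intros; ring, ← Complex.exp_add]
        push_cast
        congr 2
        ring
      · simp
    · rw [if_neg hb, if_neg hb]
      simp
  rw [h1]
  by_cases h : i.1 = i'.1
  · simp only [h, if_true]
    rw [integral_blk hL, integral_log_exp hL]
    congr 1
    rw [Prod.ext_iff, eq_iff_iff]
    simp only [h, true_and]
    constructor <;> intro h' <;> omega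
  · simp only [h, if_false, ite_self, integral_zero]
    rw [if_neg (fun h' => h (by rw [h']))]

end Basis

section ModelIdentity

/-- The common factor of the block diagonal kernels. -/
def modW (c : ℤ → ℝ) (L : ℕ) (t s : ℝ) : ℝ :=
  if blk L t = blk L s then c (blk L s) * (t ^ (-(1:ℝ) / 2) * s ^ (-(1:ℝ) / 2)) else 0

theorem measurable_modW (c : ℤ → ℝ) (L : ℕ) :
    Measurable fun z : ℝ × ℝ => modW c L z.1 z.2 := by
  unfold modW
  refine Measurable.ite ?_ ?_ measurable_const
  · exact measurableSet_eq_fun ((measurable_blk L).comp measurable_fst)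
      ((measurable_blk L).comp measurable_snd)
  · refine Measurable.mul ?_ (by fun_prop)
    exact (Measurable.of_discrete (f := c)).comp ((measurable_blk L).comp measurable_snd)

theorem modK_eq_modW (c : ℤ → ℝ) (L : ℕ) (a : ℝ) {t s : ℝ} (ht : 0 < t) (hs : 0 < s) :
    modK c L a t s = modW c L t s * phiH (Real.log t - Real.log s + a) := by
  unfold modK modW
  split_ifs
  · rw [mul_assoc, exp_half_mul_inv_add_eq ht hs, mul_assoc (c _)]
  · simp

theorem abs_log_sub_le_of_blk {L : ℕ} (hL : 0 < L) {t s : ℝ} (h : blk L t = blk L s) :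
    |Real.log t - Real.log s| ≤ L := by
  have h1 := (blk_eq_iff hL).1 h
  have h2 := (blk_eq_iff hL (j := blk L s) (t := s)).1 rfl
  rw [abs_le]; constructor <;> nlinarith

theorem abs_modW_le {c : ℤ → ℝ} {L : ℕ} {K : ℝ} (hL : 0 < L) (hc : ∀ j, |c j| ≤ K) {t s : ℝ}
    (ht : 0 < t) (hs : 0 < s) : |modW c L t s| ≤ K * Real.exp ((L : ℝ) / 4) * gK 0 t s := by
  have hK : 0 ≤ K := (abs_nonneg _).trans (hc 0)
  have hg := gK_nonneg 0 ht hs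
  unfold modW
  split_ifs with h
  · have h1 := abs_log_sub_le_of_blk hL h
    have h2 : 1 ≤ Real.exp ((L : ℝ) / 4) * Real.exp (-|Real.log t - Real.log s + 0| / 4) := by
      rw [← Real.exp_add, Real.one_le_exp_iff, add_zero]
      linarith
    rw [abs_mul, abs_of_pos (by positivity : 0 < t ^ (-(1:ℝ) / 2) * s ^ (-(1:ℝ) / 2)), gK]
    calc |c (blk L s)| * (t ^ (-(1:ℝ) / 2) * s ^ (-(1:ℝ) / 2))
        ≤ K * (t ^ (-(1:ℝ) / 2) * s ^ (-(1:ℝ) / 2)) * 1 := by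
          rw [mul_one]; gcongr; exact hc _
      _ ≤ K * (t ^ (-(1:ℝ) / 2) * s ^ (-(1:ℝ) / 2)) *
          (Real.exp ((L : ℝ) / 4) * Real.exp (-|Real.log t - Real.log s + 0| / 4)) := by gcongr
      _ = _ := by ring
  · rw [abs_zero]; positivity

theorem abs_modK_le {c : ℤ → ℝ} {L : ℕ} {K : ℝ} (hL : 0 < L) (hc : ∀ j, |c j| ≤ K) (m : ℤ)
    {t s : ℝ} (ht : 0 < t) (hs : 0 < s) : |modK c L (m * L) t s| ≤
      K * Real.exp (-((L : ℝ) * (|(m : ℝ)| - 1)) / 4) * gK (m * L) t s := by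
  have hK : 0 ≤ K := (abs_nonneg _).trans (hc 0)
  have hg := gK_nonneg (m * L) ht hs
  unfold modK
  split_ifs with h
  · have h1 := abs_log_sub_le_of_blk hL h
    have h3 : (L : ℝ) * (|(m : ℝ)| - 1) ≤ |Real.log t - Real.log s + m * L| := by
      have := abs_sub_abs_le_abs_sub ((m : ℝ) * L) (-(Real.log t - Real.log s))
      rw [abs_neg, abs_mul, Nat.abs_cast, sub_neg_eq_add, add_comm ((m : ℝ) * L)] at this
      nlinarith
    have h4 : 0 ≤ Real.exp (m * L / 2) * (Real.exp (m * L) * t + s)⁻¹ := by positivity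
    rw [mul_assoc, abs_mul, abs_of_nonneg h4]
    calc |c (blk L s)| * (Real.exp (m * L / 2) * (Real.exp (m * L) * t + s)⁻¹)
        ≤ K * (gK (m * L) t s * Real.exp (-|Real.log t - Real.log s + m * L| / 4)) :=
          mul_le_mul (hc _) (exp_half_mul_inv_add_le ht hs _) h4 hK
      _ ≤ K * (gK (m * L) t s * Real.exp (-((L : ℝ) * (|(m : ℝ)| - 1)) / 4)) := by gcongr
      _ = _ := by ring
  · rw [abs_zero]; positivity

theorem summable_exp_neg_abs {L : ℕ} (hL : 0 < L) :
    Summable fun m : ℤ => Real.exp (-((L : ℝ) * (|(m : ℝ)| - 1)) / 4) := by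
  have hr : Real.exp (-(L : ℝ) / 4) < 1 := by
    have : (0:ℝ) < L := by exact_mod_cast hL
    rw [Real.exp_lt_one_iff]; linarith
  have hs := (summable_geometric_of_lt_one (Real.exp_pos _).le hr).mul_left (Real.exp ((L : ℝ) / 4))
  have key : ∀ n : ℕ, Real.exp ((L : ℝ) / 4) * Real.exp (-(L : ℝ) / 4) ^ n =
      Real.exp (-((L : ℝ) * ((n : ℝ) - 1)) / 4) := by
    intro n
    rw [← Real.exp_nat_mul, ← Real.exp_add]
    congr 1; ring
  simp_rw [key] at hs
  refine Summable.of_nat_of_neg ?_ ?_ <;> simpa using hs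

theorem integral_norm_kernel_le {k : ℝ × ℝ → ℂ} (hk : Measurable k) {a M : ℝ}
    (hb : ∀ t s, 0 < t → 0 < s → ‖k (t, s)‖ ≤ M * gK a t s) {u : ℝ → ℂ} (hu : MemLp u 2 muP)
    (hM : 0 ≤ M) :
    Integrable (fun z : ℝ × ℝ => k z * (u z.2 * (starRingEnd ℂ) (u z.1))) (muP.prod muP) ∧
    ∫ z, ‖k z * (u z.2 * (starRingEnd ℂ) (u z.1))‖ ∂(muP.prod muP) ≤ M * (8 * sqN u) := by
  have hpt : ∀ᵐ z ∂(muP.prod muP), ‖k z * (u z.2 * (starRingEnd ℂ) (u z.1))‖ ≤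
      M * (gK a z.1 z.2 * (‖u z.2‖ * ‖u z.1‖)) := by
    filter_upwards [ae_prod_pos] with z hz
    rw [norm_mul, norm_mul, RCLike.norm_conj, ← mul_assoc M]
    gcongr
    exact hb z.1 z.2 hz.1 hz.2
  have hint : Integrable (fun z : ℝ × ℝ => k z * (u z.2 * (starRingEnd ℂ) (u z.1)))
      (muP.prod muP) := by
    refine ((schur hu a).1.const_mul M).mono' ?_ hpt
    refine hk.aestronglyMeasurable.mul (AEStronglyMeasurable.mul ?_ ?_)
    · exact hu.1.comp_snd
    · exact continuous_star.comp_aestronglyMeasurable hu.1.comp_fst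
  refine ⟨hint, ?_⟩
  calc ∫ z, ‖k z * (u z.2 * (starRingEnd ℂ) (u z.1))‖ ∂(muP.prod muP)
      ≤ ∫ z, M * (gK a z.1 z.2 * (‖u z.2‖ * ‖u z.1‖)) ∂(muP.prod muP) :=
        integral_mono_ae hint.norm ((schur hu a).1.const_mul M) hpt
    _ ≤ _ := by
        rw [integral_const_mul]
        exact mul_le_mul_of_nonneg_left (schur hu a).2 hM

theorem norm_cexp_I_mul (x : ℝ) : ‖Complex.exp (Complex.I * (x : ℂ))‖ = 1 := by
  rw [mul_comm, Complex.norm_exp_ofReal_mul_I]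

/-- The kernels arising from the Fourier expansion of the periodized model kernel. -/
def fouK (c : ℤ → ℝ) (L : ℕ) (k : ℤ) (z : ℝ × ℝ) : ℂ :=
  (modW c L z.1 z.2 : ℂ) * ((((L : ℝ)⁻¹ * symS (2 * Real.pi / L * k) : ℝ) : ℂ) *
    Complex.exp (Complex.I * ((2 * Real.pi / L * k * (Real.log z.1 - Real.log z.2) : ℝ) : ℂ)))

theorem measurable_fouK (c : ℤ → ℝ) (L : ℕ) (k : ℤ) : Measurable (fouK c L k) := by
  unfold fouK
  refine Measurable.mul (Complex.measurable_ofReal.comp (measurable_modW c L)) ?_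
  fun_prop

theorem norm_fouK_le {c : ℤ → ℝ} {L : ℕ} {K : ℝ} (hL : 0 < L) (hc : ∀ j, |c j| ≤ K) (k : ℤ)
    {t s : ℝ} (ht : 0 < t) (hs : 0 < s) : ‖fouK c L k (t, s)‖ ≤
      K * Real.exp ((L : ℝ) / 4) * ((L : ℝ)⁻¹ * symS (2 * Real.pi / L * k)) * gK 0 t s := by
  unfold fouK
  have := abs_modW_le hL hc ht hs
  have h0 : 0 ≤ (L : ℝ)⁻¹ * symS (2 * Real.pi / L * k) := by
    have := (symS_pos (2 * Real.pi / L * k)).le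
    positivity
  rw [norm_mul, norm_mul, norm_cexp_I_mul, mul_one, Complex.norm_real, Complex.norm_real,
    Real.norm_eq_abs, Real.norm_of_nonneg h0]
  calc |modW c L t s| * ((L : ℝ)⁻¹ * symS (2 * Real.pi / L * k))
      ≤ (K * Real.exp ((L : ℝ) / 4) * gK 0 t s) * ((L : ℝ)⁻¹ * symS (2 * Real.pi / L * k)) := by
        gcongr
    _ = _ := by ring

theorem summable_symS {L : ℕ} (hL : 0 < L) : Summable fun k : ℤ => symS (2 * Real.pi / L * k) := by
  have hL0 : (0:ℝ) < L := by exact_mod_cast hL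
  have := (symS_riemann (p := 1) one_pos (δ := 2 * Real.pi / L) (by positivity)).1
  simpa using this

theorem tsum_modK_eq {c : ℤ → ℝ} {L : ℕ} (hL : 0 < L) {t s : ℝ} (ht : 0 < t) (hs : 0 < s) (U : ℂ) :
    ∑' m : ℤ, (modK c L (m * L) t s : ℂ) * U = ∑' k : ℤ, fouK c L k (t, s) * U := by
  rw [tsum_mul_right, tsum_mul_right]
  congr 1
  simp_rw [modK_eq_modW c L _ ht hs, fouK]
  have := poisson_phiH (L := (L : ℝ)) (by exact_mod_cast hL) (Real.log t - Real.log s)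
  push_cast at this ⊢
  rw [tsum_mul_left, tsum_mul_left, this]

theorem inner_eV {L : ℕ} (hL : 0 < L) (i : ℤ × ℤ) (u : HSp) :
    inner ℂ (eV hL i) u = ∫ t, (starRingEnd ℂ) (eF L i t) * u t ∂muP := by
  rw [L2.inner_def]
  refine integral_congr_ae ?_
  filter_upwards [(memLp_eF hL i).coeFn_toLp] with t h
  rw [eV, h, RCLike.inner_apply, mul_comm]

theorem hasSum_integral_fouK {c : ℤ → ℝ} {L : ℕ} {K : ℝ} (hL : 0 < L) (hc : ∀ j, |c j| ≤ K) (k : ℤ)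
    (u : HSp) : HasSum (fun j : ℤ => ((c j * symS (2 * Real.pi / L * k) *
      ‖inner ℂ (eV hL (j, k)) u‖ ^ 2 : ℝ) : ℂ))
      (∫ z, fouK c L k z * (u z.2 * (starRingEnd ℂ) (u z.1)) ∂(muP.prod muP)) := by
  have hL0 : (0:ℝ) < L := by exact_mod_cast hL
  have hK : 0 ≤ K := (abs_nonneg _).trans (hc 0)
  set σ := symS (2 * Real.pi / L * k) with hσ
  have hσ0 : 0 ≤ σ := (symS_pos _).le
  have hu := Lp.memLp u
  have hint := (integral_norm_kernel_le (measurable_fouK c L k)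
    (fun t s ht hs => norm_fouK_le hL hc k ht hs) hu (by positivity)).1
  set G : ℝ × ℝ → ℂ := fun z => fouK c L k z * (u z.2 * (starRingEnd ℂ) (u z.1)) with hG
  set S : ℤ → Set (ℝ × ℝ) := fun j => {z | blk L z.1 = j ∧ blk L z.2 = j} with hS
  have hSm : ∀ j, MeasurableSet (S j) := fun j =>
    (((measurable_blk L).comp measurable_fst) (measurableSet_singleton j)).inter
      (((measurable_blk L).comp measurable_snd) (measurableSet_singleton j))
  have hdisj : Pairwise (Function.onFun Disjoint S) := by
    intro j j' hjj
    refine Set.disjoint_left.2 fun z hz hz' => hjj ?_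
    exact hz.1.symm.trans hz'.1
  have h1 := hasSum_integral_iUnion (μ := muP.prod muP) hSm hdisj hint.integrableOn
  have h2 : ∫ z in ⋃ j, S j, G z ∂(muP.prod muP) = ∫ z, G z ∂(muP.prod muP) := by
    refine setIntegral_eq_integral_of_forall_compl_eq_zero fun z hz => ?_
    have : blk L z.1 ≠ blk L z.2 := fun h => hz (mem_iUnion.2 ⟨blk L z.2, h, rfl⟩)
    simp [hG, fouK, modW, this]
  rw [h2] at h1
  refine h1.congr_fun fun j => ?_
  rw [← integral_indicator (hSm j)]
  have h3 : ∫ z, (S j).indicator G z ∂(muP.prod muP) =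
      ∫ z, ((c j * σ : ℝ) : ℂ) * (((starRingEnd ℂ) ((starRingEnd ℂ) (eF L (j, k) z.1) * u z.1)) *
        ((starRingEnd ℂ) (eF L (j, k) z.2) * u z.2)) ∂(muP.prod muP) := by
    refine integral_congr_ae ?_
    filter_upwards [ae_prod_pos] with z hz
    simp only [indicator, hS, mem_ofPred_eq, hG, fouK, modW, eF]
    by_cases hz1 : blk L z.1 = j
    · by_cases hz2 : blk L z.2 = j
      · simp only [hz1, hz2, and_self, if_true]
        have e1 : (L : ℝ)⁻¹ = (L : ℝ) ^ (-(1:ℝ) / 2) * (L : ℝ) ^ (-(1:ℝ) / 2) := by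
          rw [← Real.rpow_add hL0]; norm_num [Real.rpow_neg_one]
        have e2 : ∀ ω x y : ℝ, Complex.exp (Complex.I * ((ω * (x - y) : ℝ) : ℂ)) =
            Complex.exp (Complex.I * ((ω * x : ℝ) : ℂ)) *
            (starRingEnd ℂ) (Complex.exp (Complex.I * ((ω * y : ℝ) : ℂ))) := by
          intro ω x y
          rw [← Complex.exp_conj, map_mul, Complex.conj_I, Complex.conj_ofReal, ← Complex.exp_add]
          congr 1; push_cast; ring
        rw [e1, e2, ← hσ]
        simp only [map_mul, Complex.conj_conj, Complex.conj_ofReal]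
        push_cast
        ring
      · simp [hz2]
    · simp [hz1]
  rw [h3, integral_const_mul, integral_prod_mul (μ := muP) (ν := muP)
    (fun t => (starRingEnd ℂ) ((starRingEnd ℂ) (eF L (j, k) t) * u t))
    (fun t => (starRingEnd ℂ) (eF L (j, k) t) * u t), integral_conj, ← inner_eV hL,
    Complex.conj_mul']
  push_cast
  ring

theorem summable_coef_inner {L : ℕ} (hL : 0 < L) {m : ℤ × ℤ → ℝ} {K : ℝ} (hm : ∀ i, |m i| ≤ K)
    (u : HSp) : Summable fun i : ℤ × ℤ => m i * ‖inner ℂ (eV hL i) u‖ ^ 2 := by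
  refine Summable.of_norm_bounded
    (((orthonormal_eV hL).inner_products_summable u).mul_left K) fun i => ?_
  rw [norm_mul, Real.norm_eq_abs, Real.norm_of_nonneg (by positivity)]
  gcongr
  exact hm i

theorem symS_le_pi (ξ : ℝ) : symS ξ ≤ Real.pi := by
  unfold symS
  exact div_le_self Real.pi_pos.le (Real.one_le_cosh _)

/-- The weights of the model operator. -/
def modM (c : ℤ → ℝ) (L : ℕ) (i : ℤ × ℤ) : ℝ := c i.1 * symS (2 * Real.pi / L * i.2)

theorem abs_modM_le {c : ℤ → ℝ} {K : ℝ} (L : ℕ) (hc : ∀ j, |c j| ≤ K) (i : ℤ × ℤ) :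
    |modM c L i| ≤ K * Real.pi := by
  unfold modM
  rw [abs_mul, abs_of_pos (symS_pos _)]
  exact mul_le_mul (hc _) (symS_le_pi _) (symS_pos _).le ((abs_nonneg _).trans (hc 0))

theorem hasSum_form_modK {c : ℤ → ℝ} {L : ℕ} {K : ℝ} (hL : 0 < L) (hc : ∀ j, |c j| ≤ K) (u : HSp) :
    HasSum (fun m : ℤ => form (modK c L (m * L)) u)
      ((∑' i, modM c L i * ‖inner ℂ (eV hL i) u‖ ^ 2 : ℝ) : ℂ) := by
  have hL0 : (0:ℝ) < L := by exact_mod_cast hL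
  have hK : 0 ≤ K := (abs_nonneg _).trans (hc 0)
  have hu := Lp.memLp u
  have hA := fun m : ℤ => integral_norm_kernel_le
    (k := fun z => (modK c L (m * L) z.1 z.2 : ℂ))
    (Complex.measurable_ofReal.comp (measurable_modK c L (m * L)))
    (fun t s ht hs => by
      rw [Complex.norm_real, Real.norm_eq_abs]; exact abs_modK_le hL hc m ht hs) hu (by positivity)
  have hB := fun k : ℤ => integral_norm_kernel_le (measurable_fouK c L k)
    (fun t s ht hs => norm_fouK_le hL hc k ht hs) hu
    (mul_nonneg (by positivity) (mul_nonneg (by positivity) (symS_pos _).le))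
  have hsA := hasSum_integral_of_summable_integral_norm (fun m => (hA m).1)
    (Summable.of_nonneg_of_le (fun m => integral_nonneg fun _ => norm_nonneg _) (fun m => (hA m).2)
      (((summable_exp_neg_abs hL).mul_left K).mul_right _))
  have hsB := hasSum_integral_of_summable_integral_norm (fun k => (hB k).1)
    (Summable.of_nonneg_of_le (fun k => integral_nonneg fun _ => norm_nonneg _) (fun k => (hB k).2)
      ((((summable_symS hL).mul_left (L : ℝ)⁻¹).mul_left (K * Real.exp ((L : ℝ) / 4))).mul_right _))
  have heq : ∫ z : ℝ × ℝ, ∑' m : ℤ, (modK c L (m * L) z.1 z.2 : ℂ) *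
      (u z.2 * (starRingEnd ℂ) (u z.1)) ∂(muP.prod muP) =
      ∫ z : ℝ × ℝ, ∑' k : ℤ, fouK c L k z * (u z.2 * (starRingEnd ℂ) (u z.1)) ∂(muP.prod muP) := by
    refine integral_congr_ae ?_
    filter_upwards [ae_prod_pos] with z hz using tsum_modK_eq hL hz.1 hz.2 _
  rw [heq] at hsA
  have hsum : ∑' i, modM c L i * ‖inner ℂ (eV hL i) u‖ ^ 2 = ∑' k : ℤ, ∑' j : ℤ,
      c j * symS (2 * Real.pi / L * k) * ‖inner ℂ (eV hL (j, k)) u‖ ^ 2 := by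
    have hs := summable_coef_inner hL (abs_modM_le L hc) u
    have hs' := hs.comp_injective (Equiv.prodComm ℤ ℤ).injective
    rw [← (Equiv.prodComm ℤ ℤ).tsum_eq]
    exact hs'.tsum_prod
  have hfin : ∫ z : ℝ × ℝ, ∑' k : ℤ, fouK c L k z * (u z.2 * (starRingEnd ℂ) (u z.1))
      ∂(muP.prod muP) = ((∑' i, modM c L i * ‖inner ℂ (eV hL i) u‖ ^ 2 : ℝ) : ℂ) := by
    rw [← hsB.tsum_eq, hsum, Complex.ofReal_tsum]
    refine tsum_congr fun k => ?_
    rw [Complex.ofReal_tsum]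
    exact (hasSum_integral_fouK hL hc k u).tsum_eq.symm
  rw [← hfin]
  exact hsA

end ModelIdentity

section CellCount

theorem sum_truncated_rpow_le {σ : ℝ} (hσ0 : 0 ≤ σ) (hσ1 : σ < 1) {y : ℝ} (hy : 0 < y) (M : ℕ) :
    ∑ i ∈ Finset.range M, (if ((i : ℝ) + 1) < y then (y / (i + 1)) ^ σ else 0) ≤ y / (1 - σ) := by
  have h1σ : 0 < 1 - σ := by linarith
  have key : ∀ M : ℕ, ∑ i ∈ Finset.range M, (if ((i : ℝ) + 1) < y then (y / (i + 1)) ^ σ else 0) ≤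
      y ^ σ * (min (M : ℝ) y) ^ (1 - σ) / (1 - σ) := by
    intro M
    induction M with
    | zero =>
      simp only [Finset.range_zero, Finset.sum_empty]
      positivity
    | succ M ih =>
      rw [Finset.sum_range_succ]
      split_ifs with h
      · have hM : (M : ℝ) ≤ y := by linarith
        rw [min_eq_left hM] at ih
        rw [min_eq_left (by push_cast; exact h.le)]
        push_cast
        have hM1 : (0:ℝ) < (M : ℝ) + 1 := by positivity
        have hb := rpow_one_add_le_one_add_mul_self (s := -(1 / ((M : ℝ) + 1)))
          (by rw [neg_le_neg_iff, div_le_one hM1]; linarith [(Nat.cast_nonneg M : (0:ℝ) ≤ M)])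
          h1σ.le (by linarith)
        have e1 : 1 + -(1 / ((M : ℝ) + 1)) = M / (M + 1) := by field_simp; ring
        rw [e1, Real.div_rpow (by positivity) hM1.le, div_le_iff₀ (by positivity)] at hb
        have e2 : (((M : ℝ) + 1)) ^ (1 - σ) = (M + 1) / (M + 1) ^ σ := by
          rw [Real.rpow_sub hM1, Real.rpow_one]
        rw [Real.div_rpow hy.le hM1.le]
        have hp : 0 < ((M : ℝ) + 1) ^ σ := by positivity
        have e3 : (1 - σ) * (1 / ((M : ℝ) + 1)) * (M + 1) ^ (1 - σ) =
            (1 - σ) / ((M : ℝ) + 1) ^ σ := by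
          rw [e2]; field_simp
        have h4 : (M : ℝ) ^ (1 - σ) + (1 - σ) / ((M : ℝ) + 1) ^ σ ≤ ((M : ℝ) + 1) ^ (1 - σ) := by
          rw [← e3]; linarith
        refine (add_le_add_left ih _).trans ?_
        have e5 : y ^ σ / ((M : ℝ) + 1) ^ σ =
            y ^ σ * ((1 - σ) / ((M : ℝ) + 1) ^ σ) / (1 - σ) := by field_simp
        rw [e5, ← add_div, ← mul_add]
        gcongr
      · rw [add_zero]
        refine ih.trans ?_
        gcongr
        linarith
  refine (key M).trans ?_
  have : y ^ σ * (min (M : ℝ) y) ^ (1 - σ) ≤ y ^ σ * y ^ (1 - σ) := by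
    gcongr
    exact min_le_right _ _
  rw [← Real.rpow_add hy, add_sub_cancel, Real.rpow_one] at this
  gcongr

theorem natCeil_rpow_bounds {x : ℝ} (hx : 1 < x) {N : ℕ} (hN : 1 ≤ N) :
    x ≤ ((⌈x ^ (1 / (N : ℝ))⌉₊ : ℕ) : ℝ) ^ N ∧
      ((⌈x ^ (1 / (N : ℝ))⌉₊ : ℕ) : ℝ) ≤ 2 * x ^ (1 / (N : ℝ)) := by
  have hx0 : 0 < x := by linarith
  constructor
  · calc x = (x ^ (1 / (N : ℝ))) ^ N := by
          rw [one_div, Real.rpow_inv_natCast_pow hx0.le (by omega)]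
      _ ≤ _ := by gcongr; exact Nat.le_ceil _
  · have h1 : 1 ≤ x ^ (1 / (N : ℝ)) := Real.one_le_rpow hx.le (by positivity)
    have := Nat.ceil_lt_add_one (by positivity : 0 ≤ x ^ (1 / (N : ℝ)))
    linarith

/-- Summand of the cell count: contribution of a block where the kernel has size `E (L i)^(-α)`. -/
def cellPhi (α : ℝ) (N L : ℕ) (x : ℝ) (i : ℕ) : ℝ :=
  if (i : ℝ) < x / L then 2 * (x / L / i) ^ (α / N) else 0

theorem cellPhi_nonneg {α : ℝ} {N L : ℕ} {x : ℝ} (hx : 0 ≤ x) (i : ℕ) :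
    0 ≤ cellPhi α N L x i := by
  unfold cellPhi
  split_ifs <;> positivity

theorem lt_of_lt_mul_rpow {α : ℝ} (hα : 0 < α) {θ E X : ℝ} (hθ : 0 < θ) (hE : 0 < E) (hX : 0 < X)
    (h : θ < E * X ^ (-α)) : X < (E / θ) ^ (1 / α) := by
  rw [Real.rpow_neg hX.le, ← div_eq_mul_inv, lt_div_iff₀ (by positivity)] at h
  rw [one_div, Real.lt_rpow_inv_iff_of_pos hX.le (by positivity) hα, lt_div_iff₀ hθ]
  linarith

theorem ceil_le_cellPhi {α : ℝ} (hα : 0 < α) {N L i : ℕ} (hN : 1 ≤ N) (hL : 0 < L) (hi : 0 < i)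
    {θ E : ℝ} (hθ : 0 < θ) (hE : 0 < E) (h : θ < E * ((L : ℝ) * i) ^ (-α)) :
    ((⌈(E * ((L : ℝ) * i) ^ (-α) / θ) ^ (1 / (N : ℝ))⌉₊ : ℕ) : ℝ) ≤
      cellPhi α N L ((E / θ) ^ (1 / α)) i := by
  have hL0 : (0:ℝ) < L := by exact_mod_cast hL
  have hi0 : (0:ℝ) < i := by exact_mod_cast hi
  refine (natCeil_rpow_bounds ((one_lt_div hθ).2 h) hN).2.trans (le_of_eq ?_)
  have h1 := lt_of_lt_mul_rpow hα hθ hE (by positivity) h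
  unfold cellPhi
  rw [if_pos (by rw [lt_div_iff₀ hL0]; linarith)]
  congr 1
  have e1 : E * ((L : ℝ) * i) ^ (-α) / θ = ((E / θ) ^ (1 / α) / L / i) ^ α := by
    rw [div_div, Real.div_rpow (by positivity) (by positivity), ← Real.rpow_mul (by positivity),
      one_div_mul_cancel hα.ne', Real.rpow_one, Real.rpow_neg (by positivity)]
    field_simp
  rw [e1, ← Real.rpow_mul (by positivity)]
  congr 1
  ring

theorem sum_cellPhi_le {α : ℝ} {N L : ℕ} (hα : 0 < α) (hN : α < N) {x : ℝ} (hx : 0 < x)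
    (hL : 0 < L) (M : ℕ) :
    ∑ i ∈ Finset.range M, cellPhi α N L x (i + 1) ≤ 2 * (x / L / (1 - α / N)) := by
  have hN0 : (0:ℝ) < N := by linarith
  have hL0 : (0:ℝ) < L := by exact_mod_cast hL
  have := sum_truncated_rpow_le (σ := α / N) (by positivity) ((div_lt_one hN0).2 hN)
    (y := x / L) (by positivity) M
  refine le_trans (le_of_eq ?_) (mul_le_mul_of_nonneg_left this zero_le_two)
  rw [Finset.mul_sum]
  refine Finset.sum_congr rfl fun i _ => ?_
  unfold cellPhi
  push_cast
  split_ifs <;> simp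

theorem exists_cells {α : ℝ} (hα : 0 < α) {N : ℕ} (hN : α < N) {C0 ε θ : ℝ} (hC0 : 0 < C0)
    (hε : 0 < ε) (hθ : 0 < θ) {L : ℕ} (hL : 0 < L) (d J : ℕ) :
    ∃ (n : ℤ → ℕ) (Q : Finset ℤ),
      (∀ q, θ < cellA α C0 (C0 + ε) ε L d J q → q ∈ Q) ∧
      (∀ q, θ < cellA α C0 (C0 + ε) ε L d J q →
        cellA α C0 (C0 + ε) ε L d J q ≤ θ * (n q : ℝ) ^ N) ∧
      (∀ q, cellA α C0 (C0 + ε) ε L d J q ≤ θ → n q = 0) ∧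
      ((∑ q ∈ Q, n q : ℕ) : ℝ) ≤ 4 * ((J + 1) * L * (C0 / θ) ^ (1 / (N : ℝ))) +
        4 / (1 - α / N) * ((ε / θ) ^ (1 / α)) +
        8 / (1 - α / N) * (d / L * ((C0 + ε) / θ) ^ (1 / α)) := by
  set A := cellA α C0 (C0 + ε) ε L d J with hA
  have hN1 : 1 ≤ N := by
    have : (0:ℝ) < N := hα.trans hN
    exact_mod_cast this
  have hN0 : (0:ℝ) < N := by linarith
  have hL0 : (0:ℝ) < L := by exact_mod_cast hL
  have hL1 : (1:ℝ) ≤ L := by exact_mod_cast hL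
  have hLz : (0:ℤ) < L := by exact_mod_cast hL
  have hσ : 0 < 1 - α / N := by rw [sub_pos, div_lt_one hN0]; exact hN
  set x1 := (ε / θ) ^ (1 / α) with hx1
  set x2 := ((C0 + ε) / θ) ^ (1 / α) with hx2
  have hx1p : 0 < x1 := by positivity
  have hx2p : 0 < x2 := by positivity
  set n : ℤ → ℕ := fun q => if θ < A q then ⌈(A q / θ) ^ (1 / (N : ℝ))⌉₊ else 0 with hn
  set M : ℕ := J + ⌈x2⌉₊ with hM
  set T : Finset ℤ := (Finset.range (M + 1)).image (fun i : ℕ => (i : ℤ)) ∪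
    (Finset.range (M + 1)).image (fun i : ℕ => -(i : ℤ)) with hT
  have hTmem : ∀ j : ℤ, |j| ≤ M → j ∈ T := by
    intro j hj
    rw [Int.abs_eq_natAbs] at hj
    rw [hT, Finset.mem_union, Finset.mem_image, Finset.mem_image]
    rcases le_total 0 j with h | h
    · refine Or.inl ⟨j.natAbs, ?_, ?_⟩
      · rw [Finset.mem_range]; omega
      · omega
    · refine Or.inr ⟨j.natAbs, ?_, ?_⟩
      · rw [Finset.mem_range]; omega
      · omega
  -- pointwise bound of the number of cells
  set g : ℕ → ℝ := fun i => (if i ≤ J then L * (2 * (C0 / θ) ^ (1 / (N : ℝ))) else 0) +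
    (if i = 0 then 0 else L * cellPhi α N L x1 i + 2 * d * cellPhi α N L x2 i) with hg
  have hg0 : ∀ i, 0 ≤ g i := by
    intro i
    have h1 := cellPhi_nonneg (α := α) (N := N) (L := L) hx1p.le i
    have h2 := cellPhi_nonneg (α := α) (N := N) (L := L) hx2p.le i
    simp only [hg]
    split_ifs <;> positivity
  have hpt : ∀ j : ℤ, ∑ r ∈ Finset.range L, (n (j * L + r) : ℝ) ≤ g j.natAbs := by
    intro j
    have hdiv : ∀ r ∈ Finset.range L, (j * L + (r : ℤ)) / (L : ℤ) = j := by
      intro r hr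
      have := Finset.mem_range.1 hr
      rw [Int.add_comm, Int.add_mul_ediv_right _ _ hLz.ne',
        Int.ediv_eq_zero_of_lt (by omega) (by omega), zero_add]
    have hmod : ∀ r ∈ Finset.range L, (j * L + (r : ℤ)) % (L : ℤ) = r := by
      intro r hr
      have := Finset.mem_range.1 hr
      rw [Int.add_comm, Int.add_mul_emod_self_right]
      exact Int.emod_eq_of_lt (by omega) (by omega)
    have hrest : 0 ≤ (if j.natAbs = 0 then 0 else
        L * cellPhi α N L x1 j.natAbs + 2 * d * cellPhi α N L x2 j.natAbs) := by
      have h1 := cellPhi_nonneg (α := α) (N := N) (L := L) hx1p.le j.natAbs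
      have h2 := cellPhi_nonneg (α := α) (N := N) (L := L) hx2p.le j.natAbs
      split_ifs <;> positivity
    by_cases hjJ : |j| ≤ (J : ℤ)
    · have hAC : ∀ r ∈ Finset.range L, (n (j * L + r) : ℝ) ≤ 2 * (C0 / θ) ^ (1 / (N : ℝ)) := by
        intro r hr
        have : A (j * L + r) = C0 := by
          rw [hA, cellA, hdiv r hr, if_pos hjJ]
        simp only [hn, this]
        split_ifs with h
        · exact (natCeil_rpow_bounds ((one_lt_div hθ).2 h) hN1).2
        · push_cast; positivity
      refine (Finset.sum_le_card_nsmul _ _ _ hAC).trans ?_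
      rw [Finset.card_range, nsmul_eq_mul]
      simp only [hg]
      rw [if_pos (by rw [Int.abs_eq_natAbs] at hjJ; omega)]
      linarith
    · have hjJ' : J < j.natAbs := by rw [Int.abs_eq_natAbs] at hjJ; omega
      have hj0 : j.natAbs ≠ 0 := by omega
      have hcast : |(j : ℝ)| = (j.natAbs : ℝ) := by rw [Nat.cast_natAbs, Int.cast_abs]
      have hAr : ∀ r ∈ Finset.range L, A (j * L + r) =
          (if d ≤ r ∧ r + 1 + d ≤ L then ε else C0 + ε) * ((L : ℝ) * j.natAbs) ^ (-α) := by
        intro r hr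
        rw [hA, cellA, hdiv r hr, hmod r hr, if_neg hjJ, hcast]
        congr 1
        refine if_congr ?_ rfl rfl
        omega
      have hb : ∀ r ∈ Finset.range L, (n (j * L + r) : ℝ) ≤ cellPhi α N L x1 j.natAbs +
          if r ∈ (Finset.range d ∪ Finset.Ico (L - d) L) then cellPhi α N L x2 j.natAbs else 0 := by
        intro r hr
        have h1 := cellPhi_nonneg (α := α) (N := N) (L := L) hx1p.le j.natAbs
        have h2 := cellPhi_nonneg (α := α) (N := N) (L := L) hx2p.le j.natAbs
        have hrL := Finset.mem_range.1 hr
        simp only [hn]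
        by_cases h : θ < A (j * L + r)
        · rw [if_pos h]
          rw [hAr r hr] at h ⊢
          by_cases hint : d ≤ r ∧ r + 1 + d ≤ L
          · rw [if_pos hint] at h ⊢
            have := ceil_le_cellPhi hα hN1 hL (Nat.pos_of_ne_zero hj0) hθ hε h
            have h3 : 0 ≤ if r ∈ (Finset.range d ∪ Finset.Ico (L - d) L) then
              cellPhi α N L x2 j.natAbs else 0 := by split_ifs <;> positivity
            linarith
          · rw [if_neg hint] at h ⊢
            have := ceil_le_cellPhi hα hN1 hL (Nat.pos_of_ne_zero hj0) hθ (by positivity) h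
            rw [if_pos]
            · linarith
            · rw [Finset.mem_union, Finset.mem_range, Finset.mem_Ico]
              omega
        · rw [if_neg h]
          push_cast
          split_ifs <;> positivity
      refine (Finset.sum_le_sum hb).trans ?_
      rw [Finset.sum_add_distrib, Finset.sum_const, Finset.card_range, nsmul_eq_mul,
        ← Finset.sum_filter, Finset.sum_const, nsmul_eq_mul]
      have hcard : ((Finset.filter (fun r => r ∈ Finset.range d ∪ Finset.Ico (L - d) L)
          (Finset.range L)).card : ℝ) ≤ 2 * d := by
        have h1 : (Finset.filter (fun r => r ∈ Finset.range d ∪ Finset.Ico (L - d) L)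
          (Finset.range L)).card ≤ 2 * d := by
          refine (Finset.card_le_card (t := Finset.range d ∪ Finset.Ico (L - d) L) ?_).trans ?_
          · intro r hr
            exact (Finset.mem_filter.1 hr).2
          · refine (Finset.card_union_le _ _).trans ?_
            rw [Finset.card_range, Nat.card_Ico]
            omega
        exact_mod_cast h1
      simp only [hg]
      rw [if_neg (by omega), if_neg hj0, zero_add]
      have h2 := cellPhi_nonneg (α := α) (N := N) (L := L) hx2p.le j.natAbs
      gcongr
  refine ⟨n, (T ×ˢ Finset.range L).image fun p => p.1 * L + (p.2 : ℤ), ?_, ?_, ?_, ?_⟩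
  · intro q hq
    rw [Finset.mem_image]
    have hr0 := Int.emod_nonneg q hLz.ne'
    have hr1 := Int.emod_lt_of_pos q hLz
    refine ⟨(q / L, (q % L).toNat), ?_, ?_⟩
    · rw [Finset.mem_product]
      refine ⟨hTmem _ ?_, by rw [Finset.mem_range]; omega⟩
      rw [hA, cellA] at hq
      by_cases hj : |q / (L : ℤ)| ≤ J
      · exact hj.trans (by exact_mod_cast Nat.le_add_right _ _)
      · rw [if_neg hj] at hq
        have hj1 : (1:ℝ) ≤ |((q / (L : ℤ) : ℤ) : ℝ)| := by
          have : (1:ℤ) ≤ |q / (L : ℤ)| := by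
            have := lt_of_not_ge hj
            linarith [(Nat.cast_nonneg J : (0:ℤ) ≤ J)]
          exact_mod_cast this
        have hq' : θ < (C0 + ε) * ((L : ℝ) * |((q / (L : ℤ) : ℤ) : ℝ)|) ^ (-α) := by
          refine hq.trans_le ?_
          gcongr
          split_ifs <;> linarith
        have h1 := lt_of_lt_mul_rpow hα hθ (by positivity) (by positivity) hq'
        have h2 : |((q / (L : ℤ) : ℤ) : ℝ)| ≤ M := by
          have h3 : x2 ≤ ⌈x2⌉₊ := Nat.le_ceil _
          rw [hM]
          push_cast
          nlinarith [(Nat.cast_nonneg J : (0:ℝ) ≤ J)]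
        exact_mod_cast h2
    · simp only
      rw [Int.toNat_of_nonneg hr0]
      exact Int.ediv_mul_add_emod q L
  · intro q hq
    simp only [hn]
    rw [if_pos hq]
    have := (natCeil_rpow_bounds ((one_lt_div hθ).2 hq) hN1).1
    rw [div_le_iff₀ hθ] at this
    linarith
  · intro q hq
    simp only [hn]
    rw [if_neg (not_lt.2 hq)]
  · rw [Nat.cast_sum]
    have s1 : ∑ q ∈ (T ×ˢ Finset.range L).image (fun p => p.1 * L + (p.2 : ℤ)), (n q : ℝ) ≤
        ∑ p ∈ T ×ˢ Finset.range L, (n (p.1 * L + (p.2 : ℤ)) : ℝ) :=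
      Finset.sum_image_le_of_nonneg (fun _ _ => Nat.cast_nonneg _)
    rw [Finset.sum_product] at s1
    have s2 := s1.trans (Finset.sum_le_sum fun j _ => hpt j)
    have s3 : ∑ j ∈ T, g j.natAbs ≤ 2 * ∑ i ∈ Finset.range (M + 1), g i := by
      rw [hT, two_mul]
      refine (Finset.sum_union_inter (f := fun j : ℤ => g j.natAbs) ▸
        le_add_of_nonneg_right (Finset.sum_nonneg fun j _ => hg0 _)).trans ?_
      refine add_le_add ?_ ?_
      · refine (Finset.sum_image_le_of_nonneg fun _ _ => hg0 _).trans (le_of_eq ?_)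
        simp
      · refine (Finset.sum_image_le_of_nonneg fun _ _ => hg0 _).trans (le_of_eq ?_)
        simp
    have s4 : ∑ i ∈ Finset.range (M + 1), g i ≤
        (J + 1) * (L * (2 * (C0 / θ) ^ (1 / (N : ℝ)))) +
        (L * (2 * (x1 / L / (1 - α / N))) + 2 * d * (2 * (x2 / L / (1 - α / N)))) := by
      simp only [hg]
      rw [Finset.sum_add_distrib]
      refine add_le_add ?_ ?_
      · rw [← Finset.sum_filter, Finset.sum_const, nsmul_eq_mul]
        gcongr
        have : (Finset.filter (fun i => i ≤ J) (Finset.range (M + 1))).card ≤ J + 1 := by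
          refine (Finset.card_le_card (t := Finset.range (J + 1)) ?_).trans (by simp)
          intro i hi
          have := (Finset.mem_filter.1 hi).2
          rw [Finset.mem_range]; omega
        exact_mod_cast this
      · rw [Finset.sum_range_succ', if_pos rfl, add_zero]
        have h1 := sum_cellPhi_le hα hN hx1p hL M
        have h2 := sum_cellPhi_le hα hN hx2p hL M
        simp only [Nat.add_one_ne_zero, if_false]
        rw [Finset.sum_add_distrib, ← Finset.mul_sum, ← Finset.mul_sum]
        gcongr
    refine s2.trans (s3.trans ((mul_le_mul_of_nonneg_left s4 zero_le_two).trans (le_of_eq ?_)))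
    field_simp
    ring

end CellCount

section FormApprox

theorem eventually_mul_rpow_le {q p : ℝ} (hqp : q < p) (B : ℝ) {c : ℝ} (hc : 0 < c) :
    ∀ᶠ θ in nhdsWithin (0:ℝ) (Ioi 0), B * θ ^ (-q) ≤ c * θ ^ (-p) := by
  have h1 : Tendsto (fun θ : ℝ => B * θ ^ (p - q)) (nhdsWithin (0:ℝ) (Ioi 0)) (nhds (B * 0)) := by
    refine Tendsto.const_mul B ?_
    have := (Real.continuousAt_rpow_const 0 (p - q) (Or.inr (by linarith))).tendsto
    rw [Real.zero_rpow (by linarith)] at this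
    exact this.mono_left nhdsWithin_le_nhds
  rw [mul_zero] at h1
  filter_upwards [h1.eventually (gt_mem_nhds hc), self_mem_nhdsWithin] with θ h2 h3
  have h3 : 0 < θ := h3
  have e : θ ^ (-q) = θ ^ (p - q) * θ ^ (-p) := by
    rw [← Real.rpow_add h3]; congr 1; ring
  rw [e, ← mul_assoc]
  gcongr

/-- Vectors in `L²` spanning the piecewise polynomials on the given cells. -/
theorem exists_cell_vectors (N : ℕ) (n : ℤ → ℕ) (Q : Finset ℤ) :
    ∃ S : Finset HSp, S.card ≤ N * ∑ q ∈ Q, n q ∧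
      ∀ u : HSp, (∀ v ∈ S, inner ℂ v u = 0) → ∀ i ∈ cellIdx n Q, ∀ m < N,
        ∫ s, monoInd (cellLo n i) (cellHi n i) m s * (u : ℝ → ℂ) s ∂muP = 0 := by
  classical
  refine ⟨(cellIdx n Q ×ˢ Finset.range N).image fun p =>
    (memLp_monoInd (cellLo n p.1) (cellHi n p.1) p.2).toLp, ?_, ?_⟩
  · refine Finset.card_image_le.trans (le_of_eq ?_)
    rw [Finset.card_product, Finset.card_range, cellIdx, Finset.card_sigma, mul_comm]
    simp
  · intro u hu i hi m hm
    have h1 := hu _ (Finset.mem_image.2 ⟨(i, m), Finset.mem_product.2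
      ⟨hi, Finset.mem_range.2 hm⟩, rfl⟩)
    rw [L2.inner_def] at h1
    rw [← h1]
    refine integral_congr_ae ?_
    filter_upwards [(memLp_monoInd (cellLo n i) (cellHi n i) m).coeFn_toLp] with t h
    rw [h, RCLike.inner_apply, mul_comm]
    congr 1
    unfold monoInd
    by_cases ht : t ∈ Ico (cellLo n i) (cellHi n i)
    · rw [indicator_of_mem ht, Complex.conj_ofReal]
    · rw [indicator_of_notMem ht, map_zero]

theorem CellK.abs_le {N : ℕ} {a lam M : ℝ} {A : ℤ → ℝ} (hlam : 0 ≤ lam) {k : ℝ → ℝ → ℝ}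
    (hk : CellK N a lam A k) (hAM : ∀ q, A q ≤ M) {t s : ℝ} (ht : 0 < t) (hs : 0 < s) :
    |k t s| ≤ M * lam * gK a t s := by
  obtain ⟨F, -, hF1, hF2⟩ := hk.2 t ht ⌊Real.log s⌋
  have hm := mem_cell_floor hs
  rw [hF1 s hm]
  refine (hF2 s ⟨hm.1, hm.2.le⟩).1.trans ?_
  have := gK_nonneg a ht hs
  gcongr
  exact hAM _

theorem cellA_nonneg (α : ℝ) {C1 C2 ε : ℝ} (h1 : 0 ≤ C1) (h2 : 0 ≤ C2) (hε : 0 ≤ ε) (L d J : ℕ)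
    (q : ℤ) : 0 ≤ cellA α C1 C2 ε L d J q := by
  unfold cellA
  split_ifs <;> positivity

theorem cellA_le {α : ℝ} (hα : 0 < α) {C0 ε : ℝ} (h1 : 0 ≤ C0) (hε : 0 ≤ ε) {L : ℕ} (hL : 0 < L)
    (d J : ℕ) (q : ℤ) : cellA α C0 (C0 + ε) ε L d J q ≤ C0 + ε := by
  unfold cellA
  have := rpow_block_le_one hα hL (q / (L : ℤ))
  have h0 : (0:ℝ) ≤ ((L : ℝ) * |((q / (L : ℤ) : ℤ) : ℝ)|) ^ (-α) := by positivity
  split_ifs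
  · linarith
  · nlinarith
  · nlinarith

theorem norm_form_sub_diag_le {N : ℕ} (hN : 1 ≤ N) {c : ℤ → ℝ} {L : ℕ} (hL : 0 < L) (hL4 : 4 ≤ L)
    {K M : ℝ} (hc : ∀ j, |c j| ≤ K) {f : ℝ → ℝ} {A : ℤ → ℝ} (hA : ∀ q, 0 ≤ A q)
    (hAM : ∀ q, A q ≤ M)
    (hrem : CellK N 0 1 A (remK f c L))
    (hmod : ∀ m : ℤ, m ≠ 0 →
      CellK N (m * L) (Real.exp (-(L * (|(m : ℝ)| - 1)) / 4)) A (modK c L (m * L)))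
    {θ : ℝ} (hθ : 0 < θ) {n : ℤ → ℕ} {Q : Finset ℤ} (hQ : ∀ q, θ < A q → q ∈ Q)
    (hn : ∀ q, θ < A q → A q ≤ θ * (n q : ℝ) ^ N) (hn0 : ∀ q, A q ≤ θ → n q = 0)
    (u : HSp) (hmom : ∀ i ∈ cellIdx n Q, ∀ m < N,
      ∫ s, monoInd (cellLo n i) (cellHi n i) m s * (u : ℝ → ℂ) s ∂muP = 0) :
    ‖form (fun t s => f (t + s)) u -
        ((∑' i, modM c L i * ‖inner ℂ (eV hL i) u‖ ^ 2 : ℝ) : ℂ)‖ ≤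
      8 * (3 * 2 ^ N * θ) * (1 + ∑' m : ℤ, Real.exp (-((4:ℕ) * (|(m : ℝ)| - 1)) / 4)) *
        ‖u‖ ^ 2 := by
  have hu : MemLp (u : ℝ → ℂ) 2 muP := Lp.memLp u
  have hM : 0 ≤ M := (hA 0).trans (hAM 0)
  have hK : 0 ≤ K := (abs_nonneg _).trans (hc 0)
  have hsplit : form (fun t s => f (t + s)) u =
      form (remK f c L) u + form (modK c L 0) u := by
    rw [← form_add hrem.1 (measurable_modK c L 0) (a := 0) (b := 0) (M := M * 1)
      (M' := K * Real.exp (-(L * (|((0:ℤ) : ℝ)| - 1)) / 4))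
      (fun t s ht hs => hrem.abs_le zero_le_one hAM ht hs) ?_ hu]
    · congr 1
      funext t s
      simp [remK]
    · intro t s ht hs
      have := abs_modK_le hL hc 0 ht hs
      simpa using this
  have h1 : ‖form (remK f c L) u‖ ≤ 8 * (3 * 2 ^ N * θ) * 1 * ‖u‖ ^ 2 := by
    rw [← sqN_eq]
    exact norm_form_le_of_cellK hN zero_le_one hrem hA hAM hθ hQ hn hn0 hu hmom
  have hsum := (hasSum_form_modK hL hc u).sub (hasSum_ite_eq (0:ℤ) (form (modK c L 0) u))
  have h2 := hsum.norm_le_of_bounded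
    ((summable_exp_neg_abs (by norm_num : 0 < 4)).hasSum.mul_left
      (8 * (3 * 2 ^ N * θ) * ‖u‖ ^ 2)) ?_
  · have e : form (fun t s => f (t + s)) u -
        ((∑' i, modM c L i * ‖inner ℂ (eV hL i) u‖ ^ 2 : ℝ) : ℂ) =
        form (remK f c L) u - (((∑' i, modM c L i * ‖inner ℂ (eV hL i) u‖ ^ 2 : ℝ) : ℂ) -
          form (modK c L 0) u) := by
      rw [hsplit]; ring
    rw [e]
    refine (norm_sub_le _ _).trans ((add_le_add h1 h2).trans (le_of_eq ?_))
    ring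
  · intro m
    by_cases hm : m = 0
    · subst hm
      simp only [if_true, Int.cast_zero, zero_mul, sub_self, norm_zero]
      positivity
    · rw [if_neg hm, sub_zero]
      have h3 := norm_form_le_of_cellK hN (Real.exp_pos _).le (hmod m hm) hA hAM hθ hQ hn hn0 hu hmom
      rw [sqN_eq] at h3
      refine h3.trans ?_
      have hm1 : (1:ℝ) ≤ |(m : ℝ)| := by exact_mod_cast Int.one_le_abs hm
      have hL4' : (4:ℝ) ≤ L := by exact_mod_cast hL4
      have h4 : Real.exp (-(L * (|(m : ℝ)| - 1)) / 4) ≤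
          Real.exp (-((4:ℕ) * (|(m : ℝ)| - 1)) / 4) := by
        refine Real.exp_le_exp.2 ?_
        push_cast
        nlinarith
      calc _ = 8 * (3 * 2 ^ N * θ) * ‖u‖ ^ 2 * Real.exp (-(L * (|(m : ℝ)| - 1)) / 4) := by ring
        _ ≤ _ := by gcongr

theorem Reg.exists_form_approx {N : ℕ} {α κ0 κinf C : ℝ} {f : ℝ → ℝ} (hα : 0 < α)
    (hf : Reg N α κ0 κinf C f) {ε : ℝ} (hε : 0 < ε) (L0 : ℕ) :
    ∃ (L : ℕ) (hL : 0 < L), L0 ≤ L ∧ ∀ᶠ θ in nhdsWithin (0:ℝ) (Ioi 0),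
      ∃ S : Finset HSp, (S.card : ℝ) ≤ ε * θ ^ (-(1 / α)) ∧
        ∀ u : HSp, (∀ v ∈ S, inner ℂ v u = 0) →
          ‖form (fun t s => f (t + s)) u -
            ((∑' i, modM (coef α κ0 κinf L) L i * ‖inner ℂ (eV hL i) u‖ ^ 2 : ℝ) : ℂ)‖ ≤
          ε * θ * ‖u‖ ^ 2 := by
  obtain ⟨C0, hC0, hKC, hcell⟩ := hf.exists_cellK_remK hα
  have hN0 : (0:ℝ) < N := by exact_mod_cast hf.one_le
  have hσ : 0 < 1 - α / N := by rw [sub_pos, div_lt_one hN0]; exact hf.lt_order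
  set W := ∑' m : ℤ, Real.exp (-((4:ℕ) * (|(m : ℝ)| - 1)) / 4) with hW
  have hW0 : 0 ≤ W := tsum_nonneg fun m => (Real.exp_pos _).le
  set CW := 8 * (3 * 2 ^ N) * (1 + W) with hCW
  have hCWp : 0 < CW := by positivity
  set δ := ε / CW with hδ
  have hδp : 0 < δ := by positivity
  set p := 1 / α with hp
  have hp0 : 0 < p := by positivity
  set ε' := δ * (ε / 3 * (1 - α / N) / (4 * N)) ^ α with hε'
  have hε'p : 0 < ε' := by positivity
  have hε'2 : (ε' / δ) ^ p = ε / 3 * (1 - α / N) / (4 * N) := by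
    rw [hε', mul_div_cancel_left₀ _ hδp.ne', ← Real.rpow_mul (by positivity), hp,
      mul_one_div_cancel hα.ne', Real.rpow_one]
  obtain ⟨d, hd⟩ : ∃ d : ℕ, C0 * Real.exp (-(d : ℝ) / 8) ≤ ε' := by
    have h1 : Tendsto (fun d : ℕ => C0 * Real.exp (-((d : ℝ) / 8))) atTop (nhds (C0 * 0)) :=
      (Real.tendsto_exp_neg_atTop_nhds_zero.comp
        (tendsto_natCast_atTop_atTop.atTop_div_const (by norm_num))).const_mul C0
    rw [mul_zero] at h1
    obtain ⟨d, hd⟩ := (h1.eventually (gt_mem_nhds hε'p)).exists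
    exact ⟨d, by rw [neg_div]; exact hd.le⟩
  set X := ((C0 + ε') / δ) ^ p with hX
  have hXp : 0 < X := by positivity
  obtain ⟨L1, hL1⟩ := exists_nat_ge (N * (8 / (1 - α / N) * (d * X)) / (ε / 3))
  set L := max L0 (max 4 L1) with hLdef
  have hL4 : 4 ≤ L := (le_max_left _ _).trans (le_max_right _ _)
  have hL : 0 < L := by omega
  have hLL1 : (L1 : ℝ) ≤ L := by exact_mod_cast (le_max_right _ _).trans (le_max_right _ _)
  have hLr : (0:ℝ) < L := by exact_mod_cast hL
  have hterm3 : N * (8 / (1 - α / N) * (d / L * X)) ≤ ε / 3 := by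
    have h1 := hL1.trans hLL1
    rw [div_le_iff₀ (by positivity)] at h1
    have e : N * (8 / (1 - α / N) * (d / L * X)) = N * (8 / (1 - α / N) * (d * X)) / L := by
      field_simp
    rw [e, div_le_iff₀ hLr]
    linarith
  refine ⟨L, hL, le_max_left _ _, ?_⟩
  obtain ⟨J, hJ⟩ := hcell ε' L d hε'p hL hd
  set K := max |κ0| |κinf| with hK
  have hK0 : 0 ≤ K := (abs_nonneg _).trans (le_max_left _ _)
  have hqp : 1 / (N : ℝ) < p := one_div_lt_one_div_of_lt hα hf.lt_order
  filter_upwards [self_mem_nhdsWithin, eventually_mul_rpow_le hqp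
    (N * (4 * ((J + 1) * L * (C0 / δ) ^ (1 / (N : ℝ))))) (by positivity : 0 < ε / 3)]
    with θ hθ hθ1
  have hθ : 0 < θ := hθ
  obtain ⟨n, Q, hQ, hn, hn0, hcount⟩ := exists_cells hα hf.lt_order hC0 hε'p
    (by positivity : 0 < δ * θ) hL d J
  obtain ⟨S, hScard, hS⟩ := exists_cell_vectors N n Q
  refine ⟨S, ?_, ?_⟩
  · have hs1 : (S.card : ℝ) ≤ N * ((∑ q ∈ Q, n q : ℕ) : ℝ) := by exact_mod_cast hScard
    have hscale : ∀ x r : ℝ, 0 ≤ x → (x / (δ * θ)) ^ r = (x / δ) ^ r * θ ^ (-r) := by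
      intro x r hx
      rw [← div_div, Real.div_rpow (by positivity) hθ.le, Real.rpow_neg hθ.le, div_eq_mul_inv]
    rw [hscale _ _ hC0.le, hscale _ _ hε'p.le, hscale _ _ (by positivity), hε'2] at hcount
    have hs2 := hs1.trans (mul_le_mul_of_nonneg_left hcount hN0.le)
    have hθp : 0 < θ ^ (-p) := by positivity
    have h3 := mul_le_mul_of_nonneg_right hterm3 hθp.le
    have h2 : N * (4 / (1 - α / N) * (ε / 3 * (1 - α / N) / (4 * N) * θ ^ (-p))) =
        ε / 3 * θ ^ (-p) := by
      have : ∀ s y : ℝ, 0 < s → N * (4 / s * (ε / 3 * s / (4 * N) * y)) = ε / 3 * y := by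
        intro s y hs
        field_simp
      exact this _ _ hσ
    linarith
  · intro u hu
    have hcK : ∀ j, |coef α κ0 κinf L j| ≤ K := fun j =>
      (abs_coef_le (le_max_left _ _) (le_max_right _ _) L j).trans
        (mul_le_of_le_one_right hK0 (rpow_block_le_one hα hL j))
    have := norm_form_sub_diag_le hf.one_le hL hL4 hcK
      (cellA_nonneg α hC0.le (by positivity) hε'p.le L d J) (cellA_le hα hC0.le hε'p.le hL d J) hJ
      (fun m hm => cellK_modK hα (le_max_left _ _) (le_max_right _ _) hL d J hKC
        (hKC.trans (by linarith)) ?_ hm)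
      (by positivity : 0 < δ * θ) hQ hn hn0 u (hS u hu)
    · refine this.trans (le_of_eq ?_)
      rw [← hW, hδ, hCW]
      field_simp
    · refine le_trans (mul_le_mul hKC (Real.exp_le_exp.2 ?_) (Real.exp_pos _).le hC0.le) hd
      have := (Nat.cast_nonneg d : (0:ℝ) ≤ d)
      linarith

end FormApprox

section Counting

theorem card_int_le {T : Finset ℤ} {a b : ℝ} (ha : 0 ≤ a) (hb : 0 ≤ b)
    (hT : ∀ j ∈ T, (0 < j ∧ (j : ℝ) ≤ a) ∨ (j < 0 ∧ -(j : ℝ) ≤ b)) : (T.card : ℝ) ≤ a + b := by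
  have hsub : T ⊆ Finset.Icc 1 ⌊a⌋ ∪ Finset.Icc (-⌊b⌋) (-1) := by
    intro j hj
    rw [Finset.mem_union, Finset.mem_Icc, Finset.mem_Icc]
    rcases hT j hj with h | h
    · exact Or.inl ⟨by omega, Int.le_floor.2 h.2⟩
    · have : -j ≤ ⌊b⌋ := Int.le_floor.2 (by push_cast; exact h.2)
      exact Or.inr ⟨by omega, by omega⟩
  have h1 := (Finset.card_le_card hsub).trans (Finset.card_union_le _ _)
  rw [Int.card_Icc, Int.card_Icc] at h1
  have ha' := Int.floor_nonneg.2 ha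
  have hb' := Int.floor_nonneg.2 hb
  have h2 : (T.card : ℤ) ≤ ⌊a⌋ + ⌊b⌋ := by omega
  have h3 : (T.card : ℝ) ≤ (⌊a⌋ : ℝ) + ⌊b⌋ := by exact_mod_cast h2
  linarith [Int.floor_le a, Int.floor_le b]

theorem exists_card_int_ge {a b : ℝ} (ha : 0 ≤ a) (hb : 0 ≤ b) :
    ∃ T : Finset ℤ, (∀ j ∈ T, (0 < j ∧ (j : ℝ) ≤ a) ∨ (j < 0 ∧ -(j : ℝ) ≤ b)) ∧
      a + b - 2 ≤ T.card := by
  refine ⟨Finset.Icc 1 ⌊a⌋ ∪ Finset.Icc (-⌊b⌋) (-1), ?_, ?_⟩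
  · intro j hj
    rw [Finset.mem_union, Finset.mem_Icc, Finset.mem_Icc] at hj
    rcases hj with h | h
    · exact Or.inl ⟨by omega, Int.le_floor.1 h.2⟩
    · have : -j ≤ ⌊b⌋ := by omega
      have := Int.le_floor.1 this
      push_cast at this
      exact Or.inr ⟨by omega, this⟩
  · rw [Finset.card_union_of_disjoint, Int.card_Icc, Int.card_Icc]
    · have ha' := Int.floor_nonneg.2 ha
      have hb' := Int.floor_nonneg.2 hb
      have h2 : (((⌊a⌋ + 1 - 1).toNat + (-1 + 1 - -⌊b⌋).toNat : ℕ) : ℤ) = ⌊a⌋ + ⌊b⌋ := by omega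
      have h3 : (((⌊a⌋ + 1 - 1).toNat + (-1 + 1 - -⌊b⌋).toNat : ℕ) : ℝ) = (⌊a⌋ : ℝ) + ⌊b⌋ := by
        exact_mod_cast h2
      rw [h3]
      linarith [Int.lt_floor_add_one a, Int.lt_floor_add_one b]
    · rw [Finset.disjoint_left]
      intro j h1 h2
      rw [Finset.mem_Icc] at h1 h2
      omega

theorem le_mul_rpow_neg_iff {α κ s θ X : ℝ} (hα : 0 < α) (hs : 0 < s) (hθ : 0 < θ) (hX : 0 < X)
    (hκ : 0 ≤ κ) : θ ≤ κ * X ^ (-α) * s ↔ X ≤ (κ * s / θ) ^ (1 / α) := by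
  rw [one_div, Real.le_rpow_inv_iff_of_pos hX.le (by positivity) hα, le_div_iff₀ hθ,
    Real.rpow_neg hX.le]
  have : 0 < X ^ α := by positivity
  rw [mul_right_comm, ← div_eq_mul_inv, le_div_iff₀ this, mul_comm]

theorem coef_zero {α : ℝ} (hα : 0 < α) (κ0 κinf : ℝ) (L : ℕ) : coef α κ0 κinf L 0 = 0 := by
  unfold coef
  rw [Int.cast_zero, abs_zero, mul_zero, Real.zero_rpow (by linarith), mul_zero]

/-- Number of positive (`κ = κinf`) or negative (`κ = κ0`) indices `j` above level `θ`. -/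
def levelY (α κ θ : ℝ) (L : ℕ) (k : ℤ) : ℝ :=
  (max κ 0 * symS (2 * Real.pi / L * k) / θ) ^ (1 / α) / L

theorem levelY_nonneg {α κ θ : ℝ} (hθ : 0 < θ) (L : ℕ) (k : ℤ) : 0 ≤ levelY α κ θ L k := by
  unfold levelY
  have := symS_pos (2 * Real.pi / L * k)
  have h2 : 0 ≤ max κ 0 := le_max_right _ _
  positivity

theorem levelY_eq {α κ θ : ℝ} (hθ : 0 < θ) (L : ℕ) (k : ℤ) :
    levelY α κ θ L k = (max κ 0) ^ (1 / α) / L * θ ^ (-(1 / α)) *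
      symS (2 * Real.pi / L * k) ^ (1 / α) := by
  unfold levelY
  have := symS_pos (2 * Real.pi / L * k)
  have h2 : 0 ≤ max κ 0 := le_max_right _ _
  rw [Real.div_rpow (by positivity) hθ.le, Real.mul_rpow h2 this.le, Real.rpow_neg hθ.le]
  field_simp

theorem level_pos {α κ0 κinf θ : ℝ} (hα : 0 < α) (hθ : 0 < θ) {L : ℕ} (hL : 0 < L) (j k : ℤ) :
    (θ ≤ modM (coef α κ0 κinf L) L (j, k) → (0 < j ∧ (j : ℝ) ≤ levelY α κinf θ L k) ∨
      (j < 0 ∧ -(j : ℝ) ≤ levelY α κ0 θ L k)) ∧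
    ((0 < j ∧ (j : ℝ) ≤ levelY α κinf θ L k) ∨ (j < 0 ∧ -(j : ℝ) ≤ levelY α κ0 θ L k) →
      θ ≤ modM (coef α κ0 κinf L) L (j, k)) := by
  have hL0 : (0:ℝ) < L := by exact_mod_cast hL
  have hs := symS_pos (2 * Real.pi / L * k)
  have key : ∀ κ X : ℝ, 0 < X → (θ ≤ κ * ((L : ℝ) * X) ^ (-α) * symS (2 * Real.pi / L * k) ↔
      X ≤ levelY α κ θ L k) := by
    intro κ X hX
    unfold levelY
    rw [le_div_iff₀ hL0, mul_comm X]
    rcases le_total 0 κ with h | h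
    · rw [max_eq_left h]
      exact le_mul_rpow_neg_iff hα hs hθ (by positivity) h
    · rw [max_eq_right h, zero_mul, zero_div, Real.zero_rpow (by positivity)]
      have h1 : κ * ((L : ℝ) * X) ^ (-α) * symS (2 * Real.pi / L * k) ≤ 0 :=
        mul_nonpos_of_nonpos_of_nonneg
          (mul_nonpos_of_nonpos_of_nonneg h (by positivity)) hs.le
      have h2 : 0 < L * X := by positivity
      constructor <;> intro h3 <;> linarith
  unfold modM coef
  rcases lt_trichotomy 0 j with h | h | h
  · have hj : (0:ℝ) < j := by exact_mod_cast h
    simp only [if_pos h, abs_of_pos hj, key _ _ hj]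
    constructor
    · exact fun h3 => Or.inl ⟨h, h3⟩
    · rintro (h3 | h3)
      · exact h3.2
      · omega
  · subst h
    simp [Real.zero_rpow (neg_ne_zero.2 hα.ne'), hθ]
  · have hj : (j : ℝ) < 0 := by exact_mod_cast h
    simp only [if_neg h.not_gt, abs_of_neg hj, key _ _ (neg_pos.2 hj)]
    constructor
    · exact fun h3 => Or.inr ⟨h, h3⟩
    · rintro (h3 | h3)
      · omega
      · exact h3.2

theorem level_upper {α κ0 κinf θ : ℝ} (hα : 0 < α) (hθ : 0 < θ) {L : ℕ} (hL : 0 < L) :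
    ∃ F : Finset (ℤ × ℤ), (∀ i ∉ F, modM (coef α κ0 κinf L) L i ≤ θ) ∧
      (F.card : ℝ) ≤ ((max κ0 0) ^ (1 / α) + (max κinf 0) ^ (1 / α)) / L *
        (∑' k : ℤ, symS (2 * Real.pi / L * k) ^ (1 / α)) * θ ^ (-(1 / α)) := by
  classical
  have hL0 : (0:ℝ) < L := by exact_mod_cast hL
  have hsum := (symS_riemann (p := 1 / α) (by positivity)
    (by have := Real.pi_pos; positivity : 0 < 2 * Real.pi / L)).1
  set P : Set (ℤ × ℤ) := {i | θ < modM (coef α κ0 κinf L) L i} with hP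
  have hbound : ∀ G : Finset (ℤ × ℤ), (G : Set (ℤ × ℤ)) ⊆ P → (G.card : ℝ) ≤
      ((max κ0 0) ^ (1 / α) + (max κinf 0) ^ (1 / α)) / L *
        (∑' k : ℤ, symS (2 * Real.pi / L * k) ^ (1 / α)) * θ ^ (-(1 / α)) := by
    intro G hG
    rw [Finset.card_eq_sum_card_image Prod.snd G]
    push_cast
    have hfib : ∀ k ∈ G.image Prod.snd, ((Finset.filter (fun i => i.2 = k) G).card : ℝ) ≤
        ((max κ0 0) ^ (1 / α) + (max κinf 0) ^ (1 / α)) / L * θ ^ (-(1 / α)) *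
          symS (2 * Real.pi / L * k) ^ (1 / α) := by
      intro k _
      have hinj : Set.InjOn Prod.fst (Finset.filter (fun i : ℤ × ℤ => i.2 = k) G : Set (ℤ × ℤ)) := by
        intro x hx y hy hxy
        simp only [Finset.coe_filter, Set.mem_ofPred_eq] at hx hy
        exact Prod.ext hxy (hx.2.trans hy.2.symm)
      rw [← Finset.card_image_of_injOn hinj]
      refine (card_int_le (levelY_nonneg (α := α) (κ := κinf) hθ L k)
        (levelY_nonneg (α := α) (κ := κ0) hθ L k)
        ?_).trans (le_of_eq ?_)
      · intro j hj
        obtain ⟨i, hi, rfl⟩ := Finset.mem_image.1 hj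
        obtain ⟨hi1, rfl⟩ := Finset.mem_filter.1 hi
        have : θ < modM (coef α κ0 κinf L) L i := hG hi1
        exact (level_pos hα hθ hL i.1 i.2).1 this.le
      · rw [levelY_eq hθ, levelY_eq hθ]
        ring
    refine (Finset.sum_le_sum hfib).trans ?_
    rw [← Finset.mul_sum, mul_right_comm]
    have h0 : ∀ κ : ℝ, 0 ≤ (max κ 0) ^ (1 / α) := fun κ => Real.rpow_nonneg (le_max_right _ _) _
    have h1 := hsum.sum_le_tsum (G.image Prod.snd) (fun k _ => Real.rpow_nonneg (symS_pos _).le _)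
    have := h0 κ0
    have := h0 κinf
    gcongr
  have hfin : P.Finite := by
    by_contra hinf
    obtain ⟨G, hG1, hG2⟩ := Set.Infinite.exists_subset_card_eq hinf
      (⌊((max κ0 0) ^ (1 / α) + (max κinf 0) ^ (1 / α)) / L *
        (∑' k : ℤ, symS (2 * Real.pi / L * k) ^ (1 / α)) * θ ^ (-(1 / α))⌋₊ + 1)
    have := hbound G hG1
    rw [hG2] at this
    push_cast at this
    exact absurd (Nat.lt_floor_add_one _) (not_lt.2 this)
  refine ⟨hfin.toFinset, ?_, hbound _ (by simp)⟩
  intro i hi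
  rw [Set.Finite.mem_toFinset] at hi
  exact not_lt.1 hi

theorem level_lower {α κ0 κinf θ : ℝ} (hα : 0 < α) (hθ : 0 < θ) {L : ℕ} (hL : 0 < L)
    (T : Finset ℤ) :
    ∃ F : Finset (ℤ × ℤ), (∀ i ∈ F, θ ≤ modM (coef α κ0 κinf L) L i) ∧
      ((max κ0 0) ^ (1 / α) + (max κinf 0) ^ (1 / α)) / L *
        (∑ k ∈ T, symS (2 * Real.pi / L * k) ^ (1 / α)) * θ ^ (-(1 / α)) - 2 * T.card ≤ F.card := by
  classical
  choose G hG1 hG2 using fun k : ℤ => exists_card_int_ge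
    (levelY_nonneg (α := α) (κ := κinf) hθ L k) (levelY_nonneg (α := α) (κ := κ0) hθ L k)
  refine ⟨(T.sigma G).image fun x => (x.2, x.1), ?_, ?_⟩
  · intro i hi
    obtain ⟨x, hx, rfl⟩ := Finset.mem_image.1 hi
    exact (level_pos hα hθ hL x.2 x.1).2 (hG1 _ _ (Finset.mem_sigma.1 hx).2)
  · rw [Finset.card_image_of_injective, Finset.card_sigma]
    · push_cast
      refine le_trans (le_of_eq ?_) (Finset.sum_le_sum fun k _ => hG2 k)
      rw [Finset.sum_sub_distrib, Finset.sum_const, nsmul_eq_mul, mul_right_comm, Finset.mul_sum]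
      congr 1
      · refine Finset.sum_congr rfl fun k _ => ?_
        rw [levelY_eq hθ, levelY_eq hθ]
        ring
      · ring
    · rintro ⟨a, b⟩ ⟨a', b'⟩ h
      simp only [Prod.mk.injEq] at h
      obtain ⟨rfl, rfl⟩ := h
      rfl

/-- The quadratic form `R` is bounded by `β` off a subspace of codimension at most `r`. -/
def SmallForm (r β : ℝ) (R : HSp → ℂ) : Prop :=
  ∃ S : Finset HSp, (S.card : ℝ) ≤ r ∧ ∀ u, (∀ v ∈ S, inner ℂ v u = 0) → ‖R u‖ ≤ β * ‖u‖ ^ 2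

theorem SmallForm.add {r r' β β' : ℝ} {R R' : HSp → ℂ} (h : SmallForm r β R)
    (h' : SmallForm r' β' R') : SmallForm (r + r') (β + β') fun u => R u + R' u := by
  classical
  obtain ⟨S, hS, hR⟩ := h
  obtain ⟨S', hS', hR'⟩ := h'
  refine ⟨S ∪ S', ?_, fun u hu => ?_⟩
  · have : ((S ∪ S').card : ℝ) ≤ S.card + S'.card := by exact_mod_cast Finset.card_union_le S S'
    linarith
  · rw [add_mul]
    exact (norm_add_le _ _).trans (add_le_add
      (hR u fun v hv => hu v (Finset.mem_union_left _ hv))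
      (hR' u fun v hv => hu v (Finset.mem_union_right _ hv)))

/-- `R` does not contribute to spectral asymptotics of order `n ^ (-α)`. -/
def Negligible (α : ℝ) (R : HSp → ℂ) : Prop :=
  ∀ ε : ℝ, 0 < ε → ∀ᶠ θ in nhdsWithin (0:ℝ) (Ioi 0), SmallForm (ε * θ ^ (-(1 / α))) (ε * θ) R

/-- The Weyl-type coefficient. -/
def weylV (α κ0 κinf : ℝ) : ℝ :=
  ((max κ0 0) ^ (1 / α) + (max κinf 0) ^ (1 / α)) *
    ((∫ ξ, symS ξ ^ (1 / α)) / (2 * Real.pi))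

theorem weylV_nonneg (α κ0 κinf : ℝ) : 0 ≤ weylV α κ0 κinf := by
  have h0 : ∀ κ : ℝ, 0 ≤ (max κ 0) ^ (1 / α) := fun κ => Real.rpow_nonneg (le_max_right _ _) _
  have := h0 κ0
  have := h0 κinf
  have : 0 ≤ ∫ ξ, symS ξ ^ (1 / α) := integral_nonneg fun ξ => Real.rpow_nonneg (symS_pos _).le _
  have := Real.pi_pos
  unfold weylV
  positivity

theorem exists_weylV_near {α : ℝ} (hα : 0 < α) (κ0 κinf : ℝ) {ε : ℝ} (hε : 0 < ε) :
    ∃ L0 : ℕ, ∀ L : ℕ, 0 < L → L0 ≤ L →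
      |((max κ0 0) ^ (1 / α) + (max κinf 0) ^ (1 / α)) / L *
        (∑' k : ℤ, symS (2 * Real.pi / L * k) ^ (1 / α)) - weylV α κ0 κinf| ≤ ε := by
  set A := (max κ0 0) ^ (1 / α) + (max κinf 0) ^ (1 / α) with hA
  have hA0 : 0 ≤ A :=
    add_nonneg (Real.rpow_nonneg (le_max_right _ _) _) (Real.rpow_nonneg (le_max_right _ _) _)
  have hπ := Real.pi_pos
  have hs0 : 0 ≤ symS 0 ^ (1 / α) := Real.rpow_nonneg (symS_pos _).le _
  obtain ⟨L0, hL0⟩ := exists_nat_ge (A * symS 0 ^ (1 / α) / ε)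
  refine ⟨L0, fun L hL hLL => ?_⟩
  have hLr : (0:ℝ) < L := by exact_mod_cast hL
  have h1 := (symS_riemann (p := 1 / α) (by positivity)
    (by positivity : 0 < 2 * Real.pi / L)).2
  have e : A / L * (∑' k : ℤ, symS (2 * Real.pi / L * k) ^ (1 / α)) - weylV α κ0 κinf =
      A / (2 * Real.pi) * (2 * Real.pi / L * (∑' k : ℤ, symS (2 * Real.pi / L * k) ^ (1 / α)) -
        ∫ ξ, symS ξ ^ (1 / α)) := by
    rw [weylV, ← hA]
    field_simp
  rw [e, abs_mul, abs_of_nonneg (by positivity)]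
  refine (mul_le_mul_of_nonneg_left h1 (by positivity)).trans ?_
  have e2 : A / (2 * Real.pi) * (2 * Real.pi / L * symS 0 ^ (1 / α)) =
      A * symS 0 ^ (1 / α) / L := by field_simp
  rw [e2, div_le_iff₀ hLr]
  have h2 : A * symS 0 ^ (1 / α) / ε ≤ L := hL0.trans (by exact_mod_cast hLL)
  rwa [div_le_iff₀ hε, mul_comm (L : ℝ)] at h2

end Counting

section Asymptotics

theorem Reg.exists_diag_approx {N : ℕ} {α κ0 κinf C : ℝ} {f : ℝ → ℝ} (hα : 0 < α)
    (hf : Reg N α κ0 κinf C f) {R : HSp → ℂ} (hR : Negligible α R) {K : HSp →L[ℂ] HSp}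
    (hK : ∀ u : HSp, (inner ℂ (K u) u).re = (form (fun t s => f (t + s)) u + R u).re)
    {ε : ℝ} (hε : 0 < ε) (L0 : ℕ) :
    ∃ (L : ℕ) (hL : 0 < L), L0 ≤ L ∧ ∀ᶠ θ in nhdsWithin (0:ℝ) (Ioi 0),
      ∃ S : Finset HSp, (S.card : ℝ) ≤ ε * θ ^ (-(1 / α)) ∧
        ∀ u : HSp, (∀ v ∈ S, inner ℂ v u = 0) →
          |(inner ℂ (K u) u).re -
            ∑' i, modM (coef α κ0 κinf L) L i * ‖inner ℂ (eV hL i) u‖ ^ 2| ≤ ε * θ * ‖u‖ ^ 2 := by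
  obtain ⟨L, hL, hLL, h1⟩ := hf.exists_form_approx hα (half_pos hε) L0
  refine ⟨L, hL, hLL, ?_⟩
  filter_upwards [h1, hR _ (half_pos hε)] with θ hθ1 hθ2
  obtain ⟨S, hS, hu⟩ := SmallForm.add (R := fun u => form (fun t s => f (t + s)) u -
    ((∑' i, modM (coef α κ0 κinf L) L i * ‖inner ℂ (eV hL i) u‖ ^ 2 : ℝ) : ℂ)) hθ1 hθ2
  refine ⟨S, hS.trans (le_of_eq (by ring)), fun u huS => ?_⟩
  have h3 := (Complex.abs_re_le_norm _).trans (hu u huS)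
  beta_reduce at h3
  rw [sub_add_eq_add_sub, Complex.sub_re, ← hK, Complex.ofReal_re] at h3
  exact h3.trans (le_of_eq (by ring))

theorem Reg.posEig_nonneg {N : ℕ} {α κ0 κinf C : ℝ} {f : ℝ → ℝ} (hα : 0 < α)
    (hf : Reg N α κ0 κinf C f) {R : HSp → ℂ} (hR : Negligible α R) {K : HSp →L[ℂ] HSp}
    (hK : ∀ u : HSp, (inner ℂ (K u) u).re = (form (fun t s => f (t + s)) u + R u).re)
    {n : ℕ} (hn : 1 ≤ n) : 0 ≤ posEig K n := by
  obtain ⟨L, hL, -, h1⟩ := hf.exists_diag_approx hα hR hK one_pos 0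
  have h2 : ∀ᶠ θ in nhdsWithin (0:ℝ) (Ioi 0), -θ ≤ posEig K n := by
    filter_upwards [h1] with θ hθ
    obtain ⟨S, -, hS⟩ := hθ
    have := le_posEig_of_diag K (eV hL) (orthonormal_eV hL) (modM (coef α κ0 κinf L) L) (1 * θ) 0 S
      (fun u hu => by linarith [(abs_le.1 (hS u hu)).1])
      ((Finset.range (n + S.card)).image fun k : ℕ => ((0:ℤ), (k : ℤ))) ?_ n hn ?_
    · linarith
    · intro i hi
      obtain ⟨k, -, rfl⟩ := Finset.mem_image.1 hi
      rw [modM, coef_zero hα, zero_mul]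
    · rw [Finset.card_image_of_injective, Finset.card_range]
      intro a b hab
      simpa using hab
  have h3 : Tendsto (fun θ : ℝ => -θ) (nhdsWithin (0:ℝ) (Ioi 0)) (nhds 0) := by
    have : Tendsto (fun θ : ℝ => -θ) (nhds 0) (nhds (-0)) := tendsto_id.neg
    rw [neg_zero] at this
    exact this.mono_left nhdsWithin_le_nhds
  exact le_of_tendsto h3 h2

theorem Reg.posEig_asymp {N : ℕ} {α κ0 κinf C : ℝ} {f : ℝ → ℝ} (hα : 0 < α)
    (hf : Reg N α κ0 κinf C f) {R : HSp → ℂ} (hR : Negligible α R) {K : HSp →L[ℂ] HSp}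
    (hK : ∀ u : HSp, (inner ℂ (K u) u).re = (form (fun t s => f (t + s)) u + R u).re) :
    (fun n : ℕ => posEig K n - weylV α κ0 κinf ^ α * (n : ℝ) ^ (-α)) =o[atTop]
      fun n : ℕ => (n : ℝ) ^ (-α) := by
  refine isLittleO_of_counting hα (weylV_nonneg α κ0 κinf) _
    (fun n hn => hf.posEig_nonneg hα hR hK hn) ?_ ?_
  · intro ε hε _
    obtain ⟨L0, hL0⟩ := exists_weylV_near hα κ0 κinf (by positivity : 0 < ε / 4)
    obtain ⟨L, hL, hLL, h1⟩ := hf.exists_diag_approx hα hR hK (by positivity : 0 < ε / 4) L0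
    filter_upwards [h1, self_mem_nhdsWithin] with θ hθ1 hθ n hn hnV
    have hθ : 0 < θ := hθ
    obtain ⟨S, hS1, hS2⟩ := hθ1
    obtain ⟨F, hF1, hF2⟩ := level_upper (κ0 := κ0) (κinf := κinf) hα hθ hL
    have hθp : 0 < θ ^ (-(1 / α)) := by positivity
    have hV := (abs_le.1 (hL0 L hL hLL)).2
    have := posEig_le_of_diag K (eV hL) (orthonormal_eV hL) (modM (coef α κ0 κinf L) L)
      (ε / 4 * θ) θ (by positivity) hθ.le S
      (fun u hu => by linarith [(abs_le.1 (hS2 u hu)).2]) F hF1 n ?_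
    · nlinarith
    · have : ((S.card + F.card : ℕ) : ℝ) < n := by
        push_cast
        nlinarith
      exact_mod_cast this
  · intro ε hε _
    obtain ⟨L0, hL0⟩ := exists_weylV_near hα κ0 κinf (by positivity : 0 < ε / 4)
    obtain ⟨L, hL, hLL, h1⟩ := hf.exists_diag_approx hα hR hK (by positivity : 0 < ε / 4) L0
    have hV := (abs_le.1 (hL0 L hL hLL)).1
    have hπ := Real.pi_pos
    have hsum := (symS_riemann (p := 1 / α) (by positivity)
      (by positivity : 0 < 2 * Real.pi / L)).1.hasSum.mul_left
        (((max κ0 0) ^ (1 / α) + (max κinf 0) ^ (1 / α)) / L)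
    obtain ⟨T, hT⟩ := (hsum.eventually (lt_mem_nhds (sub_lt_self _
      (by positivity : 0 < ε / 4)))).exists
    rw [← Finset.mul_sum] at hT
    filter_upwards [h1, self_mem_nhdsWithin, eventually_mul_rpow_le
      (by positivity : 0 < 1 / α) (2 * T.card : ℝ) (by positivity : 0 < ε / 4)]
      with θ hθ1 hθ hθT n hn hnV
    have hθ : 0 < θ := hθ
    rw [neg_zero, Real.rpow_zero, mul_one] at hθT
    obtain ⟨S, hS1, hS2⟩ := hθ1
    obtain ⟨F, hF1, hF2⟩ := level_lower (κ0 := κ0) (κinf := κinf) hα hθ hL T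
    have hθp : 0 < θ ^ (-(1 / α)) := by positivity
    have := le_posEig_of_diag K (eV hL) (orthonormal_eV hL) (modM (coef α κ0 κinf L) L)
      (ε / 4 * θ) θ S
      (fun u hu => by linarith [(abs_le.1 (hS2 u hu)).1]) F hF1 n hn ?_
    · nlinarith
    · have : ((n + S.card : ℕ) : ℝ) ≤ F.card := by
        push_cast
        have := mul_le_mul_of_nonneg_right (hV.trans (sub_le_sub_right (sub_le_iff_le_add.1
          hT.le) _)) hθp.le
        nlinarith
      exact_mod_cast this

theorem weylV_rpow {α : ℝ} (hα : 0 < α) (κ0 κinf : ℝ) :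
    weylV α κ0 κinf ^ α =
      tauC α * ((max κ0 0) ^ (1 / α) + (max κinf 0) ^ (1 / α)) ^ α := by
  have hA : 0 ≤ (max κ0 0) ^ (1 / α) + (max κinf 0) ^ (1 / α) :=
    add_nonneg (Real.rpow_nonneg (le_max_right _ _) _) (Real.rpow_nonneg (le_max_right _ _) _)
  have hπ := Real.pi_pos
  set B := Real.Gamma (1 / (2 * α)) * Real.Gamma (1 / 2) / Real.Gamma (1 / (2 * α) + 1 / 2) with hB
  have hB0 : 0 < B := by
    have h1 := Real.Gamma_pos_of_pos (by positivity : 0 < 1 / (2 * α))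
    have h2 := Real.Gamma_pos_of_pos (by norm_num : (0:ℝ) < 1 / 2)
    have h3 := Real.Gamma_pos_of_pos (by positivity : 0 < 1 / (2 * α) + 1 / 2)
    positivity
  have hI : ∫ ξ, symS ξ ^ (1 / α) = Real.pi ^ (1 / α - 1) * B := by
    rw [integral_symS_rpow (by positivity), hB, show 1 / α / 2 = 1 / (2 * α) by field_simp]
  rw [weylV, hI, Real.mul_rpow hA (by positivity), tauC, ← hB, mul_comm]
  congr 1
  have e1 : Real.pi ^ (1 / α - 1) * B / (2 * Real.pi) =
      (2:ℝ)⁻¹ * Real.pi ^ (1 / α - 2) * B := by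
    rw [show 1 / α - 1 = (1 / α - 2) + 1 by ring, Real.rpow_add hπ, Real.rpow_one]
    field_simp
  rw [e1, Real.mul_rpow (by positivity) hB0.le, Real.mul_rpow (by positivity) (by positivity),
    Real.inv_rpow (by norm_num), ← Real.rpow_neg (by norm_num), ← Real.rpow_mul hπ.le]
  congr 3
  field_simp

end Asymptotics

section HankelForm

theorem abs_add_kernel_le {g : ℝ → ℝ} {M : ℝ} (hM : 0 ≤ M) (hb : ∀ τ, 0 < τ → |g τ| * τ ≤ M)
    {t s : ℝ} (ht : 0 < t) (hs : 0 < s) : |g (t + s)| ≤ M * gK 0 t s := by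
  have h1 := hb (t + s) (by positivity)
  rw [← le_div_iff₀ (by positivity), div_eq_mul_inv] at h1
  exact h1.trans (mul_le_mul_of_nonneg_left (gK_exp_le ht hs) hM)

theorem measurable_add_kernel {g : ℝ → ℝ} (hg : Measurable g) :
    Measurable fun z : ℝ × ℝ => g (z.1 + z.2) :=
  hg.comp (measurable_fst.add measurable_snd)

theorem re_inner_hankel {h g : ℝ → ℝ} {H : HSp →L[ℂ] HSp}
    (hH : IsHankel (fun t => ((h t : ℝ) : ℂ)) H) (hg : Measurable g)
    (hgh : ∀ᵐ τ ∂muP, h τ = g τ) {M : ℝ} (hM : 0 ≤ M) (hb : ∀ τ, 0 < τ → |g τ| * τ ≤ M) (u : HSp) :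
    (inner ℂ (H u) u).re = (form (fun t s => g (t + s)) u).re := by
  have hu : MemLp (u : ℝ → ℂ) 2 muP := Lp.memLp u
  have hint := integrable_form (k := fun t s => g (t + s)) (a := 0) (M := M)
    (measurable_add_kernel hg) (fun t s ht hs => abs_add_kernel_le hM hb ht hs) hu
  have h1 : form (fun t s => g (t + s)) u = inner ℂ u (H u) := by
    rw [form, integral_prod _ hint, L2.inner_def]
    refine integral_congr_ae ?_
    filter_upwards [hH u, ae_muP_pos] with t ht ht0
    rw [ht, RCLike.inner_apply, ← integral_mul_const]
    have hs : ∀ᵐ s ∂muP, h (t + s) = g (t + s) := by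
      rw [ae_restrict_iff' measurableSet_Ioi] at hgh ⊢
      have := (measurePreserving_add_left volume t).quasiMeasurePreserving.ae hgh
      filter_upwards [this] with s hs hs0
      exact hs (add_pos ht0 hs0)
    refine integral_congr_ae ?_
    filter_upwards [hs] with s hs
    rw [hs]
    ring
  rw [h1, ← Complex.conj_re, inner_conj_symm]

end HankelForm

section ModelKernel

theorem exists_iteratedDeriv_model (α : ℝ) (σ : ℝ) (m : ℕ) :
    ∃ P : Polynomial ℝ, P.eval 0 = (-1) ^ m * m.factorial ∧ ∀ t, 0 < t → 0 < σ * Real.log t →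
      iteratedDeriv m (fun t : ℝ => t⁻¹ * (σ * Real.log t) ^ (-α)) t =
        (t ^ (m + 1))⁻¹ * ((σ * Real.log t) ^ (-α) * P.eval (σ * Real.log t)⁻¹) := by
  induction m with
  | zero => exact ⟨1, by simp, fun t _ _ => by simp⟩
  | succ m ih =>
    obtain ⟨P, hP0, hP⟩ := ih
    refine ⟨-(Polynomial.C ((m:ℝ) + 1)) * P - Polynomial.C σ * (Polynomial.C α * Polynomial.X * P +
      Polynomial.X ^ 2 * Polynomial.derivative P), ?_, fun t ht hy => ?_⟩
    · simp only [Polynomial.eval_sub, Polynomial.eval_mul, Polynomial.eval_neg, Polynomial.eval_C,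
        Polynomial.eval_add, Polynomial.eval_X, Polynomial.eval_pow, hP0, Nat.factorial_succ]
      push_cast
      ring
    · have hev : iteratedDeriv m (fun t : ℝ => t⁻¹ * (σ * Real.log t) ^ (-α)) =ᶠ[nhds t]
          fun t => (t ^ (m + 1))⁻¹ * ((σ * Real.log t) ^ (-α) * P.eval (σ * Real.log t)⁻¹) := by
        have hc : ContinuousAt (fun t => σ * Real.log t) t :=
          continuousAt_const.mul (Real.continuousAt_log ht.ne')
        filter_upwards [lt_mem_nhds ht, hc.eventually (lt_mem_nhds hy)] with t' h1 h2
        exact hP t' h1 h2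
      rw [iteratedDeriv_succ, hev.deriv_eq]
      have d0 : HasDerivAt (fun t => σ * Real.log t) (σ * t⁻¹) t :=
        (Real.hasDerivAt_log ht.ne').const_mul σ
      set y := σ * Real.log t with hyd
      have d1 : HasDerivAt (fun t => (σ * Real.log t) ^ (-α)) (σ * t⁻¹ * (-α) * y ^ (-α - 1)) t :=
        d0.rpow_const (Or.inl hy.ne')
      have d2 : HasDerivAt (fun t => (σ * Real.log t)⁻¹) (-(σ * t⁻¹) / y ^ 2) t := d0.inv hy.ne'
      have d3 : HasDerivAt (fun t => P.eval (σ * Real.log t)⁻¹)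
          ((Polynomial.derivative P).eval y⁻¹ * (-(σ * t⁻¹) / y ^ 2)) t :=
        HasDerivAt.comp (h₂ := fun x => P.eval x) t (P.hasDerivAt y⁻¹) d2
      have d4 : HasDerivAt (fun t : ℝ => (t ^ (m + 1))⁻¹)
          (-(((m + 1 : ℕ) : ℝ) * t ^ m) / (t ^ (m + 1)) ^ 2) t :=
        (hasDerivAt_pow (m + 1) t).inv (by positivity)
      rw [(d4.fun_mul (d1.fun_mul d3)).deriv]
      simp only [Polynomial.eval_sub, Polynomial.eval_mul, Polynomial.eval_neg, Polynomial.eval_C,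
        Polynomial.eval_add, Polynomial.eval_X, Polynomial.eval_pow]
      rw [Real.rpow_sub_one hy.ne', ← hyd]
      push_cast
      field_simp
      ring

theorem contDiffAt_model (α σ : ℝ) (n : ℕ) {t : ℝ} (ht : 0 < t) (hy : 0 < σ * Real.log t) :
    ContDiffAt ℝ n (fun t : ℝ => t⁻¹ * (σ * Real.log t) ^ (-α)) t :=
  (contDiffAt_inv ℝ ht.ne').mul
    ((contDiffAt_const.mul (contDiffAt_id.log ht.ne')).rpow_const_of_ne hy.ne')

theorem one_add_sq_rpow_le {α : ℝ} (hα : 0 < α) {x : ℝ} (hx : 0 < x) :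
    (1 + x ^ 2) ^ (-α / 2) ≤ x ^ (-α) := by
  have : x ^ (-α) = (x ^ 2) ^ (-α / 2) := by
    rw [← Real.rpow_natCast x 2, ← Real.rpow_mul hx.le]
    congr 1
    push_cast
    ring
  rw [this]
  exact Real.rpow_le_rpow_of_nonpos (by positivity) (by linarith) (by linarith)

theorem eventually_iteratedDeriv_near {α : ℝ} (hα : 0 < α) {σ κ : ℝ} (hσ : |σ| = 1)
    {l : Filter ℝ} (hl0 : ∀ᶠ t in l, 0 < t) (hl : Tendsto (fun t => σ * Real.log t) l atTop)
    {h : ℝ → ℝ} {N m : ℕ} (hm : m ≤ N) (hh : ContDiffOn ℝ N h (Ioi 0))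
    (hc : iteratedDerivWithin m
          (fun t : ℝ => h t - κ * (t⁻¹ * (σ * Real.log t) ^ (-α))) (Set.Ioi 0)
        =o[l] fun t : ℝ => t ^ (-1 - (m:ℝ)) * (1 + Real.log t ^ 2) ^ (-α/2)) {η : ℝ} (hη : 0 < η) :
    ∀ᶠ t in l, |iteratedDeriv m ((Ioi 0).indicator h) t * t ^ (m + 1) -
      (-1) ^ m * m.factorial * (κ * |Real.log t| ^ (-α))| ≤ η * |Real.log t| ^ (-α) := by
  obtain ⟨P, hP0, hP⟩ := exists_iteratedDeriv_model α σ m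
  have hlim : Tendsto (fun t => κ * (P.eval (σ * Real.log t)⁻¹ - P.eval 0)) l (nhds 0) := by
    have h1 := (P.continuous.tendsto 0).comp (tendsto_inv_atTop_zero.comp hl)
    have h2 := (h1.sub_const (P.eval 0)).const_mul κ
    rw [sub_self, mul_zero] at h2
    exact h2
  have hlim' := (Metric.tendsto_nhds.1 hlim) (η / 2) (by positivity)
  filter_upwards [hl0, hl.eventually_gt_atTop 0, hlim', hc.def (by positivity : 0 < η / 2)]
    with t ht hy h1 h2
  set y := σ * Real.log t with hyd
  have habs : |Real.log t| = y := by
    rw [← abs_of_pos hy, hyd, abs_mul, hσ, one_mul]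
  have hI : Ioi (0:ℝ) ∈ nhds t := Ioi_mem_nhds ht
  have hht : ContDiffAt ℝ m h t := (hh.contDiffAt hI).of_le (by exact_mod_cast hm)
  have e1 : iteratedDeriv m ((Ioi 0).indicator h) t = iteratedDeriv m h t := by
    refine Filter.EventuallyEq.iteratedDeriv_eq m ?_
    filter_upwards [hI] with s hs
    exact indicator_of_mem hs h
  have e2 : iteratedDerivWithin m
      (fun t : ℝ => h t - κ * (t⁻¹ * (σ * Real.log t) ^ (-α))) (Set.Ioi 0) t =
      iteratedDeriv m h t - κ * ((t ^ (m + 1))⁻¹ * (y ^ (-α) * P.eval y⁻¹)) := by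
    rw [iteratedDerivWithin_of_isOpen isOpen_Ioi ht, iteratedDeriv_fun_sub hht
      (contDiffAt_const.mul (contDiffAt_model α σ m ht hy)), iteratedDeriv_const_mul_field,
      hP t ht hy]
  rw [e2, Real.norm_eq_abs, Real.norm_of_nonneg (by positivity)] at h2
  have e3 : t ^ (-1 - (m:ℝ)) = (t ^ (m + 1))⁻¹ := by
    rw [show -1 - (m:ℝ) = -((m + 1 : ℕ) : ℝ) by push_cast; ring, Real.rpow_neg ht.le,
      Real.rpow_natCast]
  have h3 : (1 + Real.log t ^ 2) ^ (-α / 2) ≤ y ^ (-α) := by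
    rw [← sq_abs, habs]
    exact one_add_sq_rpow_le hα hy
  rw [e1, habs]
  rw [Real.dist_eq, sub_zero, hP0] at h1
  rw [e3] at h2
  have hy0 : 0 < y ^ (-α) := by positivity
  have ht0 : 0 < t ^ (m + 1) := by positivity
  have e4 : iteratedDeriv m h t * t ^ (m + 1) - (-1) ^ m * m.factorial * (κ * y ^ (-α)) =
      (iteratedDeriv m h t - κ * ((t ^ (m + 1))⁻¹ * (y ^ (-α) * P.eval y⁻¹))) * t ^ (m + 1) +
      κ * (P.eval y⁻¹ - (-1) ^ m * m.factorial) * y ^ (-α) := by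
    field_simp
    ring
  rw [e4]
  refine (abs_add_le _ _).trans ?_
  rw [abs_mul, abs_mul _ (y ^ (-α)), abs_of_pos ht0, abs_of_pos hy0]
  have h4 := mul_le_mul_of_nonneg_right h2 ht0.le
  have h5 : η / 2 * ((t ^ (m + 1))⁻¹ * (1 + Real.log t ^ 2) ^ (-α / 2)) * t ^ (m + 1) =
      η / 2 * (1 + Real.log t ^ 2) ^ (-α / 2) := by
    field_simp
  rw [h5] at h4
  have h6 := mul_le_mul_of_nonneg_right h1.le hy0.le
  nlinarith

theorem exists_log_ge_of_eventually {p : ℝ → Prop} (h : ∀ᶠ t in atTop, p t) :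
    ∃ X, ∀ τ, 0 < τ → X ≤ Real.log τ → p τ := by
  have := Real.tendsto_exp_atTop.eventually h
  obtain ⟨X, hX⟩ := eventually_atTop.1 this
  refine ⟨X, fun τ hτ h => ?_⟩
  simpa [Real.exp_log hτ] using hX _ h

theorem exists_log_le_of_eventually {p : ℝ → Prop} (h : ∀ᶠ t in nhdsWithin 0 (Ioi 0), p t) :
    ∃ X, ∀ τ, 0 < τ → Real.log τ ≤ -X → p τ := by
  have := Real.tendsto_exp_atBot_nhdsGT.eventually h
  obtain ⟨X, hX⟩ := eventually_atBot.1 this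
  refine ⟨-X, fun τ hτ h => ?_⟩
  rw [neg_neg] at h
  simpa [Real.exp_log hτ] using hX _ h

theorem exists_log_bound {α : ℝ} (hα : 0 < α) {g : ℝ → ℝ} {c X : ℝ}
    (hends : ∀ τ, 0 < τ → X ≤ |Real.log τ| → |g τ| ≤ c * |Real.log τ| ^ (-α))
    (hmid : ∀ a b : ℝ, 0 < a → ∃ M, ∀ τ ∈ Icc a b, |g τ| ≤ M) :
    ∃ C, 0 ≤ C ∧ ∀ τ, 0 < τ → |g τ| ≤ C * (1 + |Real.log τ|) ^ (-α) := by
  set Y := max X 1 with hY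
  have hY1 : 1 ≤ Y := le_max_right _ _
  obtain ⟨M, hM⟩ := hmid (Real.exp (-Y)) (Real.exp Y) (Real.exp_pos _)
  refine ⟨max 0 (max (c * 2 ^ α) (M * (1 + Y) ^ α)), le_max_left _ _, fun τ hτ => ?_⟩
  have hp : 0 < (1 + |Real.log τ|) ^ (-α) := by positivity
  rcases le_total Y |Real.log τ| with h | h
  · have h1 := hends τ hτ ((le_max_left _ _).trans h)
    have hl : 0 < |Real.log τ| := by linarith
    have hc : 0 ≤ c := by
      by_contra! hc
      have : 0 < |Real.log τ| ^ (-α) := by positivity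
      nlinarith [abs_nonneg (g τ)]
    have h2 : |Real.log τ| ^ (-α) ≤ 2 ^ α * (1 + |Real.log τ|) ^ (-α) := by
      have : |Real.log τ| ^ (-α) ≤ ((1 + |Real.log τ|) / 2) ^ (-α) :=
        Real.rpow_le_rpow_of_nonpos (by positivity) (by linarith) (by linarith)
      rw [Real.div_rpow (by positivity) (by norm_num), Real.rpow_neg (by norm_num : (0:ℝ) ≤ 2),
        div_inv_eq_mul] at this
      linarith
    calc |g τ| ≤ c * (2 ^ α * (1 + |Real.log τ|) ^ (-α)) :=
          h1.trans (mul_le_mul_of_nonneg_left h2 hc)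
      _ = c * 2 ^ α * (1 + |Real.log τ|) ^ (-α) := by ring
      _ ≤ _ := mul_le_mul_of_nonneg_right ((le_max_left _ _).trans (le_max_right _ _)) hp.le
  · have h1 := hM τ ⟨by
      rw [← Real.le_log_iff_exp_le hτ]; exact (abs_le.1 h).1, by
      rw [← Real.log_le_iff_le_exp hτ]; exact (abs_le.1 h).2⟩
    have hM0 : 0 ≤ M := (abs_nonneg _).trans h1
    have h2 : (1:ℝ) ≤ (1 + Y) ^ α * (1 + |Real.log τ|) ^ (-α) := by
      rw [Real.rpow_neg (by positivity), ← div_eq_mul_inv, one_le_div (by positivity)]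
      exact Real.rpow_le_rpow (by positivity) (by linarith) hα.le
    calc |g τ| ≤ M * ((1 + Y) ^ α * (1 + |Real.log τ|) ^ (-α)) := by nlinarith
      _ = M * (1 + Y) ^ α * (1 + |Real.log τ|) ^ (-α) := by ring
      _ ≤ _ := mul_le_mul_of_nonneg_right ((le_max_right _ _).trans (le_max_right _ _)) hp.le

theorem tendsto_neg_log_nhdsGT :
    Tendsto (fun t => -1 * Real.log t) (nhdsWithin 0 (Ioi 0)) atTop := by
  simpa using Real.tendsto_log_nhdsGT_zero

theorem exists_reg {α : ℝ} (hα : 0 < α) {N : ℕ} (hN : 1 ≤ N) (hαN : α < N) {h : ℝ → ℝ}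
    (hh : ContDiffOn ℝ N h (Ioi 0)) {κ0 κinf : ℝ}
    (hzero : ∀ m : ℕ, m ≤ N →
      iteratedDerivWithin m
          (fun t : ℝ => h t - κ0 * (t⁻¹ * (-1 * Real.log t) ^ (-α))) (Set.Ioi 0)
        =o[nhdsWithin 0 (Set.Ioi 0)]
          fun t : ℝ => t ^ (-1 - (m:ℝ)) * (1 + Real.log t ^ 2) ^ (-α/2))
    (hinf : ∀ m : ℕ, m ≤ N →
      iteratedDerivWithin m
          (fun t : ℝ => h t - κinf * (t⁻¹ * (1 * Real.log t) ^ (-α))) (Set.Ioi 0)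
        =o[atTop] fun t : ℝ => t ^ (-1 - (m:ℝ)) * (1 + Real.log t ^ 2) ^ (-α/2)) :
    ∃ C, Reg N α κ0 κinf C ((Ioi 0).indicator h) := by
  have ainf : ∀ η, 0 < η → ∀ m ≤ N, ∃ X, ∀ τ, 0 < τ → X ≤ Real.log τ →
      |iteratedDeriv m ((Ioi 0).indicator h) τ * τ ^ (m + 1) -
        (-1) ^ m * m.factorial * (κinf * |Real.log τ| ^ (-α))| ≤ η * |Real.log τ| ^ (-α) :=
    fun η hη m hm => exists_log_ge_of_eventually (eventually_iteratedDeriv_near hα (by simp)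
      (eventually_gt_atTop 0) (by simpa using Real.tendsto_log_atTop) hm hh (hinf m hm) hη)
  have azero : ∀ η, 0 < η → ∀ m ≤ N, ∃ X, ∀ τ, 0 < τ → Real.log τ ≤ -X →
      |iteratedDeriv m ((Ioi 0).indicator h) τ * τ ^ (m + 1) -
        (-1) ^ m * m.factorial * (κ0 * |Real.log τ| ^ (-α))| ≤ η * |Real.log τ| ^ (-α) :=
    fun η hη m hm => exists_log_le_of_eventually (eventually_iteratedDeriv_near hα (by simp)
      self_mem_nhdsWithin tendsto_neg_log_nhdsGT hm hh (hzero m hm) hη)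
  have hsm : ContDiffOn ℝ N ((Ioi 0).indicator h) (Ioi 0) :=
    hh.congr fun t ht => indicator_of_mem ht h
  have hbd : ∀ m ≤ N, ∃ C, 0 ≤ C ∧ ∀ τ, 0 < τ →
      |iteratedDeriv m ((Ioi 0).indicator h) τ * τ ^ (m + 1)| ≤ C * (1 + |Real.log τ|) ^ (-α) := by
    intro m hm
    obtain ⟨X1, h1⟩ := ainf 1 one_pos m hm
    obtain ⟨X0, h0⟩ := azero 1 one_pos m hm
    refine exists_log_bound hα (c := m.factorial * (|κ0| + |κinf|) + 1)
      (X := max X1 X0) (fun τ hτ hX => ?_) fun a b ha => ?_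
    · have hl0 : 0 ≤ |Real.log τ| ^ (-α) := by positivity
      have key : ∀ κ : ℝ, |κ| ≤ |κ0| + |κinf| →
          |iteratedDeriv m ((Ioi 0).indicator h) τ * τ ^ (m + 1) -
            (-1) ^ m * m.factorial * (κ * |Real.log τ| ^ (-α))| ≤ 1 * |Real.log τ| ^ (-α) →
          |iteratedDeriv m ((Ioi 0).indicator h) τ * τ ^ (m + 1)| ≤
            (m.factorial * (|κ0| + |κinf|) + 1) * |Real.log τ| ^ (-α) := by
        intro κ hκ hle
        have e : |(-1) ^ m * m.factorial * (κ * |Real.log τ| ^ (-α))| =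
            m.factorial * |κ| * |Real.log τ| ^ (-α) := by
          rw [abs_mul, abs_mul, abs_mul, abs_pow, abs_neg, abs_one, one_pow, one_mul,
            abs_of_nonneg hl0, abs_of_nonneg (Nat.cast_nonneg _)]
          ring
        have h2 := abs_sub_abs_le_abs_sub (iteratedDeriv m ((Ioi 0).indicator h) τ * τ ^ (m + 1))
          ((-1) ^ m * m.factorial * (κ * |Real.log τ| ^ (-α)))
        have h3 : m.factorial * |κ| * |Real.log τ| ^ (-α) ≤
            m.factorial * (|κ0| + |κinf|) * |Real.log τ| ^ (-α) := by gcongr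
        linarith
      rcases le_abs'.1 hX with h | h
      · exact key κ0 (by linarith [abs_nonneg κinf])
          (h0 τ hτ (by linarith [le_max_right X1 X0]))
      · exact key κinf (by linarith [abs_nonneg κ0]) (h1 τ hτ ((le_max_left _ _).trans h))
    · have hco : ContinuousOn (fun τ => iteratedDeriv m ((Ioi 0).indicator h) τ * τ ^ (m + 1))
          (Icc a b) := by
        have h2 : ContinuousOn (iteratedDeriv m ((Ioi 0).indicator h)) (Ioi 0) :=
          (hsm.continuousOn_iteratedDerivWithin (by exact_mod_cast hm)
            isOpen_Ioi.uniqueDiffOn).congr fun t ht => (iteratedDerivWithin_of_isOpen isOpen_Ioi ht).symm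
        exact (h2.mono fun t ht => ha.trans_le ht.1).mul (continuous_pow _).continuousOn
      obtain ⟨M, hM⟩ := isCompact_Icc.exists_bound_of_continuousOn hco
      exact ⟨M, hM⟩
  obtain ⟨C0, hC0, hb0⟩ := hbd 0 (Nat.zero_le _)
  obtain ⟨C1, hC1, hb1⟩ := hbd N le_rfl
  refine ⟨C0 + C1, hN, hαN, ?_, hsm, ?_, ?_, ?_⟩
  · classical
    rw [← piecewise_eq_indicator]
    exact hh.continuousOn.measurable_piecewise continuous_zero.continuousOn measurableSet_Ioi
  · intro τ hτ m hm
    have hp : 0 < (1 + |Real.log τ|) ^ (-α) := by positivity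
    have hab : |iteratedDeriv m ((Ioi 0).indicator h) τ| * τ ^ (m + 1) =
        |iteratedDeriv m ((Ioi 0).indicator h) τ * τ ^ (m + 1)| := by
      rw [abs_mul, abs_of_pos (by positivity : 0 < τ ^ (m + 1))]
    rw [hab]
    rcases hm with rfl | rfl
    · exact (hb0 τ hτ).trans (mul_le_mul_of_nonneg_right (by linarith) hp.le)
    · exact (hb1 τ hτ).trans (mul_le_mul_of_nonneg_right (by linarith) hp.le)
  · intro η hη
    obtain ⟨X0, h0⟩ := ainf η hη 0 (Nat.zero_le _)
    obtain ⟨X1, h1⟩ := ainf η hη N le_rfl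
    refine ⟨max X0 X1, fun τ hτ hX m hm => ?_⟩
    rcases hm with rfl | rfl
    · exact h0 τ hτ ((le_max_left _ _).trans hX)
    · exact h1 τ hτ ((le_max_right _ _).trans hX)
  · intro η hη
    obtain ⟨X0, h0⟩ := azero η hη 0 (Nat.zero_le _)
    obtain ⟨X1, h1⟩ := azero η hη N le_rfl
    refine ⟨max X0 X1, fun τ hτ hX m hm => ?_⟩
    rcases hm with rfl | rfl
    · exact h0 τ hτ (by linarith [le_max_left X0 X1])
    · exact h1 τ hτ (by linarith [le_max_right X0 X1])

end ModelKernel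

section HilbertSchmidt

/-- The kernel of the rank one operator `⟪u, ·⟫ u`. -/
def tensK (u : HSp) (z : ℝ × ℝ) : ℂ := u z.1 * (starRingEnd ℂ) (u z.2)

theorem memLp_tensK (u : HSp) : MemLp (tensK u) 2 (muP.prod muP) := by
  have hu : MemLp (u : ℝ → ℂ) 2 muP := Lp.memLp u
  have hm : AEStronglyMeasurable (tensK u) (muP.prod muP) :=
    hu.aestronglyMeasurable.comp_fst.mul
      (Complex.continuous_conj.comp_aestronglyMeasurable hu.aestronglyMeasurable.comp_snd)
  rw [memLp_two_iff_integrable_sq_norm hm]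
  have h2 := (memLp_two_iff_integrable_sq_norm hu.aestronglyMeasurable).1 hu
  refine (h2.mul_prod h2).congr (Eventually.of_forall fun z => ?_)
  simp only [tensK, norm_mul, RCLike.norm_conj, mul_pow]

theorem inner_tensK (u v : HSp) :
    inner ℂ (memLp_tensK u).toLp (memLp_tensK v).toLp = inner ℂ u v * inner ℂ v u := by
  rw [L2.inner_def, L2.inner_def, L2.inner_def, ← integral_prod_mul]
  refine integral_congr_ae ?_
  filter_upwards [(memLp_tensK u).coeFn_toLp, (memLp_tensK v).coeFn_toLp] with z h1 h2
  rw [h1, h2]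
  simp only [RCLike.inner_apply, tensK, map_mul, Complex.conj_conj]
  ring

theorem form_eq_inner_tensK {k : ℝ → ℝ → ℝ}
    (hk : MemLp (fun z : ℝ × ℝ => (k z.1 z.2 : ℂ)) 2 (muP.prod muP)) (u : HSp) :
    form k u = inner ℂ (memLp_tensK u).toLp hk.toLp := by
  rw [L2.inner_def, form]
  refine integral_congr_ae ?_
  filter_upwards [(memLp_tensK u).coeFn_toLp, hk.coeFn_toLp] with z h1 h2
  rw [h1, h2]
  simp only [RCLike.inner_apply, tensK, map_mul, Complex.conj_conj]
  ring

theorem card_mul_sq_le {k : ℝ → ℝ → ℝ}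
    (hk : MemLp (fun z : ℝ × ℝ => (k z.1 z.2 : ℂ)) 2 (muP.prod muP)) {β : ℝ} (hβ : 0 < β)
    {S : Finset HSp} (hS : Orthonormal ℂ fun v : S => (v : HSp))
    (hlarge : ∀ v ∈ S, β ≤ ‖form k v‖) : (S.card : ℝ) * β ^ 2 ≤ ‖hk.toLp‖ ^ 2 := by
  classical
  have ho : Orthonormal ℂ fun v : S => (memLp_tensK (v : HSp)).toLp := by
    rw [orthonormal_iff_ite] at hS ⊢
    intro i j
    have h1 := hS i j
    have h2 := hS j i
    rw [inner_tensK, h1, h2]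
    by_cases hij : i = j
    · simp [hij]
    · simp [hij]
  have h1 := ho.sum_inner_products_le (s := Finset.univ) hk.toLp
  refine le_trans ?_ h1
  have h2 : ∑ i : S, β ^ 2 = (S.card : ℝ) * β ^ 2 := by simp
  rw [← h2]
  refine Finset.sum_le_sum fun i _ => ?_
  rw [← form_eq_inner_tensK]
  exact pow_le_pow_left₀ hβ.le (hlarge i i.2) 2

theorem form_const_smul (k : ℝ → ℝ → ℝ) (c : ℂ) (u : HSp) :
    form k (c • u : HSp) = (‖c‖ ^ 2 : ℝ) * form k u := by
  rw [form, form, ← integral_const_mul]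
  refine integral_congr_ae ?_
  have h1 := Lp.coeFn_smul c u
  have e1 := Measure.quasiMeasurePreserving_fst (μ := muP) (ν := muP) |>.ae h1
  have e2 := Measure.quasiMeasurePreserving_snd (μ := muP) (ν := muP) |>.ae h1
  filter_upwards [e1, e2] with z h1 h2
  rw [h1, h2]
  simp only [Pi.smul_apply, smul_eq_mul, map_mul]
  have : ((‖c‖ ^ 2 : ℝ) : ℂ) = c * (starRingEnd ℂ) c := by
    rw [Complex.mul_conj, Complex.normSq_eq_norm_sq]
  rw [this]
  ring

theorem smallForm_of_memLp {k : ℝ → ℝ → ℝ}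
    (hk : MemLp (fun z : ℝ × ℝ => (k z.1 z.2 : ℂ)) 2 (muP.prod muP)) {β : ℝ} (hβ : 0 < β) :
    SmallForm (‖hk.toLp‖ ^ 2 / β ^ 2) β fun u => form k u := by
  classical
  let P : ℕ → Prop := fun n => ∃ S : Finset HSp, S.card = n ∧
    (Orthonormal ℂ fun v : S => (v : HSp)) ∧ ∀ v ∈ S, β ≤ ‖form k v‖
  have hP0 : P 0 := ⟨∅, by simp, ⟨by simp, fun i => absurd i.2 (Finset.notMem_empty _)⟩, by simp⟩
  have hcard : ∀ n, P n → (n : ℝ) ≤ ‖hk.toLp‖ ^ 2 / β ^ 2 := by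
    rintro n ⟨S, rfl, h1, h2⟩
    rw [le_div_iff₀ (by positivity)]
    exact card_mul_sq_le hk hβ h1 h2
  obtain ⟨B, hB⟩ := exists_nat_ge (‖hk.toLp‖ ^ 2 / β ^ 2)
  have hPB : ∀ n, P n → n ≤ B := fun n hn => by exact_mod_cast (hcard n hn).trans hB
  have hmax := Nat.findGreatest_spec (P := P) (Nat.zero_le B) hP0
  set n := Nat.findGreatest P B with hn
  obtain ⟨S, hSn, hS1, hS2⟩ := id hmax
  refine ⟨S, by rw [hSn]; exact hcard n hmax, fun u hu => ?_⟩
  by_contra! hlt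
  have hu0 : u ≠ 0 := by
    rintro rfl
    have := form_const_smul k 0 (0 : HSp)
    rw [zero_smul] at this
    rw [this] at hlt
    simp at hlt
  have hnu : 0 < ‖u‖ := norm_pos_iff.2 hu0
  set w : HSp := ((‖u‖⁻¹ : ℝ) : ℂ) • u with hw
  have hwn : ‖w‖ = 1 := by
    rw [hw, norm_smul, Complex.norm_real, norm_inv, norm_norm, inv_mul_cancel₀ hnu.ne']
  have hwf : β ≤ ‖form k w‖ := by
    rw [hw, form_const_smul, norm_mul, Complex.norm_real, Complex.norm_real]
    simp only [norm_pow, norm_inv, norm_norm]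
    rw [inv_pow, inv_mul_eq_div, le_div_iff₀ (by positivity)]
    exact hlt.le
  have hws : ∀ v ∈ S, inner ℂ v w = 0 := fun v hv => by
    rw [hw, inner_smul_right, hu v hv, mul_zero]
  have hwS : w ∉ S := fun h => by
    have := hws w h
    rw [inner_self_eq_zero] at this
    rw [this, norm_zero] at hwn
    exact zero_ne_one hwn
  have hnext : P (n + 1) := by
    refine ⟨insert w S, by rw [Finset.card_insert_of_notMem hwS, hSn], ⟨?_, ?_⟩, ?_⟩
    · rintro ⟨v, hv⟩
      rcases Finset.mem_insert.1 hv with rfl | hv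
      · exact hwn
      · exact hS1.1 ⟨v, hv⟩
    · rintro ⟨v, hv⟩ ⟨v', hv'⟩ hne
      have hne' : v ≠ v' := fun h => hne (Subtype.ext h)
      change inner ℂ v v' = 0
      rcases Finset.mem_insert.1 hv with h1 | h1 <;> rcases Finset.mem_insert.1 hv' with h2 | h2
      · exact absurd (h1.trans h2.symm) hne'
      · rw [h1, inner_eq_zero_symm]; exact hws v' h2
      · rw [h2]; exact hws v h1
      · exact hS1.2 (i := ⟨v, h1⟩) (j := ⟨v', h2⟩) fun h => hne' (congrArg Subtype.val h)
    · intro v hv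
      rcases Finset.mem_insert.1 hv with rfl | hv
      · exact hwf
      · exact hS2 v hv
  have := Nat.le_findGreatest (hPB _ hnext) hnext
  omega

end HilbertSchmidt

section HankelHilbertSchmidt

theorem lintegral_add_kernel {G : ℝ → ENNReal} (hG : Measurable G) :
    ∫⁻ z : ℝ × ℝ, G (z.1 + z.2) ∂(muP.prod muP) =
      ∫⁻ x : ℝ, ENNReal.ofReal (Real.exp x) *
        (ENNReal.ofReal (Real.exp x) * G (Real.exp x)) := by
  have hm : Measurable fun z : ℝ × ℝ => G (z.1 + z.2) :=
    hG.comp (measurable_fst.add measurable_snd)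
  have hin : ∀ t : ℝ, ∫⁻ s, G (t + s) ∂muP = ∫⁻ τ, (Ioi t).indicator G τ := by
    intro t
    rw [← lintegral_add_left_eq_self (μ := volume) _ t, ← lintegral_indicator measurableSet_Ioi]
    refine lintegral_congr fun s => ?_
    by_cases hs : 0 < s
    · rw [indicator_of_mem (show s ∈ Ioi (0:ℝ) from hs),
        indicator_of_mem (show t + s ∈ Ioi t by simpa using hs)]
    · rw [indicator_of_notMem (show s ∉ Ioi (0:ℝ) from hs),
        indicator_of_notMem (show t + s ∉ Ioi t by simpa using hs)]
  have hmi : Measurable (Function.uncurry fun t τ : ℝ => (Ioi t).indicator G τ) := by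
    have : (Function.uncurry fun t τ : ℝ => (Ioi t).indicator G τ) =
        {z : ℝ × ℝ | z.1 < z.2}.indicator fun z => G z.2 := by
      ext ⟨t, τ⟩
      by_cases h : t < τ <;> simp [Function.uncurry, indicator, h]
    rw [this]
    exact (hG.comp measurable_snd).indicator (measurableSet_lt measurable_fst measurable_snd)
  have hout : ∀ τ : ℝ, ∫⁻ t, (Ioi t).indicator G τ ∂muP = ENNReal.ofReal τ * G τ := by
    intro τ
    have : ∀ t : ℝ, (Ioi t).indicator G τ = (Iio τ).indicator (fun _ => G τ) t := by
      intro t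
      by_cases h : t < τ <;> simp [indicator, h]
    simp_rw [this]
    rw [lintegral_indicator measurableSet_Iio, setLIntegral_const,
      Measure.restrict_apply measurableSet_Iio, Iio_inter_Ioi, Real.volume_Ioo, sub_zero, mul_comm]
  rw [lintegral_prod _ hm.aemeasurable]
  simp_rw [hin]
  rw [lintegral_lintegral_swap hmi.aemeasurable]
  simp_rw [hout]
  have him : Ioi (0:ℝ) = Real.exp '' univ := by rw [image_univ, Real.range_exp]
  have h1 : ∫⁻ τ : ℝ, ENNReal.ofReal τ * G τ = ∫⁻ τ in Ioi (0:ℝ), ENNReal.ofReal τ * G τ := by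
    rw [← lintegral_indicator measurableSet_Ioi]
    refine lintegral_congr fun τ => ?_
    by_cases h : 0 < τ
    · rw [indicator_of_mem (show τ ∈ Ioi (0:ℝ) from h)]
    · rw [indicator_of_notMem (show τ ∉ Ioi (0:ℝ) from h),
        ENNReal.ofReal_of_nonpos (not_lt.1 h), zero_mul]
  rw [h1, him, lintegral_image_eq_lintegral_abs_deriv_mul MeasurableSet.univ
      (fun x _ => (Real.hasDerivAt_exp x).hasDerivWithinAt) Real.exp_injective.injOn]
  simp_rw [abs_of_pos (Real.exp_pos _)]
  rw [setLIntegral_univ]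

theorem lintegral_add_kernel_sq {r : ℝ → ℝ} (hr : Measurable r) :
    ∫⁻ z : ℝ × ℝ, ENNReal.ofReal (r (z.1 + z.2) ^ 2) ∂(muP.prod muP) =
      ∫⁻ x : ℝ, ENNReal.ofReal ((Real.exp x * r (Real.exp x)) ^ 2) := by
  rw [lintegral_add_kernel (G := fun τ => ENNReal.ofReal (r τ ^ 2))
    (hr.pow_const 2).ennreal_ofReal]
  refine lintegral_congr fun x => ?_
  rw [← ENNReal.ofReal_mul (Real.exp_pos x).le, ← ENNReal.ofReal_mul (Real.exp_pos x).le]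
  congr 1
  ring

theorem smallForm_of_lintegral {r : ℝ → ℝ} (hr : Measurable r) {K β : ℝ} (hK : 0 ≤ K)
    (hβ : 0 < β)
    (hle : ∫⁻ x : ℝ, ENNReal.ofReal ((Real.exp x * r (Real.exp x)) ^ 2) ≤ ENNReal.ofReal K) :
    SmallForm (K / β ^ 2) β fun u => form (fun t s => r (t + s)) u := by
  have hm : Measurable fun z : ℝ × ℝ => r (z.1 + z.2) := measurable_add_kernel hr
  rw [← lintegral_add_kernel_sq hr] at hle
  have hint : Integrable (fun z : ℝ × ℝ => r (z.1 + z.2) ^ 2) (muP.prod muP) := by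
    refine ⟨(hm.pow_const 2).aestronglyMeasurable, ?_⟩
    rw [hasFiniteIntegral_iff_ofReal (Eventually.of_forall fun z => sq_nonneg _)]
    exact hle.trans_lt ENNReal.ofReal_lt_top
  have hmem : MemLp (fun z : ℝ × ℝ => ((r (z.1 + z.2) : ℝ) : ℂ)) 2 (muP.prod muP) := by
    have hmc : AEStronglyMeasurable (fun z : ℝ × ℝ => ((r (z.1 + z.2) : ℝ) : ℂ))
        (muP.prod muP) := (Complex.measurable_ofReal.comp hm).aestronglyMeasurable
    rw [memLp_two_iff_integrable_sq_norm hmc]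
    refine hint.congr (Eventually.of_forall fun z => ?_)
    simp only [Complex.norm_real, Real.norm_eq_abs, sq_abs]
  have hn : ‖hmem.toLp‖ ^ 2 ≤ K := by
    have h1 : (‖hmem.toLp‖ ^ 2 : ℝ) = (inner ℂ hmem.toLp hmem.toLp).re :=
      (inner_self_eq_norm_sq (𝕜 := ℂ) _).symm
    have h2 : inner ℂ hmem.toLp hmem.toLp =
        ∫ z : ℝ × ℝ, ((r (z.1 + z.2) ^ 2 : ℝ) : ℂ) ∂(muP.prod muP) := by
      rw [L2.inner_def]
      refine integral_congr_ae ?_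
      filter_upwards [hmem.coeFn_toLp] with z hz
      rw [hz, RCLike.inner_apply, Complex.conj_ofReal]
      push_cast
      ring
    rw [h1, h2, integral_complex_ofReal, Complex.ofReal_re,
      integral_eq_lintegral_of_nonneg_ae (Eventually.of_forall fun z => sq_nonneg _)
        (hm.pow_const 2).aestronglyMeasurable]
    exact ENNReal.toReal_le_of_le_ofReal hK hle
  obtain ⟨S, hS1, hS2⟩ := smallForm_of_memLp (k := fun t s => r (t + s)) hmem hβ
  exact ⟨S, hS1.trans (div_le_div_of_nonneg_right hn (by positivity)), hS2⟩

theorem lintegral_log_weight_le {α C δ R X : ℝ} (hα : α < 1 / 2) (hδ : 0 < δ) (hR : 0 < R)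
    (hX : 0 < X) {F : ℝ → ℝ} (h1 : ∀ x, |x| ≤ R → F x ≤ C ^ 2)
    (h2 : ∀ x, R ≤ |x| → |x| ≤ X → F x ≤ δ ^ 2 * |x| ^ (-(2 * α))) (h3 : ∀ x, X < |x| → F x ≤ 0) :
    ∫⁻ x, ENNReal.ofReal (F x) ≤
      ENNReal.ofReal (2 * (C ^ 2 * R + δ ^ 2 * (X ^ (1 - 2 * α) / (1 - 2 * α)))) := by
  set Φ : ℝ → ℝ := fun y => (Iic R).indicator (fun _ => C ^ 2) y +
    (Iic X).indicator (fun y => δ ^ 2 * |y| ^ (-(2 * α))) y with hΦ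
  have hc : 0 < 1 - 2 * α := by linarith
  have e1 : IntegrableOn ((Iic R).indicator fun _ : ℝ => C ^ 2) (Ioi 0) := by
    rw [integrableOn_indicator_iff measurableSet_Iic, inter_comm, Ioi_inter_Iic]
    exact integrableOn_const (by simp)
  have e2' : IntegrableOn (fun y : ℝ => δ ^ 2 * |y| ^ (-(2 * α))) (Ioc 0 X) := by
    have := (intervalIntegral.intervalIntegrable_rpow' (a := 0) (b := X)
      (by linarith : -1 < -(2 * α))).const_mul (δ ^ 2)
    rw [intervalIntegrable_iff_integrableOn_Ioc_of_le hX.le] at this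
    exact this.congr_fun (fun y hy => by simp only [abs_of_pos hy.1]) measurableSet_Ioc
  have e2 : IntegrableOn ((Iic X).indicator fun y : ℝ => δ ^ 2 * |y| ^ (-(2 * α))) (Ioi 0) := by
    rw [integrableOn_indicator_iff measurableSet_Iic, inter_comm, Ioi_inter_Iic]
    exact e2'
  have hI : ∫ y in Ioi (0:ℝ), Φ y = C ^ 2 * R + δ ^ 2 * (X ^ (1 - 2 * α) / (1 - 2 * α)) := by
    rw [hΦ, integral_add e1 e2, setIntegral_indicator measurableSet_Iic,
      setIntegral_indicator measurableSet_Iic, Ioi_inter_Iic, Ioi_inter_Iic, setIntegral_const]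
    congr 1
    · simp [hR.le, mul_comm]
    · rw [setIntegral_congr_fun (g := fun y => δ ^ 2 * y ^ (-(2 * α))) measurableSet_Ioc
        (fun y hy => by simp only [abs_of_pos hy.1]), ← intervalIntegral.integral_of_le hX.le,
        intervalIntegral.integral_const_mul, integral_rpow (Or.inl (by linarith)),
        show -(2 * α) + 1 = 1 - 2 * α by ring, Real.zero_rpow hc.ne', sub_zero]
  have hJ : ∫ x, Φ |x| = 2 * (C ^ 2 * R + δ ^ 2 * (X ^ (1 - 2 * α) / (1 - 2 * α))) := by
    rw [integral_comp_abs, hI]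
  have hpos : 0 < 2 * (C ^ 2 * R + δ ^ 2 * (X ^ (1 - 2 * α) / (1 - 2 * α))) := by positivity
  have hint : Integrable fun x : ℝ => Φ |x| := by
    by_contra h
    rw [integral_undef h] at hJ
    exact hpos.ne hJ
  have hnn : ∀ x : ℝ, 0 ≤ Φ |x| := fun x =>
    add_nonneg (indicator_nonneg (fun _ _ => sq_nonneg C) _)
      (indicator_nonneg (fun _ _ => by positivity) _)
  rw [← hJ, ofReal_integral_eq_lintegral_ofReal hint (Eventually.of_forall hnn)]
  refine lintegral_mono fun x => ENNReal.ofReal_le_ofReal ?_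
  rcases lt_or_ge X |x| with hx | hx
  · exact (h3 x hx).trans (hnn x)
  · have i2 : (Iic X).indicator (fun y => δ ^ 2 * |y| ^ (-(2 * α))) |x| =
        δ ^ 2 * |x| ^ (-(2 * α)) := by
      rw [indicator_of_mem (show |x| ∈ Iic X from hx), abs_abs]
    rcases le_total |x| R with hxR | hxR
    · have i1 : (Iic R).indicator (fun _ => C ^ 2) |x| = C ^ 2 :=
        indicator_of_mem (show |x| ∈ Iic R from hxR) _
      simp only [hΦ]
      rw [i1, i2]
      have : 0 ≤ δ ^ 2 * |x| ^ (-(2 * α)) := by positivity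
      linarith [h1 x hxR]
    · simp only [hΦ]
      rw [i2]
      have : 0 ≤ (Iic R).indicator (fun _ => C ^ 2) |x| :=
        indicator_nonneg (fun _ _ => sq_nonneg C) _
      linarith [h2 x hxR hx]

end HankelHilbertSchmidt

section Remainder

theorem negligible_remainder {α : ℝ} (hα0 : 0 < α) (hα : α < 1 / 2) {r : ℝ → ℝ}
    (hr : Measurable r) {C : ℝ} (hC : 0 ≤ C) (hb : ∀ τ, 0 < τ → |r τ| * τ ≤ C)
    (hs : ∀ ε, 0 < ε → ∃ R, ∀ τ, 0 < τ → R ≤ |Real.log τ| → |r τ| * τ ≤ ε * |Real.log τ| ^ (-α)) :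
    Negligible α fun u => form (fun t s => r (t + s)) u := by
  intro ε hε
  have hc : 0 < 1 - 2 * α := by linarith
  obtain ⟨δ, hδ, hδ1, hδ2⟩ : ∃ δ, 0 < δ ∧ δ ≤ ε / 16 ∧ δ ^ 2 ≤ ε ^ 3 * (1 - 2 * α) / 16 := by
    refine ⟨min (ε / 16) (√(ε ^ 3 * (1 - 2 * α) / 16)), by positivity, min_le_left _ _, ?_⟩
    have h1 : min (ε / 16) (√(ε ^ 3 * (1 - 2 * α) / 16)) ≤ √(ε ^ 3 * (1 - 2 * α) / 16) :=
      min_le_right _ _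
    have h2 := pow_le_pow_left₀ (by positivity) h1 2
    rwa [Real.sq_sqrt (by positivity)] at h2
  obtain ⟨R, hR⟩ := hs δ hδ
  set R' := max R 1 with hR'
  have hR'0 : 0 < R' := lt_max_of_lt_right one_pos
  have hp : 2 < 1 / α := by rw [lt_div_iff₀ hα0]; linarith
  filter_upwards [self_mem_nhdsWithin,
    eventually_mul_rpow_le hp (8 * C ^ 2 * R' / ε ^ 2) (by positivity : 0 < ε / 2),
    eventually_mul_rpow_le (by positivity : 0 < 1 / α) R' one_pos] with θ hθ h1 hRX
  have hθ : 0 < θ := hθ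
  rw [neg_zero, Real.rpow_zero, mul_one, one_mul] at hRX
  set X := θ ^ (-(1 / α)) with hX
  have hX0 : 0 < X := by positivity
  have hXα : X ^ (-α) = θ := by
    rw [hX, ← Real.rpow_mul hθ.le, show -(1 / α) * -α = 1 by field_simp, Real.rpow_one]
  have hXc : X ^ (1 - 2 * α) = X * θ ^ 2 := by
    rw [show 1 - 2 * α = 1 + (-α) * 2 by ring, Real.rpow_add hX0, Real.rpow_one,
      Real.rpow_mul hX0.le, hXα]
    norm_num
  set B : Set ℝ := {τ | |Real.log τ| ≤ X} with hB
  have hBm : MeasurableSet B := measurableSet_le (Real.measurable_log.abs) measurable_const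
  set r1 := B.indicator r with hr1
  set r2 := Bᶜ.indicator r with hr2
  have hr1m : Measurable r1 := hr.indicator hBm
  have hr2m : Measurable r2 := hr.indicator hBm.compl
  have hle1 : ∀ τ, |r1 τ| ≤ |r τ| := fun τ => by
    by_cases h : τ ∈ B <;> simp [hr1, h]
  have hb1 : ∀ τ, 0 < τ → |r1 τ| * τ ≤ C := fun τ hτ =>
    (mul_le_mul_of_nonneg_right (hle1 τ) hτ.le).trans (hb τ hτ)
  have hb2 : ∀ τ, 0 < τ → |r2 τ| * τ ≤ δ * θ := fun τ hτ => by
    by_cases h : τ ∈ B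
    · have : r2 τ = 0 := by simp [hr2, h]
      rw [this, abs_zero, zero_mul]
      positivity
    · have e : r2 τ = r τ := by simp [hr2, h]
      have hx1 : X < |Real.log τ| := not_le.1 h
      rw [e]
      refine (hR τ hτ ((le_max_left _ _).trans (hRX.trans hx1.le))).trans (mul_le_mul_of_nonneg_left ?_ hδ.le)
      rw [← hXα]
      exact Real.rpow_le_rpow_of_nonpos hX0 hx1.le (by linarith)
  have hk1 : ∀ t s, 0 < t → 0 < s → |r1 (t + s)| ≤ (C + δ * θ) * gK 0 t s := fun t s ht hs =>
    abs_add_kernel_le (by positivity)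
      (fun τ hτ => (hb1 τ hτ).trans (le_add_of_nonneg_right (by positivity))) ht hs
  have hk2 : ∀ t s, 0 < t → 0 < s → |r2 (t + s)| ≤ (C + δ * θ) * gK 0 t s := fun t s ht hs =>
    abs_add_kernel_le (by positivity)
      (fun τ hτ => (hb2 τ hτ).trans (le_add_of_nonneg_left hC)) ht hs
  have hsum : ∀ u : HSp, form (fun t s => r (t + s)) u =
      form (fun t s => r1 (t + s)) u + form (fun t s => r2 (t + s)) u := fun u => by
    rw [← form_add (k := fun t s => r1 (t + s)) (l := fun t s => r2 (t + s))
      (measurable_add_kernel hr1m) (measurable_add_kernel hr2m) hk1 hk2 (Lp.memLp u)]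
    congr 1
    ext t s
    exact (congrFun (indicator_self_add_compl B r) (t + s)).symm
  have hS2 : SmallForm 0 (ε / 2 * θ) fun u => form (fun t s => r2 (t + s)) u := by
    refine ⟨∅, by simp, fun u _ => ?_⟩
    have := norm_form_le (k := fun t s => r2 (t + s)) (a := 0) (by positivity : 0 ≤ δ * θ)
      (fun t s ht hs => abs_add_kernel_le (by positivity) hb2 ht hs) (Lp.memLp u)
    rw [sqN_eq] at this
    refine this.trans (mul_le_mul_of_nonneg_right ?_ (by positivity))
    nlinarith
  have hF := lintegral_log_weight_le (C := C) hα hδ hR'0 hX0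
    (F := fun x => (Real.exp x * r1 (Real.exp x)) ^ 2) ?_ ?_ ?_
  · have hS1 := smallForm_of_lintegral hr1m (by positivity)
      (by positivity : 0 < ε / 2 * θ) hF
    obtain ⟨S, hS, hSu⟩ := hS1.add hS2
    refine ⟨S, hS.trans ?_, fun u hu => ?_⟩
    · have e2 : θ ^ (-(2:ℝ)) = (θ ^ 2)⁻¹ := by
        rw [Real.rpow_neg hθ.le]; norm_num
      rw [e2] at h1
      rw [hXc]
      have e : 2 * (C ^ 2 * R' + δ ^ 2 * (X * θ ^ 2 / (1 - 2 * α))) / (ε / 2 * θ) ^ 2 + 0 =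
          8 * C ^ 2 * R' / ε ^ 2 * (θ ^ 2)⁻¹ + δ ^ 2 * (8 / (ε ^ 2 * (1 - 2 * α))) * X := by
        field_simp
        ring
      have h3 : δ ^ 2 * (8 / (ε ^ 2 * (1 - 2 * α))) ≤ ε / 2 := by
        calc _ ≤ ε ^ 3 * (1 - 2 * α) / 16 * (8 / (ε ^ 2 * (1 - 2 * α))) :=
              mul_le_mul_of_nonneg_right hδ2 (by positivity)
          _ = ε / 2 := by field_simp; norm_num
      rw [e]
      nlinarith [mul_le_mul_of_nonneg_right h3 hX0.le]
    · change ‖form (fun t s => r (t + s)) u‖ ≤ _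
      rw [hsum u]
      refine (hSu u hu).trans (le_of_eq ?_)
      ring
  · intro x hx
    have := hb1 (Real.exp x) (Real.exp_pos x)
    rw [← sq_abs, abs_mul, abs_of_pos (Real.exp_pos x), mul_comm]
    exact pow_le_pow_left₀ (by positivity) this 2
  · intro x hxR hxX
    have hx0 : 0 < |x| := hR'0.trans_le hxR
    have h2 := hR (Real.exp x) (Real.exp_pos x)
      (by rw [Real.log_exp]; exact (le_max_left _ _).trans hxR)
    have h3 := (mul_le_mul_of_nonneg_right (hle1 (Real.exp x)) (Real.exp_pos x).le).trans h2
    rw [Real.log_exp] at h3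
    change (Real.exp x * r1 (Real.exp x)) ^ 2 ≤ _
    rw [← sq_abs, abs_mul, abs_of_pos (Real.exp_pos x), mul_comm]
    refine (pow_le_pow_left₀ (by positivity) h3 2).trans (le_of_eq ?_)
    rw [mul_pow, ← Real.rpow_natCast (|x| ^ (-α)) 2, ← Real.rpow_mul hx0.le]
    congr 2
    push_cast
    ring
  · intro x hx
    have hxB : Real.exp x ∉ B := fun h => by
      rw [hB, mem_ofPred_eq, Real.log_exp] at h
      exact absurd h (not_le.2 hx)
    have h0 : r1 (Real.exp x) = 0 := indicator_of_notMem hxB r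
    change (Real.exp x * r1 (Real.exp x)) ^ 2 ≤ 0
    rw [h0]
    norm_num

end Remainder

section Assembly

/-- A smooth kernel on `(0, ∞)` that coincides with the logarithmic model near both ends. -/
def modelKernel (α κ0 κinf t : ℝ) : ℝ :=
  κinf * (Real.smoothTransition (1 * Real.log t - 1) * (t⁻¹ * (1 * Real.log t) ^ (-α))) +
    κ0 * (Real.smoothTransition (-1 * Real.log t - 1) * (t⁻¹ * (-1 * Real.log t) ^ (-α)))

theorem contDiffAt_cutoff_model (α σ : ℝ) (n : ℕ) {t : ℝ} (ht : 0 < t) :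
    ContDiffAt ℝ n (fun t => Real.smoothTransition (σ * Real.log t - 1) *
      (t⁻¹ * (σ * Real.log t) ^ (-α))) t := by
  have hlog : ContDiffAt ℝ n (fun t => σ * Real.log t - 1) t :=
    (contDiffAt_const.mul (contDiffAt_id.log ht.ne')).sub contDiffAt_const
  rcases lt_or_ge 0 (σ * Real.log t) with h | h
  · exact (Real.smoothTransition.contDiffAt.comp t hlog).mul (contDiffAt_model α σ n ht h)
  · have hev : (fun t => Real.smoothTransition (σ * Real.log t - 1) *
        (t⁻¹ * (σ * Real.log t) ^ (-α))) =ᶠ[nhds t] fun _ => 0 := by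
      have h1 : σ * Real.log t - 1 < 0 := by linarith
      filter_upwards [hlog.continuousAt.eventually (gt_mem_nhds h1)] with s hs
      rw [Real.smoothTransition.zero_of_nonpos hs.le, zero_mul]
    exact contDiffAt_const.congr_of_eventuallyEq hev

theorem contDiffOn_modelKernel (α κ0 κinf : ℝ) (n : ℕ) :
    ContDiffOn ℝ n (modelKernel α κ0 κinf) (Ioi 0) := fun _ ht =>
  ((contDiffAt_const.mul (contDiffAt_cutoff_model α 1 n ht)).add
    (contDiffAt_const.mul (contDiffAt_cutoff_model α (-1) n ht))).contDiffWithinAt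

theorem modelKernel_of_two_le (α κ0 κinf : ℝ) {t : ℝ} (ht : 2 ≤ Real.log t) :
    modelKernel α κ0 κinf t = κinf * (t⁻¹ * (1 * Real.log t) ^ (-α)) := by
  rw [modelKernel, Real.smoothTransition.one_of_one_le (by linarith),
    Real.smoothTransition.zero_of_nonpos (by linarith)]
  ring

theorem modelKernel_of_le_neg_two (α κ0 κinf : ℝ) {t : ℝ} (ht : Real.log t ≤ -2) :
    modelKernel α κ0 κinf t = κ0 * (t⁻¹ * (-1 * Real.log t) ^ (-α)) := by
  rw [modelKernel, Real.smoothTransition.one_of_one_le (x := -1 * Real.log t - 1) (by linarith),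
    Real.smoothTransition.zero_of_nonpos (by linarith)]
  ring

theorem isLittleO_iteratedDerivWithin_of_eventually_zero {g w : ℝ → ℝ} {l : Filter ℝ} (m : ℕ)
    (h : ∀ᶠ t in l, 0 < t ∧ ∀ᶠ s in nhds t, g s = 0) :
    iteratedDerivWithin m g (Ioi 0) =o[l] w := by
  refine (isLittleO_zero w l).congr' ?_ EventuallyEq.rfl
  filter_upwards [h] with t ht
  have h1 : g =ᶠ[nhds t] fun _ => 0 := ht.2
  rw [iteratedDerivWithin_of_isOpen isOpen_Ioi ht.1, h1.iteratedDeriv_eq m]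
  simp

theorem exists_reg_modelKernel {α : ℝ} (hα : 0 < α) (hα1 : α < 1) (κ0 κinf : ℝ) :
    ∃ C, Reg 1 α κ0 κinf C ((Ioi 0).indicator (modelKernel α κ0 κinf)) := by
  refine exists_reg hα le_rfl (by exact_mod_cast hα1) (contDiffOn_modelKernel α κ0 κinf 1)
    (fun m _ => isLittleO_iteratedDerivWithin_of_eventually_zero m ?_)
    (fun m _ => isLittleO_iteratedDerivWithin_of_eventually_zero m ?_)
  · filter_upwards [self_mem_nhdsWithin,
      Real.tendsto_log_nhdsGT_zero.eventually (eventually_lt_atBot (-2))] with t ht hl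
    refine ⟨ht, ?_⟩
    filter_upwards [(Real.continuousAt_log (ne_of_gt ht)).eventually (gt_mem_nhds hl)] with s hs
    rw [modelKernel_of_le_neg_two α κ0 κinf hs.le, sub_self]
  · filter_upwards [eventually_gt_atTop 0,
      Real.tendsto_log_atTop.eventually (eventually_gt_atTop 2)] with t ht hl
    refine ⟨ht, ?_⟩
    filter_upwards [(Real.continuousAt_log ht.ne').eventually (lt_mem_nhds hl)] with s hs
    rw [modelKernel_of_two_le α κ0 κinf hs.le, sub_self]

theorem Reg.abs_mul_le {N : ℕ} {α κ0 κinf C : ℝ} {f : ℝ → ℝ} (hα : 0 < α)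
    (hf : Reg N α κ0 κinf C f) : 0 ≤ C ∧ ∀ τ, 0 < τ → |f τ| * τ ≤ C := by
  have h : ∀ τ, 0 < τ → |f τ| * τ ≤ C * (1 + |Real.log τ|) ^ (-α) := fun τ hτ => by
    simpa using hf.bound τ hτ 0 (Or.inl rfl)
  have hC : 0 ≤ C := by
    have := h 1 one_pos
    simp only [Real.log_one, abs_zero, add_zero, Real.one_rpow, mul_one] at this
    exact (abs_nonneg _).trans this
  refine ⟨hC, fun τ hτ => (h τ hτ).trans (mul_le_of_le_one_right hC ?_)⟩
  exact Real.rpow_le_one_of_one_le_of_nonpos (by linarith [abs_nonneg (Real.log τ)]) (by linarith)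

theorem negligible_zero (α : ℝ) : Negligible α fun _ => 0 := by
  intro ε hε
  filter_upwards [self_mem_nhdsWithin] with θ hθ
  have hθ : 0 < θ := hθ
  exact ⟨∅, by simp; positivity, fun u _ => by rw [norm_zero]; positivity⟩

theorem mul_le_of_isLittleO {α : ℝ} (hα : 0 < α) {g : ℝ → ℝ} {l : Filter ℝ}
    (hl0 : ∀ᶠ t in l, 0 < t) (hl : Tendsto (fun t => |Real.log t|) l atTop)
    (h : iteratedDerivWithin 0 g (Ioi 0) =o[l]
      fun t : ℝ => t ^ (-1 - ((0:ℕ):ℝ)) * (1 + Real.log t ^ 2) ^ (-α/2)) {ε : ℝ} (hε : 0 < ε) :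
    ∀ᶠ t in l, |g t| * t ≤ ε * |Real.log t| ^ (-α) := by
  rw [iteratedDerivWithin_zero] at h
  filter_upwards [hl0, hl.eventually_gt_atTop 0, h.def hε] with t ht hlt hb
  rw [Real.norm_eq_abs, Real.norm_of_nonneg (by positivity), Nat.cast_zero, sub_zero,
    Real.rpow_neg_one] at hb
  have h1 := one_add_sq_rpow_le hα hlt
  rw [sq_abs] at h1
  calc |g t| * t ≤ ε * (t⁻¹ * (1 + Real.log t ^ 2) ^ (-α / 2)) * t :=
        mul_le_mul_of_nonneg_right hb ht.le
    _ = ε * (1 + Real.log t ^ 2) ^ (-α / 2) := by field_simp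
    _ ≤ _ := mul_le_mul_of_nonneg_left h1 hε.le

theorem exists_remainder {α : ℝ} (hα : 0 < α) {h f : ℝ → ℝ} (hloc : LinftyLoc h)
    (hf : Measurable f) {C : ℝ} (hfb : ∀ τ, 0 < τ → |f τ| * τ ≤ C)
    (hd : ∀ ε, 0 < ε → ∃ R, ∀ τ, 0 < τ → R ≤ |Real.log τ| →
      |h τ - f τ| * τ ≤ ε * |Real.log τ| ^ (-α)) :
    ∃ r : ℝ → ℝ, Measurable r ∧ (∀ᵐ τ ∂muP, h τ = f τ + r τ) ∧
      (∃ M, 0 ≤ M ∧ ∀ τ, 0 < τ → |r τ| * τ ≤ M) ∧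
      ∀ ε, 0 < ε → ∃ R, ∀ τ, 0 < τ → R ≤ |Real.log τ| →
        |r τ| * τ ≤ ε * |Real.log τ| ^ (-α) := by
  obtain ⟨hm, hb⟩ := hloc
  have hn : ∀ n : ℕ, ∃ M, ∀ᵐ t ∂muP, t ∈ Icc (((n:ℝ) + 1)⁻¹) ((n:ℝ) + 1) → ‖h t‖ ≤ M :=
    fun n => hb _ isCompact_Icc fun t ht => lt_of_lt_of_le (by positivity) ht.1
  choose M hM using hn
  have hgood : ∀ᵐ t ∂muP, h t = hm.mk h t ∧
      ∀ n : ℕ, t ∈ Icc (((n:ℝ) + 1)⁻¹) ((n:ℝ) + 1) → ‖h t‖ ≤ M n :=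
    hm.ae_eq_mk.and (ae_all_iff.2 hM)
  obtain ⟨Z, hZ1, hZ2, hZ3⟩ := exists_measurable_superset_of_null (ae_iff.1 hgood)
  have hZ : ∀ t, t ∉ Z → h t = hm.mk h t ∧
      ∀ n : ℕ, t ∈ Icc (((n:ℝ) + 1)⁻¹) ((n:ℝ) + 1) → ‖h t‖ ≤ M n := fun t ht => by
    by_contra hc
    exact ht (hZ1 hc)
  have hrZ : ∀ t, t ∉ Z → Zᶜ.indicator (fun t => hm.mk h t - f t) t = h t - f t := fun t ht => by
    rw [indicator_of_mem (show t ∈ Zᶜ from ht), (hZ t ht).1]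
  have hr0 : ∀ t, t ∈ Z → Zᶜ.indicator (fun t => hm.mk h t - f t) t = 0 := fun t ht =>
    indicator_of_notMem (fun hc : t ∈ Zᶜ => hc ht) _
  have hsmall : ∀ ε, 0 < ε → ∃ R, ∀ τ, 0 < τ → R ≤ |Real.log τ| →
      |Zᶜ.indicator (fun t => hm.mk h t - f t) τ| * τ ≤ ε * |Real.log τ| ^ (-α) := by
    intro ε hε
    obtain ⟨R, hR⟩ := hd ε hε
    refine ⟨R, fun τ hτ hl => ?_⟩
    by_cases hz : τ ∈ Z
    · rw [hr0 τ hz, abs_zero, zero_mul]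
      positivity
    · rw [hrZ τ hz]
      exact hR τ hτ hl
  refine ⟨Zᶜ.indicator fun t => hm.mk h t - f t,
    (hm.stronglyMeasurable_mk.measurable.sub hf).indicator hZ2.compl, ?_, ?_, hsmall⟩
  · have : ∀ᵐ τ ∂muP, τ ∉ Z := measure_eq_zero_iff_ae_notMem.1 hZ3
    filter_upwards [this] with τ hτ
    rw [hrZ τ hτ]
    ring
  · obtain ⟨R, hR⟩ := hsmall 1 one_pos
    obtain ⟨K, hK, hKb⟩ := exists_log_bound hα
      (g := fun τ => Zᶜ.indicator (fun t => hm.mk h t - f t) τ * τ) (c := 1) (X := R)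
      (fun τ hτ hl => by rw [abs_mul, abs_of_pos hτ]; exact hR τ hτ hl) fun a b ha => by
        obtain ⟨n, hn⟩ := exists_nat_ge (a⁻¹ + |b|)
        refine ⟨|M n| * |b| + |C|, fun τ hτ => ?_⟩
        have hτ0 : 0 < τ := ha.trans_le hτ.1
        have ha' : 0 < a⁻¹ := by positivity
        rw [abs_mul, abs_of_pos hτ0]
        by_cases hz : τ ∈ Z
        · rw [hr0 τ hz, abs_zero, zero_mul]
          positivity
        · have h1 := (hZ τ hz).2 n ⟨by
            refine (inv_le_of_inv_le₀ ha ?_).trans hτ.1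
            linarith [abs_nonneg b], by linarith [hτ.2, le_abs_self b]⟩
          rw [hrZ τ hz]
          have h2 : |h τ - f τ| * τ ≤ |h τ| * τ + |f τ| * τ := by
            rw [← add_mul]
            exact mul_le_mul_of_nonneg_right (abs_sub _ _) hτ0.le
          have h3 : |h τ| * τ ≤ |M n| * |b| :=
            mul_le_mul (h1.trans (le_abs_self _)) (hτ.2.trans (le_abs_self _)) hτ0.le
              (abs_nonneg _)
          linarith [hfb τ hτ0, le_abs_self C]
    refine ⟨K, hK, fun τ hτ => ?_⟩
    have h1 := hKb τ hτ
    rw [abs_mul, abs_of_pos hτ] at h1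
    refine h1.trans (mul_le_of_le_one_right hK ?_)
    exact Real.rpow_le_one_of_one_le_of_nonpos (by linarith [abs_nonneg (Real.log τ)])
      (by linarith)

theorem exists_abs_log_ge_of_eventually {p : ℝ → Prop} (h0 : ∀ᶠ t in nhdsWithin 0 (Ioi 0), p t)
    (h1 : ∀ᶠ t in atTop, p t) : ∃ R, ∀ τ, 0 < τ → R ≤ |Real.log τ| → p τ := by
  obtain ⟨X0, hX0⟩ := exists_log_le_of_eventually h0
  obtain ⟨X1, hX1⟩ := exists_log_ge_of_eventually h1
  refine ⟨max X0 X1, fun τ hτ h => ?_⟩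
  rcases le_abs'.1 h with h | h
  · exact hX0 τ hτ (by linarith [le_max_left X0 X1])
  · exact hX1 τ hτ ((le_max_right _ _).trans h)

theorem posEig_hankel_asymp {α : ℝ} (hα : 0 < α) {h : ℝ → ℝ} (hloc : LinftyLoc h)
    (hreg : 1/2 ≤ α → ContDiffOn ℝ (Nal α) h (Set.Ioi 0)) {κ0 κinf : ℝ}
    (hzero : ∀ m : ℕ, m ≤ Nal α →
      iteratedDerivWithin m
          (fun t : ℝ => h t - κ0 * (t⁻¹ * Real.log (1/t) ^ (-α))) (Set.Ioi 0)
        =o[nhdsWithin 0 (Set.Ioi 0)]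
          fun t : ℝ => t ^ (-1 - (m:ℝ)) * (1 + Real.log t ^ 2) ^ (-α/2))
    (hinf : ∀ m : ℕ, m ≤ Nal α →
      iteratedDerivWithin m
          (fun t : ℝ => h t - κinf * (t⁻¹ * Real.log t ^ (-α))) (Set.Ioi 0)
        =o[atTop] fun t : ℝ => t ^ (-1 - (m:ℝ)) * (1 + Real.log t ^ 2) ^ (-α/2))
    {H : HSp →L[ℂ] HSp} (hH : IsHankel (fun t => ((h t : ℝ) : ℂ)) H) :
    (fun n : ℕ => posEig H n -
      tauC α * ((max κ0 0) ^ (1/α) + (max κinf 0) ^ (1/α)) ^ α * (n:ℝ) ^ (-α))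
        =o[atTop] fun n : ℕ => (n:ℝ) ^ (-α) := by
  have hlog : ∀ t : ℝ, Real.log (1 / t) = -1 * Real.log t := fun t => by
    rw [one_div, Real.log_inv, neg_one_mul]
  simp_rw [hlog] at hzero
  have hinf' : ∀ m : ℕ, m ≤ Nal α →
      iteratedDerivWithin m
          (fun t : ℝ => h t - κinf * (t⁻¹ * (1 * Real.log t) ^ (-α))) (Set.Ioi 0)
        =o[atTop] fun t : ℝ => t ^ (-1 - (m:ℝ)) * (1 + Real.log t ^ 2) ^ (-α/2) := by
    simp_rw [one_mul]
    exact hinf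
  rw [← weylV_rpow hα]
  rcases lt_or_ge α (1 / 2) with hα2 | hα2
  · obtain ⟨C, hC⟩ := exists_reg_modelKernel hα (by linarith) κ0 κinf
    obtain ⟨hC0, hfb⟩ := hC.abs_mul_le hα
    set f := (Ioi 0).indicator (modelKernel α κ0 κinf) with hf
    have hd : ∀ ε, 0 < ε → ∃ R, ∀ τ, 0 < τ → R ≤ |Real.log τ| →
        |h τ - f τ| * τ ≤ ε * |Real.log τ| ^ (-α) := by
      intro ε hε
      refine exists_abs_log_ge_of_eventually ?_ ?_
      · filter_upwards [mul_le_of_isLittleO hα self_mem_nhdsWithin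
          (tendsto_abs_atBot_atTop.comp Real.tendsto_log_nhdsGT_zero) (hzero 0 (Nat.zero_le _)) hε,
          self_mem_nhdsWithin,
          Real.tendsto_log_nhdsGT_zero.eventually (eventually_le_atBot (-2))] with t h1 h2 h3
        rwa [hf, indicator_of_mem h2, modelKernel_of_le_neg_two α κ0 κinf h3]
      · filter_upwards [mul_le_of_isLittleO hα (eventually_gt_atTop 0)
          (tendsto_abs_atTop_atTop.comp Real.tendsto_log_atTop) (hinf' 0 (Nat.zero_le _)) hε,
          eventually_gt_atTop 0,
          Real.tendsto_log_atTop.eventually (eventually_ge_atTop 2)] with t h1 h2 h3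
        rwa [hf, indicator_of_mem (show t ∈ Ioi (0:ℝ) from h2),
          modelKernel_of_two_le α κ0 κinf h3]
    obtain ⟨r, hr, hhr, ⟨M, hM, hrM⟩, hrs⟩ := exists_remainder hα hloc hC.meas hfb hd
    have hgb : ∀ τ, 0 < τ → |(f τ + r τ)| * τ ≤ C + M := fun τ hτ => by
      have := mul_le_mul_of_nonneg_right (abs_add_le (f τ) (r τ)) hτ.le
      rw [add_mul] at this
      linarith [hfb τ hτ, hrM τ hτ]
    refine hC.posEig_asymp hα (negligible_remainder hα hα2 hr hM hrM hrs) fun u => ?_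
    rw [re_inner_hankel (g := fun τ => f τ + r τ) hH (hC.meas.add hr) hhr (add_nonneg hC0 hM) hgb]
    rw [form_add (k := fun t s => f (t + s)) (l := fun t s => r (t + s)) (a := 0) (M := C + M)
      (measurable_add_kernel hC.meas) (measurable_add_kernel hr)
      (fun t s ht hs => abs_add_kernel_le (add_nonneg hC0 hM)
        (fun τ hτ => (hfb τ hτ).trans (le_add_of_nonneg_right hM)) ht hs)
      (fun t s ht hs => abs_add_kernel_le (add_nonneg hC0 hM)
        (fun τ hτ => (hrM τ hτ).trans (le_add_of_nonneg_left hC0)) ht hs) (Lp.memLp u)]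
  · have hN : Nal α = Nat.floor α + 1 := by rw [Nal, if_neg (not_lt.2 hα2)]
    obtain ⟨C, hC⟩ := exists_reg hα (N := Nal α) (by omega)
      (by rw [hN]; exact_mod_cast Nat.lt_floor_add_one α) (hreg hα2) hzero hinf'
    obtain ⟨hC0, hfb⟩ := hC.abs_mul_le hα
    refine hC.posEig_asymp hα (negligible_zero α) fun u => ?_
    rw [add_zero]
    refine re_inner_hankel hH hC.meas ?_ hC0 hfb u
    filter_upwards [ae_muP_pos] with τ hτ
    rw [indicator_of_mem (show τ ∈ Ioi (0:ℝ) from hτ)]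

theorem LinftyLoc.neg {h : ℝ → ℝ} (hh : LinftyLoc h) : LinftyLoc fun t => -h t := by
  refine ⟨hh.1.neg, fun K hK hK0 => ?_⟩
  simp_rw [norm_neg]
  exact hh.2 K hK hK0

theorem IsHankel.neg {h : ℝ → ℝ} {H : HSp →L[ℂ] HSp}
    (hH : IsHankel (fun t => ((h t : ℝ) : ℂ)) H) :
    IsHankel (fun t => ((-h t : ℝ) : ℂ)) (-H) := by
  intro u
  rw [neg_apply]
  filter_upwards [hH u, Lp.coeFn_neg (H u)] with t h1 h2
  rw [h2, Pi.neg_apply, h1, ← integral_neg]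
  simp

theorem isLittleO_iteratedDerivWithin_neg {h p w : ℝ → ℝ} {κ : ℝ} {l : Filter ℝ} {m : ℕ}
    (hh : iteratedDerivWithin m (fun t => h t - κ * p t) (Ioi 0) =o[l] w) :
    iteratedDerivWithin m (fun t => -h t - -κ * p t) (Ioi 0) =o[l] w := by
  have : (fun t => -h t - -κ * p t) = -fun t => h t - κ * p t := by
    ext t
    simp only [Pi.neg_apply]
    ring
  rw [this]
  refine hh.neg_left.congr_left fun t => ?_
  rw [iteratedDerivWithin_neg]

end Assembly

/-- Theorem `thm.d1` of the paper.  Eigenvalue asymptotics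
`λₙ^±(H) = a^± n^{-α} + o(n^{-α})`, `a^± = τ(α)((κ₀)_±^{1/α} + (κ_∞)_±^{1/α})^α`,
for the self-adjoint Hankel operator with real kernel `h` that behaves like
`κ₀ t^{-1}(log(1/t))^{-α}` at `t → 0` and like `κ_∞ t^{-1}(log t)^{-α}` at `t → ∞`. -/
theorem statement7 (α : ℝ) (hα : 0 < α) (h : ℝ → ℝ) (hloc : LinftyLoc h)
    (hreg : 1/2 ≤ α → ContDiffOn ℝ (Nal α) h (Set.Ioi 0))
    (κ0 κinf : ℝ)
    (hcondZero : ∀ m : ℕ, m ≤ Nal α →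
      iteratedDerivWithin m
          (fun t : ℝ => h t - κ0 * (t⁻¹ * Real.log (1/t) ^ (-α))) (Set.Ioi 0)
        =o[nhdsWithin 0 (Set.Ioi 0)]
          fun t : ℝ => t ^ (-1 - (m:ℝ)) * (1 + Real.log t ^ 2) ^ (-α/2))
    (hcondInf : ∀ m : ℕ, m ≤ Nal α →
      iteratedDerivWithin m
          (fun t : ℝ => h t - κinf * (t⁻¹ * Real.log t ^ (-α))) (Set.Ioi 0)
        =o[atTop] fun t : ℝ => t ^ (-1 - (m:ℝ)) * (1 + Real.log t ^ 2) ^ (-α/2))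
    (H : HSp →L[ℂ] HSp) (hH : IsHankel (fun t => ((h t : ℝ) : ℂ)) H)
    (aP aM : ℝ)
    (haP : aP = tauC α * ((max κ0 0) ^ (1/α) + (max κinf 0) ^ (1/α)) ^ α)
    (haM : aM = tauC α * ((max (-κ0) 0) ^ (1/α) + (max (-κinf) 0) ^ (1/α)) ^ α) :
    ((fun nn : ℕ => posEig H nn - aP * (nn:ℝ) ^ (-α)) =o[atTop] fun nn : ℕ => (nn:ℝ) ^ (-α)) ∧
    ((fun nn : ℕ => negEig H nn - aM * (nn:ℝ) ^ (-α)) =o[atTop] fun nn : ℕ => (nn:ℝ) ^ (-α)) := by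
  subst haP haM
  refine ⟨posEig_hankel_asymp hα hloc hreg hcondZero hcondInf hH, ?_⟩
  exact posEig_hankel_asymp hα hloc.neg (fun h => (hreg h).neg)
    (fun m hm => isLittleO_iteratedDerivWithin_neg (hcondZero m hm))
    (fun m hm => isLittleO_iteratedDerivWithin_neg (hcondInf m hm)) hH.neg
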